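/- arXiv:2110.11876 — 3 statements merged into one kernel-verified Lean document; each statement's English description precedes it below -/
import Mathlib

section
/- There exist absolute constants c, c' > 0 such that the following holds. Let d, m, n be positive integers, ε > 0, 0 < α ≤ 1, and δ ≥ 0 with δ ≤ c·(ε·α)/(d²·√m). Let M be a Markov kernel assigning to each dataset X = (X_{i,k})_{i∈[n], k∈[d]} ∈ (ℕ^d)ⁿ a Borel probability measure M(X) on ℝ^d that is supported on the box [1/(2d), 3/(2d)]^d, and suppose M is (ε,δ) user-level differentially private, where user i holds the row (X_{i,1},…,X_{i,d}). Consider the joint distribution in which p = (p₁,…,p_d) has i.i.d. coordinates uniform on [1/(2d), 3/(2d)], conditionally on p the entries X_{i,k} are mutually independent with X_{i,k} ~ Poisson(m·p_k), and conditionally on X the output θ is drawn from M(X). If E[‖θ − p‖₂²] ≤ α²/(24·d), then n ≥ c'·d/(α·ε·√m). -/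
open MeasureTheory
open scoped ENNReal

/-- The probability mass function of the Poisson distribution with rate `lam` at `k`. -/
noncomputable def poisPMF (lam : ℝ) (k : ℕ) : ℝ :=
  Real.exp (-lam) * lam ^ k / (Nat.factorial k : ℝ)

namespace PL
open ProbabilityTheory

section partA



lemma hasSum_mean (r : ℝ) : HasSum (fun n : ℕ => Real.exp (-r) * r ^ n / (n.factorial : ℝ) * n) r := by
  have h := (NormedSpace.expSeries_div_hasSum_exp r).mul_left (Real.exp (-r) * r)
  rw [← hasSum_nat_add_iff' 1]
  simp only [Finset.range_one, Finset.sum_singleton, Nat.cast_zero, mul_zero, sub_zero]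
  convert! h using 1
  · ext n
    rw [Nat.factorial_succ]
    have : (n.factorial : ℝ) ≠ 0 := by positivity
    push_cast
    field_simp
    ring
  · rw [← Real.exp_eq_exp_ℝ, mul_right_comm, ← Real.exp_add]; simp

lemma hasSum_fact2 (r : ℝ) : HasSum (fun n : ℕ => Real.exp (-r) * r ^ n / (n.factorial : ℝ) * (n * n)) (r * (r + 1)) := by
  have h := ((hasSum_mean r).mul_left r).add ((NormedSpace.expSeries_div_hasSum_exp r).mul_left (Real.exp (-r) * r))
  rw [← hasSum_nat_add_iff' 1]
  simp only [Finset.range_one, Finset.sum_singleton, Nat.cast_zero, mul_zero, sub_zero]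
  convert! h using 1
  · ext n
    rw [Nat.factorial_succ]
    have : (n.factorial : ℝ) ≠ 0 := by positivity
    push_cast
    field_simp
    ring
  · rw [← Real.exp_eq_exp_ℝ, mul_right_comm, ← Real.exp_add]; simp; ring

variable (r : NNReal)

lemma integrable_nat : Integrable (fun n : ℕ => (n : ℝ)) (poissonMeasure r) := by
  rw [integrable_poissonMeasure_iff]
  simpa using (hasSum_mean r).summable

lemma integral_nat : ∫ n : ℕ, (n : ℝ) ∂(poissonMeasure r) = r := by
  rw [integral_poissonMeasure]
  simpa using (hasSum_mean r).tsum_eq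

lemma integrable_nat2 : Integrable (fun n : ℕ => (n : ℝ) * n) (poissonMeasure r) := by
  rw [integrable_poissonMeasure_iff]
  simpa using (hasSum_fact2 r).summable

lemma integral_nat2 : ∫ n : ℕ, (n : ℝ) * n ∂(poissonMeasure r) = r * (r + 1) := by
  rw [integral_poissonMeasure]
  simpa using (hasSum_fact2 r).tsum_eq

lemma hasSum_mgf (r u : ℝ) : HasSum (fun n : ℕ => Real.exp (-r) * r ^ n / (n.factorial : ℝ) * Real.exp (u * n))
    (Real.exp (r * (Real.exp u - 1))) := by
  have h := (NormedSpace.expSeries_div_hasSum_exp (r * Real.exp u)).mul_left (Real.exp (-r))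
  convert! h using 1
  · ext n
    rw [mul_pow, ← Real.exp_nat_mul]
    ring_nf
  · rw [← Real.exp_eq_exp_ℝ, ← Real.exp_add]; ring_nf

lemma integrable_mgf (u : ℝ) : Integrable (fun n : ℕ => Real.exp (u * n)) (poissonMeasure r) := by
  rw [integrable_poissonMeasure_iff]
  simpa using (hasSum_mgf r u).summable

lemma integral_mgf (u : ℝ) : ∫ n : ℕ, Real.exp (u * n) ∂(poissonMeasure r) = Real.exp (r * (Real.exp u - 1)) := by
  rw [integral_poissonMeasure]
  simpa using (hasSum_mgf r u).tsum_eq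

/-- centred and scaled coordinate -/
noncomputable def z (m p : ℝ) (x : ℕ) : ℝ := (x : ℝ) / p - m

section coord
variable {m p : ℝ}

noncomputable def pm (m p : ℝ) : Measure ℕ := poissonMeasure (Real.toNNReal (m * p))

instance : IsProbabilityMeasure (pm m p) := by unfold pm; infer_instance

lemma pm_singleton (hr : 0 ≤ m * p) (x : ℕ) : (pm m p).real {x} = poisPMF (m * p) x := by
  unfold pm poisPMF
  rw [poissonMeasure_real_singleton, Real.coe_toNNReal _ hr]

lemma integrable_z : Integrable (z m p) (pm m p) :=
  ((integrable_nat _).div_const p).sub (integrable_const _)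

lemma integrable_z2 : Integrable (fun x => z m p x ^ 2) (pm m p) := by
  have h : (fun x => z m p x ^ 2) = fun x : ℕ => ((x : ℝ) * x) * (1 / p ^ 2) - (x : ℝ) * (2 * m / p) + m ^ 2 := by
    ext x; unfold z; ring
  rw [h]
  exact (((integrable_nat2 _).mul_const _).sub ((integrable_nat _).mul_const _)).add (integrable_const _)

lemma memLp_z : MemLp (z m p) 2 (pm m p) :=
  (memLp_two_iff_integrable_sq (Measurable.of_discrete.aestronglyMeasurable)).2 integrable_z2

lemma integral_z (hm : 0 ≤ m) (hp : 0 < p) : ∫ x, z m p x ∂(pm m p) = 0 := by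
  unfold z pm
  rw [integral_sub ((integrable_nat _).div_const p) (integrable_const _), integral_div]
  rw [integral_nat, Real.coe_toNNReal _ (by positivity)]
  simp; field_simp; ring

lemma integral_z2 (hm : 0 ≤ m) (hp : 0 < p) : ∫ x, z m p x ^ 2 ∂(pm m p) = m / p := by
  have h : (fun x => z m p x ^ 2) = fun x : ℕ => ((x : ℝ) * x) * (1 / p ^ 2) - (x : ℝ) * (2 * m / p) + m ^ 2 := by
    ext x; unfold z; ring
  unfold pm
  have h1 : Integrable (fun x : ℕ => ((x : ℝ) * x) * (1 / p ^ 2) - (x : ℝ) * (2 * m / p)) (poissonMeasure (m * p).toNNReal) :=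
    ((integrable_nat2 _).mul_const _).sub ((integrable_nat _).mul_const _)
  rw [h, integral_add h1 (integrable_const _),
    integral_sub ((integrable_nat2 _).mul_const _) ((integrable_nat _).mul_const _), integral_mul_const, integral_mul_const]
  rw [integral_nat, integral_nat2, Real.coe_toNNReal _ (by positivity)]
  simp; field_simp; ring

lemma integral_abs_z (hm : 0 ≤ m) (hp : 0 < p) : ∫ x, |z m p x| ∂(pm m p) ≤ 2 * m := by
  calc ∫ x, |z m p x| ∂(pm m p) ≤ ∫ x : ℕ, (x : ℝ) / p + m ∂(pm m p) := by
        apply integral_mono integrable_z.abs (((integrable_nat _).div_const p).add (integrable_const _))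
        intro x
        refine (abs_sub _ _).trans ?_
        rw [abs_of_nonneg (by positivity), abs_of_nonneg hm]
        exact le_refl _
    _ = 2 * m := by
        unfold pm
        rw [integral_add ((integrable_nat _).div_const p) (integrable_const _), integral_div]
        rw [integral_nat, Real.coe_toNNReal _ (by positivity)]
        simp; field_simp; ring

lemma integrable_expz (s : ℝ) : Integrable (fun x => Real.exp (s * z m p x)) (pm m p) := by
  have h : (fun x => Real.exp (s * z m p x)) = fun x : ℕ => Real.exp (s / p * x) * Real.exp (- s * m) := by
    ext x; rw [← Real.exp_add]; unfold z; ring_nf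
  rw [h]
  exact (integrable_mgf _ _).mul_const _

lemma integral_expz (hm : 0 ≤ m) (hp : 0 < p) (s : ℝ) (hs : |s| ≤ p) :
    ∫ x, Real.exp (s * z m p x) ∂(pm m p) ≤ Real.exp (m * s ^ 2 / p) := by
  have h : (fun x => Real.exp (s * z m p x)) = fun x : ℕ => Real.exp (s / p * x) * Real.exp (- s * m) := by
    ext x; rw [← Real.exp_add]; unfold z; ring_nf
  rw [h, integral_mul_const]
  unfold pm
  rw [integral_mgf, Real.coe_toNNReal _ (by positivity), ← Real.exp_add]
  have hu : |s / p| ≤ 1 := by rw [abs_div, abs_of_pos hp]; exact (div_le_one hp).2 hs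
  have := (abs_le.1 (Real.abs_exp_sub_one_sub_id_le hu)).2
  apply Real.exp_le_exp.2
  have h2 : m * p * (Real.exp (s/p) - 1 - s / p) ≤ m * p * (s/p)^2 := by gcongr
  have e1 : m * p * (Real.exp (s/p) - 1) + -s * m = m * p * (Real.exp (s/p) - 1 - s / p) := by
    field_simp
    ring
  have e2 : m * p * (s/p)^2 = m * s ^ 2 / p := by field_simp
  linarith
end coord

end partA

section partB
section dp
variable {Θ : Type*} [MeasurableSpace Θ]

lemma integrable_of_bdd {μ : Measure Θ} [IsFiniteMeasure μ] {g : Θ → ℝ} (hg : Measurable g)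
    {B : ℝ} (hb : ∀ᵐ θ ∂μ, |g θ| ≤ B) : Integrable g μ :=
  Integrable.of_bound hg.aestronglyMeasurable B (by simpa using hb)

lemma dp_integral {μ₁ μ₂ : Measure Θ} [IsProbabilityMeasure μ₁] [IsProbabilityMeasure μ₂]
    {ε δ : ℝ} (hδ : 0 ≤ δ)
    (h : ∀ S, MeasurableSet S → μ₁ S ≤ ENNReal.ofReal (Real.exp ε) * μ₂ S + ENNReal.ofReal δ)
    {g : Θ → ℝ} (hg : Measurable g) (hg0 : ∀ θ, 0 ≤ g θ) {B : ℝ}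
    (h1 : ∀ᵐ θ ∂μ₁, g θ ≤ B) (h2 : ∀ᵐ θ ∂μ₂, g θ ≤ B) :
    ∫ θ, g θ ∂μ₁ ≤ Real.exp ε * ∫ θ, g θ ∂μ₂ + δ * B := by
  have hB : 0 ≤ B := by
    obtain ⟨θ, hθ⟩ := h1.exists
    exact (hg0 θ).trans hθ
  have i1 : Integrable g μ₁ := integrable_of_bdd hg (h1.mono fun θ hθ => by rwa [abs_of_nonneg (hg0 θ)])
  have i2 : Integrable g μ₂ := integrable_of_bdd hg (h2.mono fun θ hθ => by rwa [abs_of_nonneg (hg0 θ)])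
  have key : ∫⁻ θ, ENNReal.ofReal (g θ) ∂μ₁ ≤
      ENNReal.ofReal (Real.exp ε) * ∫⁻ θ, ENNReal.ofReal (g θ) ∂μ₂ + ENNReal.ofReal δ * ENNReal.ofReal B := by
    rw [lintegral_eq_lintegral_meas_lt μ₁ (Filter.Eventually.of_forall hg0) hg.aemeasurable,
      lintegral_eq_lintegral_meas_lt μ₂ (Filter.Eventually.of_forall hg0) hg.aemeasurable]
    have hmeas : Measurable fun t : ℝ => μ₂ {a | t < g a} :=
      Antitone.measurable (fun s t hst => measure_mono (fun a ha => lt_of_le_of_lt hst ha))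
    calc ∫⁻ t in Set.Ioi (0:ℝ), μ₁ {a | t < g a}
        ≤ ∫⁻ t in Set.Ioi (0:ℝ), (ENNReal.ofReal (Real.exp ε) * μ₂ {a | t < g a} +
            (Set.Ioo 0 B).indicator (fun _ => ENNReal.ofReal δ) t) := by
          apply setLIntegral_mono' measurableSet_Ioi
          intro t ht
          by_cases htB : t < B
          · rw [Set.indicator_of_mem (show t ∈ Set.Ioo 0 B from ⟨ht, htB⟩)]
            exact h _ (measurableSet_lt measurable_const hg)
          · have : μ₁ {a | t < g a} = 0 := by
              refine measure_mono_null ?_ (ae_iff.1 h1)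
              intro a ha
              simp only [Set.mem_setOf_eq, not_le] at ha ⊢
              linarith [not_lt.1 htB]
            rw [this]; exact zero_le'
      _ ≤ _ := by
          rw [lintegral_add_left (hmeas.const_mul _), lintegral_const_mul _ hmeas]
          gcongr
          calc _ ≤ ∫⁻ t, (Set.Ioo 0 B).indicator (fun _ => ENNReal.ofReal δ) t :=
                setLIntegral_le_lintegral _ _
            _ = _ := by
                rw [lintegral_indicator measurableSet_Ioo]; simp
  rw [integral_eq_lintegral_of_nonneg_ae (Filter.Eventually.of_forall hg0) hg.aestronglyMeasurable,
    integral_eq_lintegral_of_nonneg_ae (Filter.Eventually.of_forall hg0) hg.aestronglyMeasurable]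
  have n1 : ∫⁻ θ, ENNReal.ofReal (g θ) ∂μ₂ ≠ ⊤ := by
    have := i2.lintegral_lt_top; exact this.ne
  have := ENNReal.toReal_mono (by finiteness) key
  rw [ENNReal.toReal_add (by finiteness) (by finiteness), ENNReal.toReal_mul, ENNReal.toReal_mul,
    ENNReal.toReal_ofReal (Real.exp_pos _).le, ENNReal.toReal_ofReal hδ, ENNReal.toReal_ofReal hB] at this
  exact this

variable {α : Type*} [MeasurableSpace α] [Countable α] [MeasurableSingletonClass α] {n : ℕ}

lemma swap_mp (ρ : Measure α) [IsProbabilityMeasure ρ] (i : Fin n) :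
    MeasurePreserving (fun q : (Fin n → α) × α => (Function.update q.1 i q.2, q.1 i))
      ((Measure.pi fun _ => ρ).prod ρ) ((Measure.pi fun _ => ρ).prod ρ) := by
  refine ⟨Measurable.of_discrete, ?_⟩
  apply Measure.ext_of_singleton
  rintro ⟨X, y⟩
  rw [Measure.map_apply Measurable.of_discrete (measurableSet_singleton _)]
  have : (fun q : (Fin n → α) × α => (Function.update q.1 i q.2, q.1 i)) ⁻¹' {(X, y)} =
      {(Function.update X i y, X i)} := by
    ext ⟨X', y'⟩
    simp only [Set.mem_preimage, Set.mem_singleton_iff, Prod.mk.injEq]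
    constructor
    · rintro ⟨rfl, rfl⟩; simp
    · rintro ⟨rfl, rfl⟩; simp
  rw [this]
  rw [← Set.singleton_prod_singleton, ← Set.singleton_prod_singleton, Measure.prod_prod, Measure.prod_prod,
    Measure.pi_singleton, Measure.pi_singleton]
  rw [← Finset.mul_prod_erase _ _ (Finset.mem_univ i), ← Finset.mul_prod_erase _ (fun j => ρ {X j}) (Finset.mem_univ i)]
  have : ∏ x ∈ Finset.univ.erase i, ρ {Function.update X i y x} = ∏ x ∈ Finset.univ.erase i, ρ {X x} := by
    apply Finset.prod_congr rfl
    intro x hx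
    rw [Function.update_of_ne (Finset.ne_of_mem_erase hx)]
  rw [this]
  simp only [Function.update_self]
  ring

/-- Comparison of the real world and the resampled world. -/
lemma dp_row (ρ : Measure α) [IsProbabilityMeasure ρ] (M : (Fin n → α) → Measure Θ)
    [∀ X, IsProbabilityMeasure (M X)] {ε δ : ℝ} (hδ : 0 ≤ δ)
    (hdp : ∀ X X' : Fin n → α, (∃ i₀, ∀ i, i ≠ i₀ → X i = X' i) → ∀ S, MeasurableSet S →
      M X S ≤ ENNReal.ofReal (Real.exp ε) * M X' S + ENNReal.ofReal δ)
    (g : α → Θ → ℝ) (hg : ∀ y, Measurable (g y)) (hg0 : ∀ y θ, 0 ≤ g y θ)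
    (Z : α → ℝ) (hZ : Integrable Z ρ) (hgZ : ∀ X y, ∀ᵐ θ ∂(M X), g y θ ≤ Z y) (i : Fin n) :
    (∫ X, ∫ θ, g (X i) θ ∂(M X) ∂(Measure.pi fun _ => ρ) ≤
      Real.exp ε * ∫ X, ∫ y, ∫ θ, g y θ ∂(M X) ∂ρ ∂(Measure.pi fun _ => ρ) + δ * ∫ y, Z y ∂ρ) ∧
    (∫ X, ∫ y, ∫ θ, g y θ ∂(M X) ∂ρ ∂(Measure.pi fun _ => ρ) ≤
      Real.exp ε * ∫ X, ∫ θ, g (X i) θ ∂(M X) ∂(Measure.pi fun _ => ρ) + δ * ∫ y, Z y ∂ρ) := by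
  set Q : Measure (Fin n → α) := Measure.pi fun _ => ρ with hQ
  set I : α → (Fin n → α) → ℝ := fun y X => ∫ θ, g y θ ∂(M X) with hI
  have hI0 : ∀ y X, 0 ≤ I y X := fun y X => integral_nonneg (hg0 y)
  have hIZ : ∀ y X, I y X ≤ Z y := by
    intro y X
    calc I y X ≤ ∫ θ, Z y ∂(M X) := by
          apply integral_mono_ae _ (integrable_const _) (hgZ X y)
          exact integrable_of_bdd (hg y) ((hgZ X y).mono fun θ h => by rwa [abs_of_nonneg (hg0 y θ)])
      _ = Z y := by simp
  have iZ : Integrable (fun X : Fin n → α => Z (X i)) Q := integrable_comp_eval hZ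
  have iA : Integrable (fun X => I (X i) X) Q :=
    iZ.mono' Measurable.of_discrete.aestronglyMeasurable
      (Filter.Eventually.of_forall fun X => by rw [Real.norm_of_nonneg (hI0 _ _)]; exact hIZ _ _)
  have iZ1 : Integrable (fun q : (Fin n → α) × α => Z (q.1 i)) (Q.prod ρ) := iZ.comp_fst ρ
  have iZ2 : Integrable (fun q : (Fin n → α) × α => Z q.2) (Q.prod ρ) := hZ.comp_snd Q
  have iB : Integrable (fun q : (Fin n → α) × α => I q.2 q.1) (Q.prod ρ) :=
    iZ2.mono' Measurable.of_discrete.aestronglyMeasurable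
      (Filter.Eventually.of_forall fun X => by rw [Real.norm_of_nonneg (hI0 _ _)]; exact hIZ _ _)
  have iC : Integrable (fun q : (Fin n → α) × α => I (q.1 i) (Function.update q.1 i q.2)) (Q.prod ρ) :=
    iZ1.mono' Measurable.of_discrete.aestronglyMeasurable
      (Filter.Eventually.of_forall fun X => by rw [Real.norm_of_nonneg (hI0 _ _)]; exact hIZ _ _)
  have iA1 : Integrable (fun q : (Fin n → α) × α => I (q.1 i) q.1) (Q.prod ρ) := iA.comp_fst ρ
  have eC : ∫ q, I (q.1 i) (Function.update q.1 i q.2) ∂(Q.prod ρ) = ∫ q, I q.2 q.1 ∂(Q.prod ρ) := by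
    have hs := swap_mp ρ i (n := n)
    rw [← hQ] at hs
    conv_rhs => rw [← hs.map_eq]
    rw [integral_map Measurable.of_discrete.aemeasurable Measurable.of_discrete.aestronglyMeasurable]
  have eB : ∫ X, ∫ y, ∫ θ, g y θ ∂(M X) ∂ρ ∂Q = ∫ q, I q.2 q.1 ∂(Q.prod ρ) := by
    rw [integral_prod _ iB]
  have eA : ∫ X, ∫ θ, g (X i) θ ∂(M X) ∂Q = ∫ q, I (q.1 i) q.1 ∂(Q.prod ρ) := by
    rw [integral_prod _ iA1]; simp [hI]
  have eZ : ∫ y, Z y ∂ρ = ∫ q, Z (q.1 i) ∂(Q.prod ρ) := by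
    rw [integral_prod _ iZ1]; simp only [integral_const, probReal_univ, one_smul]
    exact (integral_comp_eval (μ := fun _ : Fin n => ρ) (i := i) hZ.aestronglyMeasurable).symm
  rw [eB, eA, eZ, ← eC]
  have nb : ∀ (X : Fin n → α) y, ∀ j, j ≠ i → X j = Function.update X i y j := by
    intro X y j hj
    rw [Function.update_of_ne hj]
  constructor
  · rw [← integral_const_mul, ← integral_const_mul, ← integral_add (iC.const_mul _) (iZ1.const_mul _)]
    apply integral_mono iA1 ((iC.const_mul _).add (iZ1.const_mul _))
    intro q
    exact dp_integral hδ (hdp _ _ ⟨i, nb _ _⟩) (hg _) (hg0 _) (hgZ _ _) (hgZ _ _)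
  · rw [← integral_const_mul, ← integral_const_mul, ← integral_add (iA1.const_mul _) (iZ1.const_mul _)]
    apply integral_mono iC ((iA1.const_mul _).add (iZ1.const_mul _))
    intro q
    exact dp_integral hδ (hdp _ _ ⟨i, fun j hj => (nb _ _ j hj).symm⟩) (hg _) (hg0 _) (hgZ _ _) (hgZ _ _)

end dp

section row
variable {d n : ℕ}

/-- law of one row -/
noncomputable def row (m : ℝ) (p : Fin d → ℝ) : Measure (Fin d → ℕ) := Measure.pi fun k => pm m (p k)

noncomputable instance (m : ℝ) (p : Fin d → ℝ) : IsProbabilityMeasure (row m p) := by unfold row; infer_instance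

noncomputable def L (m : ℝ) (p c : Fin d → ℝ) (y : Fin d → ℕ) : ℝ := ∑ k, c k * z m (p k) (y k)

variable {m : ℝ} {p : Fin d → ℝ}

lemma integrable_zrow (k : Fin d) : Integrable (fun y : Fin d → ℕ => z m (p k) (y k)) (row m p) :=
  integrable_comp_eval (μ := fun k => pm m (p k)) (i := k) integrable_z

lemma integral_zrow (hm : 0 ≤ m) (hp : ∀ k, 0 < p k) (k : Fin d) :
    ∫ y : Fin d → ℕ, z m (p k) (y k) ∂(row m p) = 0 := by
  rw [row, integral_comp_eval (μ := fun k => pm m (p k)) (i := k) (f := z m (p k)) integrable_z.aestronglyMeasurable]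
  exact integral_z hm (hp k)

lemma integral_abs_zrow (hm : 0 ≤ m) (hp : ∀ k, 0 < p k) (k : Fin d) :
    ∫ y : Fin d → ℕ, |z m (p k) (y k)| ∂(row m p) ≤ 2 * m := by
  rw [row, integral_comp_eval (μ := fun k => pm m (p k)) (i := k) (f := fun x => |z m (p k) x|) integrable_z.abs.aestronglyMeasurable]
  exact integral_abs_z hm (hp k)

lemma integrable_L (c : Fin d → ℝ) : Integrable (L m p c) (row m p) :=
  integrable_finsetSum _ fun k _ => (integrable_zrow k).const_mul _

lemma integral_L (hm : 0 ≤ m) (hp : ∀ k, 0 < p k) (c : Fin d → ℝ) : ∫ y, L m p c y ∂(row m p) = 0 := by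
  unfold L
  rw [integral_finsetSum _ fun k _ => (integrable_zrow k).const_mul _]
  apply Finset.sum_eq_zero
  intro k _
  rw [integral_const_mul, integral_zrow hm hp, mul_zero]

lemma memLp_L (c : Fin d → ℝ) : MemLp (L m p c) 2 (row m p) := by
  apply memLp_finsetSum
  intro k _
  exact (memLp_z.comp_measurePreserving (measurePreserving_eval (fun k => pm m (p k)) k)).const_mul _

lemma integral_L2 (hm : 0 ≤ m) (hp : ∀ k, 0 < p k) (c : Fin d → ℝ) :
    ∫ y, L m p c y ^ 2 ∂(row m p) = ∑ k, c k ^ 2 * (m / p k) := by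
  have h := variance_sum_pi (μ := fun k => pm m (p k)) (X := fun k x => c k * z m (p k) x)
    (fun k => memLp_z.const_mul _)
  have e : (∑ k, fun ω : Fin d → ℕ => c k * z m (p k) (ω k)) = L m p c := by
    ext y; simp [L]
  rw [e] at h
  rw [← variance_of_integral_eq_zero (memLp_L c).aestronglyMeasurable.aemeasurable (integral_L hm hp c), row, h]
  apply Finset.sum_congr rfl
  intro k _
  rw [variance_const_mul, variance_of_integral_eq_zero integrable_z.aemeasurable (integral_z hm (hp k)), integral_z2 hm (hp k)]

lemma exp_L (c : Fin d → ℝ) (y) : Real.exp (L m p c y) = ∏ k, Real.exp (c k * z m (p k) (y k)) := by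
  rw [L, Real.exp_sum]

lemma integrable_expL (c : Fin d → ℝ) : Integrable (fun y => Real.exp (L m p c y)) (row m p) := by
  simp_rw [exp_L]
  exact Integrable.fintype_prod (f := fun k x => Real.exp (c k * z m (p k) x)) (fun k => integrable_expz (c k))

lemma integral_expL (hm : 0 ≤ m) (hp : ∀ k, 0 < p k) (c : Fin d → ℝ) (hc : ∀ k, |c k| ≤ p k) :
    ∫ y, Real.exp (L m p c y) ∂(row m p) ≤ Real.exp (∑ k, m * c k ^ 2 / p k) := by
  simp_rw [exp_L]
  rw [row, integral_fintype_prod_eq_prod (fun k x => Real.exp (c k * z m (p k) x)), Real.exp_sum]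
  apply Finset.prod_le_prod
  · intro k _; exact integral_nonneg fun x => (Real.exp_pos _).le
  · intro k _; exact integral_expz hm (hp k) _ (hc k)

/-- law of the data set -/
noncomputable def dat (n : ℕ) (m : ℝ) (p : Fin d → ℝ) : Measure (Fin n → Fin d → ℕ) := Measure.pi fun _ => row m p

noncomputable instance (m : ℝ) (p : Fin d → ℝ) : IsProbabilityMeasure (dat n m p) := by unfold dat; infer_instance

lemma memLp_SL (c : Fin d → ℝ) : MemLp (fun X : Fin n → Fin d → ℕ => ∑ i, L m p c (X i)) 2 (dat n m p) := by
  apply memLp_finsetSum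
  intro i _
  exact ((memLp_L c).comp_measurePreserving (measurePreserving_eval (fun _ : Fin n => row m p) i))

lemma integrable_Lrow (c : Fin d → ℝ) (i : Fin n) : Integrable (fun X : Fin n → Fin d → ℕ => L m p c (X i)) (dat n m p) :=
  integrable_comp_eval (μ := fun _ : Fin n => row m p) (i := i) (integrable_L c)

lemma integral_Lrow (hm : 0 ≤ m) (hp : ∀ k, 0 < p k) (c : Fin d → ℝ) (i : Fin n) :
    ∫ X : Fin n → Fin d → ℕ, L m p c (X i) ∂(dat n m p) = 0 := by
  rw [dat, integral_comp_eval (μ := fun _ : Fin n => row m p) (i := i) (integrable_L c).aestronglyMeasurable]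
  exact integral_L hm hp c

lemma integral_SL2 (hm : 0 ≤ m) (hp : ∀ k, 0 < p k) (c : Fin d → ℝ) :
    ∫ X : Fin n → Fin d → ℕ, (∑ i, L m p c (X i)) ^ 2 ∂(dat n m p) = n * ∑ k, c k ^ 2 * (m / p k) := by
  have h := variance_sum_pi (μ := fun _ : Fin n => row m p) (X := fun _ y => L m p c y)
    (fun k => memLp_L c)
  have e : (∑ i, fun ω : Fin n → Fin d → ℕ => L m p c (ω i)) = fun X => ∑ i, L m p c (X i) := by
    ext y; simp
  rw [e] at h
  have h0 : ∫ X : Fin n → Fin d → ℕ, (∑ i, L m p c (X i)) ∂(dat n m p) = 0 := by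
    rw [integral_finsetSum _ fun i _ => integrable_Lrow c i]
    exact Finset.sum_eq_zero fun i _ => integral_Lrow hm hp c i
  rw [← variance_of_integral_eq_zero (memLp_SL c).aestronglyMeasurable.aemeasurable h0, dat, h,
    variance_of_integral_eq_zero (integrable_L c).aemeasurable (integral_L hm hp c), integral_L2 hm hp]
  simp

end row

end partB

section partC
lemma abs_integral_le {Ω : Type*} [MeasurableSpace Ω] {μ : Measure Ω} [IsProbabilityMeasure μ] {g : Ω → ℝ} {B : ℝ}
    (hb : ∀ᵐ θ ∂μ, |g θ| ≤ B) : |∫ θ, g θ ∂μ| ≤ B := by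
  have := norm_integral_le_of_norm_le_const (μ := μ) (f := g) (C := B) (by simpa using hb)
  simpa using this

abbrev EE (d : ℕ) := EuclideanSpace ℝ (Fin d)

structure Ctx (d n : ℕ) (m : ℝ) (p w : Fin d → ℝ) (M : (Fin n → Fin d → ℕ) → Measure (EE d)) : Prop where
  hd : 1 ≤ d
  hm : 0 ≤ m
  hp : ∀ k, p k ∈ Set.Icc (1 / (2 * (d : ℝ))) (3 / (2 * (d : ℝ)))
  hw0 : ∀ k, 0 ≤ w k
  hw : ∀ k, w k ≤ 1 / (4 * (d : ℝ) ^ 2)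
  hM : ∀ X, IsProbabilityMeasure (M X)
  hbox : ∀ X, ∀ᵐ θ ∂(M X), ∀ k, θ k ∈ Set.Icc (1 / (2 * (d : ℝ))) (3 / (2 * (d : ℝ)))

noncomputable def cof {d : ℕ} (p w : Fin d → ℝ) (θ : EE d) (k : Fin d) : ℝ := w k * (θ k - p k)

noncomputable def sq {d : ℕ} (p : Fin d → ℝ) (θ : EE d) : ℝ := ∑ k, (θ k - p k) ^ 2

noncomputable def ZZ {d : ℕ} (m : ℝ) (p : Fin d → ℝ) (y : Fin d → ℕ) : ℝ :=
  ∑ k, 1 / (4 * (d : ℝ) ^ 3) * |z m (p k) (y k)|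

/-- the risk at `p` -/
noncomputable def R {d n : ℕ} (m : ℝ) (p : Fin d → ℝ) (M : (Fin n → Fin d → ℕ) → Measure (EE d)) : ℝ :=
  ∫ X, ∫ θ, sq p θ ∂(M X) ∂(dat n m p)

/-- the total correlation at `p` -/
noncomputable def T {d n : ℕ} (m : ℝ) (p w : Fin d → ℝ) (M : (Fin n → Fin d → ℕ) → Measure (EE d)) : ℝ :=
  ∫ X, ∫ θ, ∑ i, L m p (cof p w θ) (X i) ∂(M X) ∂(dat n m p)

namespace Ctx
variable {d n : ℕ} {m : ℝ} {p w : Fin d → ℝ} {M : (Fin n → Fin d → ℕ) → Measure (EE d)}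

lemma dpos (h : Ctx d n m p w M) : (0:ℝ) < d := by
  have := h.hd; exact_mod_cast this

lemma ppos (h : Ctx d n m p w M) (k : Fin d) : 0 < p k := by
  have := h.dpos
  exact lt_of_lt_of_le (by positivity) (h.hp k).1

lemma diff_le (h : Ctx d n m p w M) (X) : ∀ᵐ θ ∂(M X), ∀ k, |θ k - p k| ≤ 1 / d := by
  filter_upwards [h.hbox X] with θ hθ k
  have h1 := hθ k
  have h2 := h.hp k
  have := h.dpos
  have e : 3 / (2 * (d:ℝ)) - 1 / (2 * d) = 1 / d := by field_simp; norm_num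
  rw [abs_le]
  constructor <;> linarith [h1.1, h1.2, h2.1, h2.2]

lemma cof_le (h : Ctx d n m p w M) {θ : EE d} {k : Fin d} (hθ : |θ k - p k| ≤ 1 / d) :
    |cof p w θ k| ≤ 1 / (4 * (d : ℝ) ^ 3) := by
  have := h.dpos
  rw [cof, abs_mul, abs_of_nonneg (h.hw0 k)]
  calc w k * |θ k - p k| ≤ 1 / (4 * (d:ℝ)^2) * (1 / d) := by
        apply mul_le_mul (h.hw k) hθ (abs_nonneg _) (by positivity)
    _ = _ := by field_simp

lemma meas_cof (k : Fin d) : Measurable fun θ : EE d => cof p w θ k := by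
  unfold cof; fun_prop

lemma meas_L (y : Fin d → ℕ) : Measurable fun θ : EE d => L m p (cof p w θ) y := by
  unfold L cof; fun_prop

lemma meas_sq : Measurable (sq p) := by unfold sq; fun_prop

lemma absL_le (h : Ctx d n m p w M) (X y) : ∀ᵐ θ ∂(M X), |L m p (cof p w θ) y| ≤ ZZ m p y := by
  filter_upwards [h.diff_le X] with θ hθ
  unfold L ZZ
  refine (Finset.abs_sum_le_sum_abs _ _).trans (Finset.sum_le_sum fun k _ => ?_)
  rw [abs_mul]
  gcongr
  exact h.cof_le (hθ k)

lemma sq_nonneg' (θ : EE d) : 0 ≤ sq p θ := Finset.sum_nonneg fun k _ => sq_nonneg _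

lemma sq_le (h : Ctx d n m p w M) (X) : ∀ᵐ θ ∂(M X), |sq p θ| ≤ 1 / d := by
  filter_upwards [h.diff_le X] with θ hθ
  rw [abs_of_nonneg (sq_nonneg' θ)]
  have := h.dpos
  calc sq p θ ≤ ∑ k : Fin d, (1 / (d:ℝ)) ^ 2 := by
        apply Finset.sum_le_sum
        intro k _
        rw [← sq_abs]
        gcongr
        exact hθ k
    _ = _ := by simp; field_simp

lemma int_sq (h : Ctx d n m p w M) (X) : Integrable (sq p) (M X) :=
  have := h.hM X
  integrable_of_bdd meas_sq (h.sq_le X)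

lemma int_L (h : Ctx d n m p w M) (X y) : Integrable (fun θ => L m p (cof p w θ) y) (M X) :=
  have := h.hM X
  integrable_of_bdd (meas_L y) (h.absL_le X y)

lemma int_int_sq (h : Ctx d n m p w M) : Integrable (fun X => ∫ θ, sq p θ ∂(M X)) (dat n m p) := by
  apply integrable_of_bdd (B := 1 / (d:ℝ)) Measurable.of_discrete
  refine Filter.Eventually.of_forall fun X => ?_
  have := h.hM X
  have := abs_integral_le (h.sq_le X)
  simpa using this

lemma int_ZZ (h : Ctx d n m p w M) : Integrable (ZZ m p) (row m p) :=
  integrable_finsetSum _ fun k _ => (integrable_zrow k).abs.const_mul _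

lemma integral_ZZ (h : Ctx d n m p w M) : ∫ y, ZZ m p y ∂(row m p) ≤ m / (2 * (d:ℝ) ^ 2) := by
  have := h.dpos
  unfold ZZ
  rw [integral_finsetSum _ fun k _ => (integrable_zrow k).abs.const_mul _]
  calc _ ≤ ∑ k : Fin d, 1 / (4 * (d : ℝ) ^ 3) * (2 * m) := by
        apply Finset.sum_le_sum
        intro k _
        rw [integral_const_mul]
        gcongr
        exact integral_abs_zrow h.hm h.ppos k
    _ = _ := by simp; field_simp; norm_num

lemma int_int_L (h : Ctx d n m p w M) (i : Fin n) :
    Integrable (fun X => ∫ θ, L m p (cof p w θ) (X i) ∂(M X)) (dat n m p) := by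
  have hZ : Integrable (fun X : Fin n → Fin d → ℕ => ZZ m p (X i)) (dat n m p) :=
    integrable_comp_eval (μ := fun _ : Fin n => row m p) h.int_ZZ
  refine hZ.mono' Measurable.of_discrete.aestronglyMeasurable (Filter.Eventually.of_forall fun X => ?_)
  have := h.hM X
  have := abs_integral_le (h.absL_le X (X i))
  simpa using this

lemma T_eq (h : Ctx d n m p w M) : T m p w M = ∑ i, ∫ X, ∫ θ, L m p (cof p w θ) (X i) ∂(M X) ∂(dat n m p) := by
  unfold T
  rw [← integral_finsetSum _ fun i _ => h.int_int_L i]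
  congr 1
  ext X
  rw [integral_finsetSum _ fun i _ => h.int_L X (X i)]

lemma var_le (h : Ctx d n m p w M) (θ : EE d) :
    ∑ k, cof p w θ k ^ 2 * (m / p k) ≤ m / (8 * (d:ℝ)^3) * sq p θ := by
  have := h.dpos
  unfold sq
  rw [Finset.mul_sum]
  apply Finset.sum_le_sum
  intro k _
  have h1 : m / p k ≤ m * (2 * d) := by
    rw [div_le_iff₀ (h.ppos k)]
    have := (h.hp k).1
    rw [div_le_iff₀ (by positivity)] at this
    nlinarith [h.hm]
  have h2 : w k ^ 2 ≤ (1 / (4 * (d:ℝ)^2)) ^ 2 := by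
    have := h.hw0 k
    gcongr
    exact h.hw k
  have h0 : 0 ≤ m / p k := div_nonneg h.hm (h.ppos k).le
  calc cof p w θ k ^ 2 * (m / p k) = w k ^ 2 * (m / p k) * (θ k - p k) ^ 2 := by unfold cof; ring
    _ ≤ (1 / (4 * (d:ℝ)^2)) ^ 2 * (m * (2 * d)) * (θ k - p k) ^ 2 := by
        gcongr
    _ = _ := by field_simp; ring

/-- Fubini bound for the resampled world. -/
lemma resample (h : Ctx d n m p w M) (g : (Fin d → ℕ) → EE d → ℝ) (hg : ∀ y, Measurable (g y))
    (hgZ : ∀ X y, ∀ᵐ θ ∂(M X), |g y θ| ≤ ZZ m p y) (X) :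
    ∫ y, ∫ θ, g y θ ∂(M X) ∂(row m p) = ∫ θ, ∫ y, g y θ ∂(row m p) ∂(M X) ∧
    Integrable (fun θ => ∫ y, g y θ ∂(row m p)) (M X) ∧
    Integrable (fun y => ∫ θ, g y θ ∂(M X)) (row m p) := by
  have := h.hM X
  have hm : Measurable (Function.uncurry g) := measurable_from_prod_countable_right hg
  have hi : Integrable (Function.uncurry g) ((row m p).prod (M X)) := by
    have hZ : Integrable (fun q : (Fin d → ℕ) × EE d => ZZ m p q.1) ((row m p).prod (M X)) := h.int_ZZ.comp_fst _
    refine hZ.mono' hm.aestronglyMeasurable ?_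
    have hms : MeasurableSet {q : (Fin d → ℕ) × EE d | ‖Function.uncurry g q‖ ≤ ZZ m p q.1} := by
      apply measurableSet_le hm.norm
      exact (Measurable.of_discrete (f := ZZ m p)).comp measurable_fst
    rw [Measure.ae_prod_iff_ae_ae hms]
    exact Filter.Eventually.of_forall fun y => hgZ X y
  exact ⟨integral_integral_swap hi, hi.integral_prod_right, hi.integral_prod_left⟩

lemma resample_le (h : Ctx d n m p w M) (g : (Fin d → ℕ) → EE d → ℝ) (hg : ∀ y, Measurable (g y))
    (hgZ : ∀ X y, ∀ᵐ θ ∂(M X), |g y θ| ≤ ZZ m p y) (a b : ℝ)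
    (hb : ∀ X, ∀ᵐ θ ∂(M X), ∫ y, g y θ ∂(row m p) ≤ a + b * sq p θ) :
    ∫ X, ∫ y, ∫ θ, g y θ ∂(M X) ∂(row m p) ∂(dat n m p) ≤ a + b * R m p M := by
  have hb' : ∀ X, ∫ y, ∫ θ, g y θ ∂(M X) ∂(row m p) ≤ a + b * ∫ θ, sq p θ ∂(M X) := by
    intro X
    have := h.hM X
    obtain ⟨e, i1, i2⟩ := h.resample g hg hgZ X
    rw [e]
    refine (integral_mono_ae i1 ((integrable_const _).add ((h.int_sq X).const_mul b)) (hb X)).trans (le_of_eq ?_)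
    simp only [Pi.add_apply]
    rw [integral_add (integrable_const _) ((h.int_sq X).const_mul b), integral_const_mul]
    simp
  have i3 : Integrable (fun X => ∫ y, ∫ θ, g y θ ∂(M X) ∂(row m p)) (dat n m p) := by
    apply integrable_of_bdd (B := ∫ y, ZZ m p y ∂(row m p)) Measurable.of_discrete
    refine Filter.Eventually.of_forall fun X => ?_
    have := h.hM X
    rw [← Real.norm_eq_abs]
    apply norm_integral_le_of_norm_le h.int_ZZ
    refine Filter.Eventually.of_forall fun y => ?_
    have := abs_integral_le (hgZ X y)
    simpa using this
  refine (integral_mono i3 ((integrable_const a).add (h.int_int_sq.const_mul b)) hb').trans (le_of_eq ?_)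
  simp only [Pi.add_apply]
  rw [integral_add (integrable_const _) (h.int_int_sq.const_mul b), integral_const_mul]
  simp [R]

def DP (ε δ : ℝ) (M : (Fin n → Fin d → ℕ) → Measure (EE d)) : Prop :=
  ∀ X X' : Fin n → Fin d → ℕ, (∃ i₀, ∀ i, i ≠ i₀ → X i = X' i) → ∀ S, MeasurableSet S →
      M X S ≤ ENNReal.ofReal (Real.exp ε) * M X' S + ENNReal.ofReal δ

lemma pos_le_abs (x : ℝ) : |max x 0| ≤ |x| := by
  rw [abs_of_nonneg (le_max_right _ _)]
  exact max_le (le_abs_self _) (abs_nonneg _)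

lemma int_abs_L (h : Ctx d n m p w M) {t : ℝ} (ht : 0 < t) (θ : EE d) :
    ∫ y, |L m p (cof p w θ) y| ∂(row m p) ≤ 1 / (2 * t) + t * m / (16 * (d:ℝ)^3) * sq p θ := by
  have i2 : Integrable (fun y => L m p (cof p w θ) y ^ 2) (row m p) := (memLp_L (cof p w θ)).integrable_sq
  calc _ ≤ ∫ y, (1 / (2 * t) + t / 2 * L m p (cof p w θ) y ^ 2) ∂(row m p) := by
        apply integral_mono (integrable_L _).abs ((integrable_const _).add (i2.const_mul _))
        intro y
        simp only [Pi.add_apply]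
        rw [← sq_abs]
        set x := |L m p (cof p w θ) y|
        have : 1 / (2 * t) + t / 2 * x ^ 2 - x = (1 - t * x) ^ 2 / (2 * t) := by field_simp; ring
        have h2 : 0 ≤ (1 - t * x) ^ 2 / (2 * t) := by positivity
        linarith
    _ = 1 / (2 * t) + t / 2 * ∑ k, cof p w θ k ^ 2 * (m / p k) := by
        rw [integral_add (integrable_const _) (i2.const_mul _), integral_const_mul, integral_L2 h.hm h.ppos]
        simp
    _ ≤ 1 / (2 * t) + t / 2 * (m / (8 * (d:ℝ)^3) * sq p θ) := by
        gcongr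
        exact h.var_le θ
    _ = _ := by ring

lemma case1 (h : Ctx d n m p w M) {ε δ : ℝ} (hε : 0 ≤ ε) (hδ : 0 ≤ δ) (hdp : DP ε δ M) {t : ℝ} (ht : 0 < t) :
    T m p w M ≤ n * ((Real.exp ε - Real.exp (-ε)) * (1 / (2 * t) + t * m / (16 * (d:ℝ)^3) * R m p M) +
      δ * m / (d:ℝ) ^ 2) := by
  have := h.hM
  have hdpos := h.dpos
  rw [h.T_eq]
  have key : ∀ i, ∫ X, ∫ θ, L m p (cof p w θ) (X i) ∂(M X) ∂(dat n m p) ≤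
      (Real.exp ε - Real.exp (-ε)) * (1 / (2 * t) + t * m / (16 * (d:ℝ)^3) * R m p M) + δ * m / (d:ℝ) ^ 2 := by
    intro i
    set f : (Fin d → ℕ) → EE d → ℝ := fun y θ => L m p (cof p w θ) y with hf
    have mp : ∀ y, Measurable fun θ => max (f y θ) 0 := fun y => (meas_L y).max measurable_const
    have mn : ∀ y, Measurable fun θ => max (- f y θ) 0 := fun y => (meas_L y).neg.max measurable_const
    have bp : ∀ X y, ∀ᵐ θ ∂(M X), |max (f y θ) 0| ≤ ZZ m p y := fun X y =>
      (h.absL_le X y).mono fun θ hθ => (pos_le_abs _).trans hθ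
    have bn : ∀ X y, ∀ᵐ θ ∂(M X), |max (- f y θ) 0| ≤ ZZ m p y := fun X y =>
      (h.absL_le X y).mono fun θ hθ => (pos_le_abs _).trans (by rwa [abs_neg])
    have P := (dp_row (row m p) M hδ hdp (fun y θ => max (f y θ) 0) mp (fun _ _ => le_max_right _ _)
      (ZZ m p) h.int_ZZ (fun X y => (bp X y).mono fun θ hθ => (le_abs_self _).trans hθ) i).1
    have N := (dp_row (row m p) M hδ hdp (fun y θ => max (- f y θ) 0) mn (fun _ _ => le_max_right _ _)
      (ZZ m p) h.int_ZZ (fun X y => (bn X y).mono fun θ hθ => (le_abs_self _).trans hθ) i).2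
    have hdat : (Measure.pi fun _ : Fin n => row m p) = dat n m p := rfl
    rw [hdat] at P N
    have Pb := h.resample_le (fun y θ => max (f y θ) 0) mp bp (1 / (2 * t)) (t * m / (16 * (d:ℝ)^3))
      (fun X => Filter.Eventually.of_forall fun θ => by
        refine le_trans (integral_mono ?_ (integrable_L (cof p w θ)).abs ?_) (h.int_abs_L ht θ)
        · exact (integrable_L (cof p w θ)).pos_part
        · intro y; exact max_le (le_abs_self _) (abs_nonneg _))
    have eqPN : ∫ X, ∫ y, ∫ θ, max (- f y θ) 0 ∂(M X) ∂(row m p) ∂(dat n m p) =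
        ∫ X, ∫ y, ∫ θ, max (f y θ) 0 ∂(M X) ∂(row m p) ∂(dat n m p) := by
      congr 1
      ext X
      rw [(h.resample _ mp bp X).1, (h.resample _ mn bn X).1]
      congr 1
      ext θ
      have e : ∫ y, max (f y θ) 0 ∂(row m p) - ∫ y, max (- f y θ) 0 ∂(row m p) = 0 := by
        have i1 : Integrable (fun y => max (f y θ) 0) (row m p) := (integrable_L (cof p w θ)).pos_part
        have i2 : Integrable (fun y => max (- f y θ) 0) (row m p) := (integrable_L (cof p w θ)).neg.pos_part
        rw [← integral_sub i1 i2]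
        refine Eq.trans ?_ (integral_L h.hm h.ppos (cof p w θ))
        congr 1
        ext y
        exact max_zero_sub_max_neg_zero_eq_self (f y θ)
      linarith
    have eqf : ∫ X, ∫ θ, f (X i) θ ∂(M X) ∂(dat n m p) = ∫ X, ∫ θ, max (f (X i) θ) 0 ∂(M X) ∂(dat n m p)
        - ∫ X, ∫ θ, max (- f (X i) θ) 0 ∂(M X) ∂(dat n m p) := by
      have hZ : Integrable (fun X : Fin n → Fin d → ℕ => ZZ m p (X i)) (dat n m p) :=
        integrable_comp_eval (μ := fun _ : Fin n => row m p) h.int_ZZ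
      have ii : ∀ g : (Fin d → ℕ) → EE d → ℝ, (∀ X y, ∀ᵐ θ ∂(M X), |g y θ| ≤ ZZ m p y) →
          Integrable (fun X => ∫ θ, g (X i) θ ∂(M X)) (dat n m p) := by
        intro g hg
        refine hZ.mono' Measurable.of_discrete.aestronglyMeasurable (Filter.Eventually.of_forall fun X => ?_)
        have := abs_integral_le (hg X (X i))
        simpa using this
      rw [← integral_sub (ii _ bp) (ii _ bn)]
      congr 1
      ext X
      have i1 : Integrable (fun θ => max (f (X i) θ) 0) (M X) := (h.int_L X (X i)).pos_part
      have i2 : Integrable (fun θ => max (- f (X i) θ) 0) (M X) := (h.int_L X (X i)).neg.pos_part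
      rw [← integral_sub i1 i2]
      congr 1
      ext θ
      exact (max_zero_sub_max_neg_zero_eq_self _).symm
    rw [eqf]
    rw [eqPN] at N
    set A := ∫ X, ∫ θ, max (f (X i) θ) 0 ∂(M X) ∂(dat n m p)
    set B := ∫ X, ∫ θ, max (- f (X i) θ) 0 ∂(M X) ∂(dat n m p)
    set C := ∫ X, ∫ y, ∫ θ, max (f y θ) 0 ∂(M X) ∂(row m p) ∂(dat n m p)
    set ζ := ∫ y, ZZ m p y ∂(row m p)
    have hζ : ζ ≤ m / (2 * (d:ℝ) ^ 2) := h.integral_ZZ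
    have hζ0 : 0 ≤ ζ := integral_nonneg fun y => Finset.sum_nonneg fun k _ => by positivity
    have e1 : Real.exp (-ε) * Real.exp ε = 1 := by rw [← Real.exp_add]; simp
    have e2 : Real.exp (-ε) ≤ 1 := by simpa using hε
    have e3 : (1:ℝ) ≤ Real.exp ε := by simpa using hε
    have N' : Real.exp (-ε) * C ≤ B + δ * ζ := by
      have := mul_le_mul_of_nonneg_left N (Real.exp_pos (-ε)).le
      rw [mul_add, ← mul_assoc, e1, one_mul] at this
      have h3 : Real.exp (-ε) * (δ * ζ) ≤ 1 * (δ * ζ) := by gcongr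
      linarith
    have h4 : (Real.exp ε - Real.exp (-ε)) * C ≤ (Real.exp ε - Real.exp (-ε)) * (1 / (2 * t) + t * m / (16 * (d:ℝ)^3) * R m p M) := by
      apply mul_le_mul_of_nonneg_left Pb
      linarith
    have h5 : δ * ζ ≤ δ * (m / (2 * (d:ℝ)^2)) := by gcongr
    have h6 : δ * m / (d:ℝ)^2 = 2 * (δ * (m / (2 * (d:ℝ)^2))) := by field_simp
    rw [h6]
    nlinarith
  calc _ ≤ ∑ i : Fin n, _ := Finset.sum_le_sum fun i _ => key i
    _ = _ := by rw [Finset.sum_const, Finset.card_univ, Fintype.card_fin, nsmul_eq_mul]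

lemma case3 (h : Ctx d n m p w M) {ε δ : ℝ} (hε : 0 ≤ ε) (hδ : 0 ≤ δ) (hdp : DP ε δ M) {t : ℝ} (ht : 0 < t)
    (htd : t ≤ (d:ℝ)^2) :
    T m p w M ≤ n * ((ε + 1) / t + t * m / (8 * (d:ℝ)^3) * R m p M + δ * m / (d:ℝ) ^ 2) := by
  have := h.hM
  have hdpos := h.dpos
  have hmm := h.hm
  rw [h.T_eq]
  have key : ∀ i, ∫ X, ∫ θ, L m p (cof p w θ) (X i) ∂(M X) ∂(dat n m p) ≤
      (ε + 1) / t + t * m / (8 * (d:ℝ)^3) * R m p M + δ * m / (d:ℝ) ^ 2 := by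
    intro i
    set f : (Fin d → ℕ) → EE d → ℝ := fun y θ => L m p (cof p w θ) y with hf
    set τ : EE d → ℝ := fun θ => ε / t + t * m / (8 * (d:ℝ)^3) * sq p θ with hτ
    have hτ0 : ∀ θ, 0 ≤ τ θ := fun θ => by
      have := sq_nonneg' (p := p) θ
      simp only [hτ]; positivity
    have mτ : Measurable τ := (meas_sq.const_mul _).const_add _
    have iτ : ∀ X, Integrable τ (M X) := fun X => (integrable_const _).add ((h.int_sq X).const_mul _)
    have eτ : ∀ X, ∫ θ, τ θ ∂(M X) = ε / t + t * m / (8 * (d:ℝ)^3) * ∫ θ, sq p θ ∂(M X) := by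
      intro X
      simp only [hτ]
      rw [integral_add (integrable_const _) ((h.int_sq X).const_mul _), integral_const_mul]
      simp
    have iτ' : Integrable (fun X => ∫ θ, τ θ ∂(M X)) (dat n m p) := by
      simp_rw [eτ]
      exact (integrable_const _).add (h.int_int_sq.const_mul _)
    have eτ' : ∫ X, ∫ θ, τ θ ∂(M X) ∂(dat n m p) = ε / t + t * m / (8 * (d:ℝ)^3) * R m p M := by
      simp_rw [eτ]
      rw [integral_add (integrable_const _) (h.int_int_sq.const_mul _), integral_const_mul]
      simp [R]
    have mp : ∀ y, Measurable fun θ => max (f y θ - τ θ) 0 := fun y => ((meas_L y).sub mτ).max measurable_const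
    have bp : ∀ X y, ∀ᵐ θ ∂(M X), |max (f y θ - τ θ) 0| ≤ ZZ m p y := fun X y =>
      (h.absL_le X y).mono fun θ hθ => by
        rw [abs_of_nonneg (le_max_right _ _)]
        refine le_trans ?_ hθ
        apply max_le _ (abs_nonneg _)
        have := le_abs_self (f y θ)
        have := hτ0 θ
        linarith
    have P := (dp_row (row m p) M hδ hdp (fun y θ => max (f y θ - τ θ) 0) mp (fun _ _ => le_max_right _ _)
      (ZZ m p) h.int_ZZ (fun X y => (bp X y).mono fun θ hθ => (le_abs_self _).trans hθ) i).1
    have hdat : (Measure.pi fun _ : Fin n => row m p) = dat n m p := rfl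
    rw [hdat] at P
    have Pb := h.resample_le (fun y θ => max (f y θ - τ θ) 0) mp bp (Real.exp (-ε) / t) 0
      (fun X => (h.diff_le X).mono fun θ hθ => by
        have hL : ∀ y, t * f y θ = L m p (fun k => t * cof p w θ k) y := by
          intro y
          simp only [hf, L, Finset.mul_sum, mul_assoc]
        have hexp : ∫ y, Real.exp (L m p (fun k => t * cof p w θ k) y) ∂(row m p) ≤
            Real.exp (t ^ 2 * (m / (8 * (d:ℝ)^3) * sq p θ)) := by
          refine (integral_expL h.hm h.ppos _ ?_).trans ?_
          · intro k
            rw [abs_mul, abs_of_pos ht]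
            calc t * |cof p w θ k| ≤ (d:ℝ)^2 * (1 / (4 * (d:ℝ)^3)) := by
                  gcongr
                  exact h.cof_le (hθ k)
              _ ≤ 1 / (2 * (d:ℝ)) := by
                  have : (d:ℝ)^2 * (1 / (4 * (d:ℝ)^3)) = 1 / (2 * (d:ℝ)) / 2 := by field_simp; norm_num
                  rw [this]
                  have : 0 < 1 / (2 * (d:ℝ)) := by positivity
                  linarith
              _ ≤ p k := (h.hp k).1
          · apply Real.exp_le_exp.2
            refine le_trans (le_of_eq ?_) (mul_le_mul_of_nonneg_left (h.var_le θ) (sq_nonneg t))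
            rw [Finset.mul_sum]
            apply Finset.sum_congr rfl
            intro k _
            ring
        have iE := integrable_expL (m := m) (p := p) (fun k => t * cof p w θ k)
        calc ∫ y, max (f y θ - τ θ) 0 ∂(row m p)
            ≤ ∫ y, Real.exp (L m p (fun k => t * cof p w θ k) y) * (Real.exp (- (t * τ θ)) / t) ∂(row m p) := by
              have i0 : Integrable (fun y => max (f y θ - τ θ) 0) (row m p) :=
                ((integrable_L (cof p w θ)).sub (integrable_const _)).pos_part
              apply integral_mono i0 (iE.mul_const _)
              intro y
              simp only
              rw [← hL, ← mul_div_assoc, ← Real.exp_add, le_div_iff₀ ht]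
              have hx := Real.add_one_le_exp (t * f y θ + -(t * τ θ))
              have hx0 := Real.exp_pos (t * f y θ + -(t * τ θ))
              rcases max_cases (f y θ - τ θ) 0 with ⟨e, _⟩ | ⟨e, _⟩
              · rw [e]; nlinarith
              · rw [e]; linarith
          _ ≤ Real.exp (t ^ 2 * (m / (8 * (d:ℝ)^3) * sq p θ)) * (Real.exp (- (t * τ θ)) / t) := by
              rw [integral_mul_const]
              gcongr
          _ = Real.exp (-ε) / t + 0 * sq p θ := by
              rw [← mul_div_assoc, ← Real.exp_add, zero_mul, add_zero]
              congr 2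
              simp only [hτ]
              field_simp
              ring)
    have hZ : Integrable (fun X : Fin n → Fin d → ℕ => ZZ m p (X i)) (dat n m p) :=
      integrable_comp_eval (μ := fun _ : Fin n => row m p) h.int_ZZ
    have ii : Integrable (fun X => ∫ θ, max (f (X i) θ - τ θ) 0 ∂(M X)) (dat n m p) := by
      refine hZ.mono' Measurable.of_discrete.aestronglyMeasurable (Filter.Eventually.of_forall fun X => ?_)
      have := abs_integral_le (bp X (X i))
      simpa using this
    have hle : ∫ X, ∫ θ, f (X i) θ ∂(M X) ∂(dat n m p) ≤ ∫ X, ∫ θ, τ θ ∂(M X) ∂(dat n m p)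
        + ∫ X, ∫ θ, max (f (X i) θ - τ θ) 0 ∂(M X) ∂(dat n m p) := by
      rw [← integral_add iτ' ii]
      apply integral_mono (h.int_int_L i) (iτ'.add ii)
      intro X
      simp only [Pi.add_apply]
      have i3 : Integrable (fun θ => max (f (X i) θ - τ θ) 0) (M X) := ((h.int_L X (X i)).sub (iτ X)).pos_part
      rw [← integral_add (iτ X) i3]
      apply integral_mono (h.int_L X (X i)) ((iτ X).add i3)
      intro θ
      simp only [Pi.add_apply]
      have := le_max_left (f (X i) θ - τ θ) 0
      simp only [hf] at this ⊢
      linarith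
    rw [eτ'] at hle
    have hζ : ∫ y, ZZ m p y ∂(row m p) ≤ m / (2 * (d:ℝ) ^ 2) := h.integral_ZZ
    have h5 : δ * ∫ y, ZZ m p y ∂(row m p) ≤ δ * (m / (2 * (d:ℝ)^2)) := by gcongr
    have h6 : δ * m / (d:ℝ)^2 = 2 * (δ * (m / (2 * (d:ℝ)^2))) := by field_simp
    have h7 : 0 ≤ δ * (m / (2 * (d:ℝ)^2)) := by positivity
    have e1 : Real.exp ε * (Real.exp (-ε) / t + 0 * R m p M) = 1 / t := by
      rw [zero_mul, add_zero, ← mul_div_assoc, ← Real.exp_add]; simp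
    have h8 := mul_le_mul_of_nonneg_left Pb (Real.exp_pos ε).le
    rw [e1] at h8
    have e9 : (ε + 1) / t = ε / t + 1 / t := by ring
    rw [h6, e9]
    linarith
  calc _ ≤ ∑ i : Fin n, _ := Finset.sum_le_sum fun i _ => key i
    _ = _ := by rw [Finset.sum_const, Finset.card_univ, Fintype.card_fin, nsmul_eq_mul]

lemma case2 (h : Ctx d n m p w M) {t : ℝ} (ht : 0 < t) :
    T m p w M ≤ t / 2 * R m p M + n * m / (16 * t * (d:ℝ)^2) := by
  have := h.hM
  have hdpos := h.dpos
  have hmm := h.hm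
  set S : Fin d → (Fin n → Fin d → ℕ) → ℝ := fun k X => ∑ i, L m p (Pi.single k (w k)) (X i) with hS
  have hLs : ∀ k y, L m p (Pi.single k (w k)) y = w k * z m (p k) (y k) := by
    intro k y
    unfold L
    rw [Finset.sum_eq_single k]
    · simp
    · intro b _ hb; simp [hb]
    · simp
  have iS : ∀ k, Integrable (fun X => S k X ^ 2) (dat n m p) := fun k => (memLp_SL _).integrable_sq
  have eS : ∀ k, ∫ X, S k X ^ 2 ∂(dat n m p) ≤ n * m / (8 * (d:ℝ)^3) := by
    intro k
    simp only [hS]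
    rw [integral_SL2 h.hm h.ppos]
    rw [Finset.sum_eq_single k (by intro b _ hb; simp [hb]) (by simp)]
    simp only [Pi.single_eq_same]
    have h1 : m / p k ≤ m * (2 * d) := by
      rw [div_le_iff₀ (h.ppos k)]
      have := (h.hp k).1
      rw [div_le_iff₀ (by positivity)] at this
      nlinarith [h.hm]
    have h2 : w k ^ 2 ≤ (1 / (4 * (d:ℝ)^2)) ^ 2 := by
      have := h.hw0 k
      gcongr
      exact h.hw k
    have h0 : 0 ≤ m / p k := div_nonneg h.hm (h.ppos k).le
    calc (n:ℝ) * (w k ^ 2 * (m / p k)) ≤ n * ((1 / (4 * (d:ℝ)^2)) ^ 2 * (m * (2 * d))) := by gcongr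
      _ = _ := by field_simp; ring
  have iSS : Integrable (fun X => 1 / (2 * t) * ∑ k, S k X ^ 2) (dat n m p) :=
    (integrable_finsetSum _ fun k _ => iS k).const_mul _
  have iT : Integrable (fun X => ∫ θ, ∑ i, L m p (cof p w θ) (X i) ∂(M X)) (dat n m p) := by
    have : (fun X => ∫ θ, ∑ i, L m p (cof p w θ) (X i) ∂(M X)) = fun X => ∑ i, ∫ θ, L m p (cof p w θ) (X i) ∂(M X) := by
      ext X
      rw [integral_finsetSum _ fun i _ => h.int_L X (X i)]
    rw [this]
    exact integrable_finsetSum _ fun i _ => h.int_int_L i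
  calc T m p w M ≤ ∫ X, (t / 2 * ∫ θ, sq p θ ∂(M X)) + 1 / (2 * t) * ∑ k, S k X ^ 2 ∂(dat n m p) := by
        apply integral_mono iT ((h.int_int_sq.const_mul _).add iSS)
        intro X
        simp only [Pi.add_apply]
        have : (t / 2 * ∫ θ, sq p θ ∂(M X)) + 1 / (2 * t) * ∑ k, S k X ^ 2 =
            ∫ θ, t / 2 * sq p θ + 1 / (2 * t) * ∑ k, S k X ^ 2 ∂(M X) := by
          rw [integral_add ((h.int_sq X).const_mul _) (integrable_const _), integral_const_mul]
          simp
        rw [this]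
        apply integral_mono (integrable_finsetSum _ fun i _ => h.int_L X (X i))
          (((h.int_sq X).const_mul _).add (integrable_const _))
        intro θ
        simp only [Pi.add_apply]
        have e : ∑ i, L m p (cof p w θ) (X i) = ∑ k, (θ k - p k) * S k X := by
          simp only [hS, hLs, Finset.mul_sum]
          simp only [L, cof]
          rw [Finset.sum_comm]
          refine Finset.sum_congr rfl fun k _ => Finset.sum_congr rfl fun i _ => ?_
          ring
        rw [e, sq, Finset.mul_sum, Finset.mul_sum, ← Finset.sum_add_distrib]
        apply Finset.sum_le_sum
        intro k _
        set u := θ k - p k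
        set v := S k X
        have e2 : t / 2 * u ^ 2 + 1 / (2 * t) * v ^ 2 - u * v = (t * u - v) ^ 2 / (2 * t) := by
          field_simp; ring
        have e3 : 0 ≤ (t * u - v) ^ 2 / (2 * t) := by positivity
        linarith
    _ = t / 2 * R m p M + 1 / (2 * t) * ∑ k, ∫ X, S k X ^ 2 ∂(dat n m p) := by
        rw [integral_add (h.int_int_sq.const_mul _) iSS, integral_const_mul, integral_const_mul,
          integral_finsetSum _ fun k _ => iS k, R]
    _ ≤ t / 2 * R m p M + 1 / (2 * t) * ∑ k : Fin d, n * m / (8 * (d:ℝ)^3) := by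
        gcongr with k
        exact eS k
    _ = _ := by
        simp only [Finset.sum_const, Finset.card_univ, Fintype.card_fin, nsmul_eq_mul]
        field_simp
        ring

end Ctx

end partC

section partD
noncomputable def lo (d : ℕ) : ℝ := 1 / (2 * (d : ℝ))
noncomputable def hi (d : ℕ) : ℝ := 3 / (2 * (d : ℝ))
noncomputable def wq (d : ℕ) (x : ℝ) : ℝ := (x - lo d) * (hi d - x)
noncomputable def wd (d : ℕ) (x : ℝ) : ℝ := lo d + hi d - 2 * x

/-- Lebesgue measure on the box -/
noncomputable def bx (d : ℕ) : Measure (Fin d → ℝ) :=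
  Measure.pi fun _ => volume.restrict (Set.Icc (lo d) (hi d))

instance (d : ℕ) : IsFiniteMeasure (bx d) := by unfold bx; infer_instance

/-- the joint likelihood -/
noncomputable def WW {d n : ℕ} (m : ℝ) (p : Fin d → ℝ) (X : Fin n → Fin d → ℕ) : ℝ :=
  ∏ i, ∏ k, poisPMF (m * p k) (X i k)

lemma hasDerivAt_pois (m : ℝ) (j : ℕ) {x : ℝ} (hx : x ≠ 0) :
    HasDerivAt (fun x => poisPMF (m * x) j) (poisPMF (m * x) j * z m x j) x := by
  unfold poisPMF z
  have h1 : HasDerivAt (fun x : ℝ => m * x) m x := by simpa using (hasDerivAt_id x).const_mul m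
  have h2 := ((h1.neg.exp).mul (h1.pow j)).div_const (j.factorial : ℝ)
  refine h2.congr_deriv ?_
  simp only [Pi.neg_apply, Pi.pow_apply]
  rcases j with _ | j
  · simp; 
  · have : ((j + 1).factorial : ℝ) ≠ 0 := by positivity
    simp only [Nat.add_sub_cancel]
    field_simp
    push_cast
    ring

lemma hasDerivAt_q {n : ℕ} (m : ℝ) (c : Fin n → ℕ) {x : ℝ} (hx : x ≠ 0) :
    HasDerivAt (fun x => ∏ i, poisPMF (m * x) (c i)) ((∏ i, poisPMF (m * x) (c i)) * ∑ i, z m x (c i)) x := by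
  have h := HasDerivAt.fun_finsetProd (u := (Finset.univ : Finset (Fin n)))
    (f := fun i x => poisPMF (m * x) (c i)) (fun i _ => hasDerivAt_pois m (c i) hx)
  refine h.congr_deriv ?_
  rw [Finset.mul_sum]
  refine Finset.sum_congr rfl fun i _ => ?_
  rw [smul_eq_mul, ← mul_assoc, Finset.prod_erase_mul _ _ (Finset.mem_univ i)]

lemma cont_pois (m : ℝ) (j : ℕ) : Continuous (fun x => poisPMF (m * x) j) := by
  unfold poisPMF; fun_prop

lemma lo_pos {d : ℕ} (hd : 1 ≤ d) : 0 < lo d := by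
  have : (0:ℝ) < d := by exact_mod_cast hd
  unfold lo; positivity

lemma lo_le_hi {d : ℕ} (hd : 1 ≤ d) : lo d ≤ hi d := by
  have : (0:ℝ) < d := by exact_mod_cast hd
  unfold lo hi; gcongr; norm_num

lemma hi_sub_lo {d : ℕ} (hd : 1 ≤ d) : hi d - lo d = 1 / d := by
  have : (0:ℝ) < d := by exact_mod_cast hd
  unfold lo hi; field_simp; norm_num

lemma ibp1 {d n : ℕ} (hd : 1 ≤ d) (m : ℝ) (c : Fin n → ℕ) :
    ∫ x in Set.Icc (lo d) (hi d), (∏ i, poisPMF (m * x) (c i)) * (wq d x * ∑ i, z m x (c i) + wd d x) = 0 := by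
  rw [integral_Icc_eq_integral_Ioc, ← intervalIntegral.integral_of_le (lo_le_hi hd)]
  have hpos : ∀ x ∈ Set.uIcc (lo d) (hi d), x ≠ 0 := by
    intro x hx
    rw [Set.uIcc_of_le (lo_le_hi hd)] at hx
    exact (lt_of_lt_of_le (lo_pos hd) hx.1).ne'
  have hw : ∀ x, HasDerivAt (wq d) (wd d x) x := by
    intro x
    have := ((hasDerivAt_id x).sub_const (lo d)).mul ((hasDerivAt_id x).const_sub (hi d))
    refine this.congr_deriv ?_
    simp [wd]; ring
  rw [intervalIntegral.integral_eq_sub_of_hasDerivAt (f := fun x => wq d x * ∏ i, poisPMF (m * x) (c i))]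
  · simp [wq]
  · intro x hx
    refine ((hw x).mul (hasDerivAt_q m c (hpos x hx))).congr_deriv ?_
    ring
  · apply ContinuousOn.intervalIntegrable
    apply ContinuousOn.mul
    · exact (continuous_finsetProd _ fun i _ => cont_pois m (c i)).continuousOn
    · unfold wq wd z
      apply ContinuousOn.add (ContinuousOn.mul (by fun_prop) _) (by fun_prop)
      apply continuousOn_finsetSum
      intro i _
      apply ContinuousOn.sub _ continuousOn_const
      exact continuousOn_const.div continuousOn_id hpos

lemma ibp {d n : ℕ} (hd : 1 ≤ d) (m : ℝ) (X : Fin n → Fin d → ℕ) (k : Fin d) :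
    ∫ p, WW m p X * (wq d (p k) * ∑ i, z m (p k) (X i k) + wd d (p k)) ∂(bx d) = 0 := by
  set g : Fin d → ℝ → ℝ := (fun (j : Fin d) (x : ℝ) => (∏ i, poisPMF (m * x) (X i j)) *
        (if j = k then wq d x * ∑ i, z m x (X i k) + wd d x else 1)) with hg
  have e : ∀ p : Fin d → ℝ, WW m p X * (wq d (p k) * ∑ i, z m (p k) (X i k) + wd d (p k)) =
      ∏ j, g j (p j) := by
    intro p
    simp only [hg]
    rw [Finset.prod_mul_distrib, WW, Finset.prod_comm]
    congr 1
    rw [Finset.prod_ite_eq' Finset.univ k (fun j => wq d (p j) * ∑ i, z m (p j) (X i k) + wd d (p j))]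
    simp
  simp_rw [e]
  rw [bx, integral_fintype_prod_eq_prod]
  apply Finset.prod_eq_zero (Finset.mem_univ k)
  simp only [hg, if_true]
  exact ibp1 hd m fun i => X i k

/-- marginal integrals -/
lemma bx_marg {d : ℕ} (hd : 1 ≤ d) (k : Fin d) (f : ℝ → ℝ) :
    ∫ p, f (p k) ∂(bx d) = (1 / (d:ℝ)) ^ (d - 1) * ∫ x in (lo d)..(hi d), f x := by
  set g : Fin d → ℝ → ℝ := (fun (j : Fin d) (x : ℝ) => if j = k then f x else 1) with hg
  have e : ∀ p : Fin d → ℝ, f (p k) = ∏ j, g j (p j) := by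
    intro p
    simp [hg]
  simp_rw [e]
  rw [bx, integral_fintype_prod_eq_prod, ← Finset.mul_prod_erase _ _ (Finset.mem_univ k)]
  rw [mul_comm, Finset.prod_congr rfl (g := fun _ => 1 / (d:ℝ))]
  · rw [Finset.prod_const, Finset.card_erase_of_mem (Finset.mem_univ k), Finset.card_univ, Fintype.card_fin]
    simp only [hg, if_true]
    rw [integral_Icc_eq_integral_Ioc, ← intervalIntegral.integral_of_le (lo_le_hi hd)]
  · intro j hj
    simp [hg, Finset.ne_of_mem_erase hj, lo_le_hi hd, hi_sub_lo hd]

lemma bx_univ {d : ℕ} (hd : 1 ≤ d) : (d:ℝ)^d * (bx d).real Set.univ = 1 := by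
  have h := bx_marg hd ⟨0, hd⟩ (fun _ => 1)
  have hdp : (0:ℝ) < d := by exact_mod_cast hd
  simp only [integral_const, smul_eq_mul, mul_one, intervalIntegral.integral_const, hi_sub_lo hd] at h
  rw [h, ← pow_succ, Nat.sub_add_cancel hd, ← mul_pow]
  field_simp
  simp

lemma bx_ae {d : ℕ} : ∀ᵐ p ∂(bx d), ∀ k, p k ∈ Set.Icc (lo d) (hi d) := by
  have : bx d = (Measure.pi fun _ : Fin d => (volume : Measure ℝ)).restrict (Set.univ.pi fun _ => Set.Icc (lo d) (hi d)) := by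
    rw [bx, Measure.restrict_pi_pi]
  rw [this]
  have hms : MeasurableSet (Set.univ.pi fun _ : Fin d => Set.Icc (lo d) (hi d)) :=
    MeasurableSet.univ_pi fun _ => measurableSet_Icc
  filter_upwards [ae_restrict_mem hms] with p hp k
  exact hp k (Set.mem_univ k)

lemma bx_wd {d : ℕ} (hd : 1 ≤ d) (k : Fin d) :
    (d:ℝ)^d * ∫ p, (wd d (p k) * p k + wd d (p k) ^ 2 / 6) ∂(bx d) = - (1 / (9 * (d:ℝ)^2)) := by
  have hdp : (0:ℝ) < d := by exact_mod_cast hd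
  rw [bx_marg hd k (fun x => wd d x * x + wd d x ^ 2 / 6)]
  have e : ∀ x, wd d x * x + wd d x ^ 2 / 6 = (2 / (3 * (d:ℝ)^2)) + (2 / (3 * (d:ℝ))) * x + (- (4 / 3)) * x ^ 2 := by
    intro x
    unfold wd lo hi
    field_simp
    ring
  have hI : ∫ x in (lo d)..(hi d), (wd d x * x + wd d x ^ 2 / 6) = - (1 / (9 * (d:ℝ)^3)) := by
    simp_rw [e]
    rw [intervalIntegral.integral_add (by apply Continuous.intervalIntegrable; fun_prop) (by apply Continuous.intervalIntegrable; fun_prop),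
      intervalIntegral.integral_add (by apply Continuous.intervalIntegrable; fun_prop) (by apply Continuous.intervalIntegrable; fun_prop)]
    rw [intervalIntegral.integral_const, intervalIntegral.integral_const_mul, intervalIntegral.integral_const_mul,
      integral_id, integral_pow]
    unfold lo hi
    simp only [smul_eq_mul]
    push_cast
    field_simp
    ring_nf
  rw [hI]
  have h2 : (d:ℝ)^d * (1 / (d:ℝ))^(d-1) = d := by
    obtain ⟨e, he⟩ : ∃ e, d = e + 1 := ⟨d - 1, by omega⟩
    have h3 : (d:ℝ)^d = d ^ (d - 1) * d := by rw [← pow_succ, Nat.sub_add_cancel hd]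
    rw [h3, one_div, inv_pow]
    field_simp
  rw [← mul_assoc, h2]
  field_simp

end partD

section partF
lemma fub {Ω ι : Type*} [MeasurableSpace Ω] [Countable ι] [MeasurableSpace ι] [DiscreteMeasurableSpace ι]
    (ν : Measure Ω) [IsFiniteMeasure ν] (h : Ω → ι → ℝ) (hm : ∀ X, Measurable fun p => h p X) {C : ℝ≥0∞} (hC : C ≠ ∞)
    (hb : ∀ᵐ p ∂ν, ∑' X, ‖h p X‖ₑ ≤ C) :
    Integrable (fun p => ∑' X, h p X) ν ∧ ∫ p, ∑' X, h p X ∂ν = ∑' X, ∫ p, h p X ∂ν := by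
  have hlt : ∫⁻ p, ∑' X, ‖h p X‖ₑ ∂ν < ∞ := by
    calc _ ≤ ∫⁻ p, C ∂ν := lintegral_mono_ae hb
      _ = C * ν Set.univ := by simp
      _ < ∞ := ENNReal.mul_lt_top hC.lt_top (measure_lt_top _ _)
  constructor
  · have hmu : Measurable (Function.uncurry h) := measurable_from_prod_countable_left hm
    have hi : Integrable (Function.uncurry h) (ν.prod Measure.count) := by
      refine ⟨hmu.aestronglyMeasurable, ?_⟩
      rw [HasFiniteIntegral, lintegral_prod _ hmu.enorm.aemeasurable]
      simpa [lintegral_count] using hlt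
    refine hi.integral_prod_left.congr ?_
    filter_upwards [hi.prod_right_ae] with p hp
    rw [integral_countable hp]
    simp
  · apply integral_tsum (fun X => (hm X).aestronglyMeasurable)
    rw [← lintegral_tsum fun X => (hm X).enorm.aemeasurable]
    exact hlt.ne

variable {d n : ℕ} {m : ℝ}

lemma dat_singleton (p : Fin d → ℝ) (hp : ∀ k, 0 ≤ m * p k) (X : Fin n → Fin d → ℕ) :
    (dat n m p).real {X} = WW m p X := by
  unfold dat WW
  rw [Measure.real, Measure.pi_singleton, ENNReal.toReal_prod]
  refine Finset.prod_congr rfl fun i _ => ?_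
  rw [row, Measure.pi_singleton, ENNReal.toReal_prod]
  refine Finset.prod_congr rfl fun k _ => ?_
  exact pm_singleton (hp k) _

lemma dat_tsum (p : Fin d → ℝ) (hp : ∀ k, 0 ≤ m * p k) {F : (Fin n → Fin d → ℕ) → ℝ}
    (hF : Integrable F (dat n m p)) : ∫ X, F X ∂(dat n m p) = ∑' X, WW m p X * F X := by
  rw [integral_countable hF]
  simp only [dat_singleton p hp, smul_eq_mul]

lemma dat_enorm (p : Fin d → ℝ) (hp : ∀ k, 0 ≤ m * p k) (F : (Fin n → Fin d → ℕ) → ℝ) :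
    ∑' X, ‖WW m p X * F X‖ₑ = ∫⁻ X, ‖F X‖ₑ ∂(dat n m p) := by
  rw [lintegral_countable']
  refine tsum_congr fun X => ?_
  rw [← dat_singleton p hp X, enorm_mul, mul_comm]
  congr 1
  rw [Real.enorm_eq_ofReal measureReal_nonneg, ofReal_measureReal]

lemma meas_WW (X : Fin n → Fin d → ℕ) : Measurable fun p : Fin d → ℝ => WW m p X := by
  unfold WW
  refine Finset.measurable_fun_prod _ fun i _ => Finset.measurable_fun_prod _ fun k _ => ?_
  exact (cont_pois m (X i k)).measurable.comp (measurable_pi_apply k)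

lemma fubW (hd : 1 ≤ d) (hm : 0 ≤ m) (F : (Fin d → ℝ) → (Fin n → Fin d → ℕ) → ℝ) (hF : ∀ X, Measurable fun p => F p X)
    (C : ℝ) (hb : ∀ p : Fin d → ℝ, (∀ k, p k ∈ Set.Icc (lo d) (hi d)) → Integrable (F p) (dat n m p) ∧
      ∫ X, |F p X| ∂(dat n m p) ≤ C) :
    Integrable (fun p => ∫ X, F p X ∂(dat n m p)) (bx d) ∧
    ∫ p, ∫ X, F p X ∂(dat n m p) ∂(bx d) = ∑' X, ∫ p, WW m p X * F p X ∂(bx d) := by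
  have hpos : ∀ p : Fin d → ℝ, (∀ k, p k ∈ Set.Icc (lo d) (hi d)) → ∀ k, 0 ≤ m * p k := fun p hp k =>
    mul_nonneg hm ((lo_pos hd).le.trans (hp k).1)
  have h1 := fub (bx d) (fun p X => WW m p X * F p X) (fun X => (meas_WW X).mul (hF X)) (C := ENNReal.ofReal C)
    ENNReal.ofReal_ne_top (by
      filter_upwards [bx_ae] with p hp
      rw [dat_enorm p (hpos p hp)]
      obtain ⟨hi, hc⟩ := hb p hp
      rw [← ofReal_integral_norm_eq_lintegral_enorm hi]
      exact ENNReal.ofReal_le_ofReal hc)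
  have hae : (fun p => ∑' X, WW m p X * F p X) =ᵐ[bx d] fun p => ∫ X, F p X ∂(dat n m p) := by
    filter_upwards [bx_ae] with p hp
    rw [dat_tsum p (hpos p hp) (hb p hp).1]
  exact ⟨h1.1.congr hae, by rw [← h1.2]; exact (integral_congr_ae hae).symm⟩

/-- mean of the output coordinate -/
noncomputable def tb (M : (Fin n → Fin d → ℕ) → Measure (EE d)) (k : Fin d) (X : Fin n → Fin d → ℕ) : ℝ :=
  ∫ θ, θ k ∂(M X)

noncomputable def VF (m : ℝ) (M : (Fin n → Fin d → ℕ) → Measure (EE d)) (k : Fin d) (p : Fin d → ℝ)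
    (X : Fin n → Fin d → ℕ) : ℝ :=
  (wq d (p k) * ∑ i, z m (p k) (X i k) + wd d (p k)) * tb M k X

structure Mech (d n : ℕ) (M : (Fin n → Fin d → ℕ) → Measure (EE d)) : Prop where
  hd : 1 ≤ d
  hM : ∀ X, IsProbabilityMeasure (M X)
  hbox : ∀ X, ∀ᵐ θ ∂(M X), ∀ k, θ k ∈ Set.Icc (1 / (2 * (d : ℝ))) (3 / (2 * (d : ℝ)))

variable {M : (Fin n → Fin d → ℕ) → Measure (EE d)}

lemma wq_nonneg {x : ℝ} (hx : x ∈ Set.Icc (lo d) (hi d)) : 0 ≤ wq d x :=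
  mul_nonneg (sub_nonneg.2 hx.1) (sub_nonneg.2 hx.2)

lemma wq_le (hd : 1 ≤ d) (x : ℝ) : wq d x ≤ 1 / (4 * (d : ℝ) ^ 2) := by
  have e : 1 / (4 * (d : ℝ) ^ 2) = (hi d - lo d) ^ 2 / 4 := by
    rw [hi_sub_lo hd]; field_simp
  rw [e]
  unfold wq
  nlinarith [sq_nonneg ((x - lo d) - (hi d - x))]

lemma wd_le (hd : 1 ≤ d) {x : ℝ} (hx : x ∈ Set.Icc (lo d) (hi d)) : |wd d x| ≤ 1 / d := by
  rw [← hi_sub_lo hd]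
  unfold wd
  rw [abs_le]
  constructor <;> linarith [hx.1, hx.2]

lemma Mech.ctx (h : Mech d n M) (hm : 0 ≤ m) {p : Fin d → ℝ} (hp : ∀ k, p k ∈ Set.Icc (lo d) (hi d)) :
    Ctx d n m p (fun k => wq d (p k)) M :=
  ⟨h.hd, hm, hp, fun k => wq_nonneg (hp k), fun k => wq_le h.hd _, h.hM, h.hbox⟩

lemma Mech.absθ (h : Mech d n M) (X) : ∀ᵐ θ ∂(M X), ∀ k, |θ k| ≤ hi d := by
  filter_upwards [h.hbox X] with θ hθ k
  have := (hθ k).1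
  have h0 := lo_pos h.hd
  rw [abs_of_nonneg (h0.le.trans this)]
  exact (hθ k).2

lemma Mech.tb_le (h : Mech d n M) (k X) : |tb M k X| ≤ hi d := by
  have := h.hM X
  exact abs_integral_le ((h.absθ X).mono fun θ hθ => hθ k)

lemma Mech.intθ (h : Mech d n M) (k X) : Integrable (fun θ : EE d => θ k) (M X) := by
  have := h.hM X
  exact integrable_of_bdd (by fun_prop) ((h.absθ X).mono fun θ hθ => hθ k)

lemma int_zdat (p : Fin d → ℝ) (k : Fin d) (i : Fin n) : Integrable (fun X : Fin n → Fin d → ℕ => z m (p k) (X i k)) (dat n m p) :=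
  integrable_comp_eval (μ := fun _ : Fin n => row m p) (i := i) (f := fun y : Fin d → ℕ => z m (p k) (y k)) (integrable_zrow k)

lemma int_abs_zdat (hm : 0 ≤ m) (p : Fin d → ℝ) (hp : ∀ k, 0 < p k) (k : Fin d) (i : Fin n) :
    ∫ X : Fin n → Fin d → ℕ, |z m (p k) (X i k)| ∂(dat n m p) ≤ 2 * m := by
  rw [dat, integral_comp_eval (μ := fun _ : Fin n => row m p) (i := i) (f := fun y : Fin d → ℕ => |z m (p k) (y k)|)
    (integrable_zrow k).abs.aestronglyMeasurable]
  exact integral_abs_zrow hm hp k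

lemma Mech.VF_int (h : Mech d n M) (k : Fin d) (p : Fin d → ℝ) : Integrable (VF m M k p) (dat n m p) := by
  unfold VF
  apply Integrable.mul_bdd (c := hi d)
  · exact ((integrable_finsetSum _ fun i _ => int_zdat p k i).const_mul _).add (integrable_const _)
  · exact Measurable.of_discrete.aestronglyMeasurable
  · exact Filter.Eventually.of_forall fun X => h.tb_le k X

lemma Mech.V (h : Mech d n M) (hm : 0 ≤ m) (k : Fin d) :
    Integrable (fun p => ∫ X, VF m M k p X ∂(dat n m p)) (bx d) ∧
    ∫ p, ∫ X, VF m M k p X ∂(dat n m p) ∂(bx d) = 0 := by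
  have hdp : (0:ℝ) < d := by exact_mod_cast h.hd
  have hhi : 0 ≤ hi d := (lo_pos h.hd).le.trans (lo_le_hi h.hd)
  have h1 := fubW (n := n) h.hd hm (VF m M k) (by
      intro X
      unfold VF wq wd z
      fun_prop) ((1 / (4 * (d:ℝ)^2) * (∑ i : Fin n, 2 * m) + 1 / d) * hi d) (by
      intro p hp
      have hpp : ∀ k, 0 < p k := fun k => lt_of_lt_of_le (lo_pos h.hd) (hp k).1
      have hI := h.VF_int (m := m) k p
      refine ⟨hI, ?_⟩
      have iz : Integrable (fun X : Fin n → Fin d → ℕ => ∑ i, |z m (p k) (X i k)|) (dat n m p) :=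
        integrable_finsetSum _ fun i _ => (int_zdat p k i).abs
      have ic := ((iz.const_mul (1 / (4 * (d:ℝ)^2))).add (integrable_const (1 / (d:ℝ)))).mul_const (hi d)
      refine (integral_mono hI.abs ic ?_).trans ?_
      · intro X
        simp only [VF, Pi.add_apply]
        rw [abs_mul]
        apply mul_le_mul _ (h.tb_le k X) (abs_nonneg _) (by positivity)
        refine (abs_add_le _ _).trans (add_le_add ?_ (wd_le h.hd (hp k)))
        rw [abs_mul, abs_of_nonneg (wq_nonneg (hp k))]
        exact mul_le_mul (wq_le h.hd _) (Finset.abs_sum_le_sum_abs _ _) (abs_nonneg _) (by positivity)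
      · rw [integral_mul_const]
        simp only [Pi.add_apply]
        rw [integral_add (iz.const_mul _) (integrable_const _), integral_const_mul,
          integral_finsetSum _ fun i _ => (int_zdat p k i).abs]
        simp only [integral_const, probReal_univ, one_smul]
        gcongr with i
        exact int_abs_zdat hm p hpp k i)
  refine ⟨h1.1, h1.2.trans ?_⟩
  have : ∀ X : Fin n → Fin d → ℕ, ∫ p, WW m p X * VF m M k p X ∂(bx d) = 0 := by
    intro X
    simp only [VF]
    simp_rw [← mul_assoc]
    rw [integral_mul_const, ibp h.hd, zero_mul]
  simp [this]

lemma Mech.R_int (h : Mech d n M) (hm : 0 ≤ m) : Integrable (fun p => R m p M) (bx d) := by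
  have hM := h.hM
  refine (fubW (n := n) h.hd hm (fun p X => ∫ θ, sq p θ ∂(M X)) ?_ (1 / d) ?_).1
  · intro X
    apply StronglyMeasurable.measurable
    apply StronglyMeasurable.integral_prod_right (f := fun (p : Fin d → ℝ) (θ : EE d) => sq p θ)
    apply Measurable.stronglyMeasurable
    unfold sq Function.uncurry
    fun_prop
  · intro p hp
    have c := h.ctx hm hp
    refine ⟨c.int_int_sq, ?_⟩
    refine (le_abs_self _).trans (abs_integral_le (Filter.Eventually.of_forall fun X => ?_))
    rw [abs_abs]
    exact abs_integral_le (c.sq_le X)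

lemma Mech.pointwise (h : Mech d n M) (hm : 0 ≤ m) {p : Fin d → ℝ} (hp : ∀ k, p k ∈ Set.Icc (lo d) (hi d)) :
    ∑ k, ∫ X, VF m M k p X ∂(dat n m p) ≤ T m p (fun k => wq d (p k)) M +
      ∑ k, (wd d (p k) * p k + wd d (p k) ^ 2 / 6) + 3 / 2 * R m p M := by
  have c := h.ctx hm hp
  have hM := h.hM
  set w : Fin d → ℝ := fun k => wq d (p k) with hw
  set G := ∑ k, (wd d (p k) * p k + wd d (p k) ^ 2 / 6) with hG
  have iT : Integrable (fun X => ∫ θ, ∑ i, L m p (cof p w θ) (X i) ∂(M X)) (dat n m p) := by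
    have : (fun X => ∫ θ, ∑ i, L m p (cof p w θ) (X i) ∂(M X)) = fun X => ∑ i, ∫ θ, L m p (cof p w θ) (X i) ∂(M X) := by
      ext X
      rw [integral_finsetSum _ fun i _ => c.int_L X (X i)]
    rw [this]
    exact integrable_finsetSum _ fun i _ => c.int_int_L i
  have iS : Integrable (fun X : Fin n → Fin d → ℕ => ∑ i, L m p (fun k => w k * p k) (X i)) (dat n m p) :=
    integrable_finsetSum _ fun i _ => integrable_Lrow _ i
  have eS : ∫ X : Fin n → Fin d → ℕ, ∑ i, L m p (fun k => w k * p k) (X i) ∂(dat n m p) = 0 := by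
    rw [integral_finsetSum _ fun i _ => integrable_Lrow _ i]
    exact Finset.sum_eq_zero fun i _ => integral_Lrow hm c.ppos _ i
  have iR := c.int_int_sq.const_mul (3 / 2)
  have i12 : Integrable (fun X => ∫ θ, ∑ i, L m p (cof p w θ) (X i) ∂(M X) +
      ∑ i, L m p (fun k => w k * p k) (X i)) (dat n m p) := iT.add iS
  have i123 : Integrable (fun X => ∫ θ, ∑ i, L m p (cof p w θ) (X i) ∂(M X) +
      ∑ i, L m p (fun k => w k * p k) (X i) + G) (dat n m p) := i12.add (integrable_const G)
  have i1234 := i123.add iR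
  rw [← integral_finsetSum _ fun k _ => h.VF_int k p]
  refine (integral_mono (integrable_finsetSum _ fun k _ => h.VF_int k p) i1234 ?_).trans (le_of_eq ?_)
  · intro X
    simp only [Pi.add_apply]
    have iTθ : Integrable (fun θ => ∑ i, L m p (cof p w θ) (X i)) (M X) := integrable_finsetSum _ fun i _ => c.int_L X (X i)
    set S := ∑ i, L m p (fun k => w k * p k) (X i) with hS
    set a : Fin d → ℝ := fun k => wq d (p k) * ∑ i, z m (p k) (X i k) + wd d (p k) with ha
    have e1 : ∑ k, VF m M k p X = ∫ θ, ∑ k, a k * θ k ∂(M X) := by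
      rw [integral_finsetSum _ fun k _ => (h.intθ k X).const_mul _]
      refine Finset.sum_congr rfl fun k _ => ?_
      rw [integral_const_mul]; rfl
    have iq := (c.int_sq X).const_mul (3 / 2)
    have iTc : Integrable (fun θ => (∑ i, L m p (cof p w θ) (X i)) + (S + G)) (M X) := iTθ.add (integrable_const _)
    have e2 : ∫ θ, ∑ i, L m p (cof p w θ) (X i) ∂(M X) + S + G + 3 / 2 * ∫ θ, sq p θ ∂(M X) =
        ∫ θ, ((∑ i, L m p (cof p w θ) (X i)) + (S + G)) + 3 / 2 * sq p θ ∂(M X) := by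
      rw [integral_add iTc iq, integral_add iTθ (integrable_const _), integral_const_mul]
      simp
      ring
    rw [e1, e2]
    apply integral_mono (integrable_finsetSum _ fun k _ => (h.intθ k X).const_mul _) (iTc.add iq)
    intro θ
    simp only [Pi.add_apply]
    have e3 : ∑ i, L m p (cof p w θ) (X i) = ∑ k, w k * (θ k - p k) * ∑ i, z m (p k) (X i k) := by
      simp only [L, cof, Finset.mul_sum]
      rw [Finset.sum_comm]
    have e4 : S = ∑ k, w k * p k * ∑ i, z m (p k) (X i k) := by
      simp only [hS, L, Finset.mul_sum]
      rw [Finset.sum_comm]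
    rw [e3, e4, hG, sq, Finset.mul_sum, ← Finset.sum_add_distrib, ← Finset.sum_add_distrib, ← Finset.sum_add_distrib]
    apply Finset.sum_le_sum
    intro k _
    simp only [ha, hw]
    set zz := ∑ i, z m (p k) (X i k)
    nlinarith [sq_nonneg (wd d (p k) - 3 * (θ k - p k))]
  · simp only [Pi.add_apply]
    rw [integral_add i123 iR, integral_add i12 (integrable_const G), integral_add iT iS, eS, integral_const_mul]
    simp [T, R]

lemma Mech.main (h : Mech d n M) (hm : 0 ≤ m) {A B : ℝ}
    (hT : ∀ p : Fin d → ℝ, (∀ k, p k ∈ Set.Icc (lo d) (hi d)) →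
      T m p (fun k => wq d (p k)) M ≤ A + B * R m p M) :
    1 / (9 * (d:ℝ)) ≤ A + (B + 3 / 2) * ((d:ℝ)^d * ∫ p, R m p M ∂(bx d)) := by
  have hdp : (0:ℝ) < d := by exact_mod_cast h.hd
  have iG : ∀ k : Fin d, Integrable (fun p : Fin d → ℝ => wd d (p k) * p k + wd d (p k) ^ 2 / 6) (bx d) := by
    intro k
    refine integrable_of_bdd (B := 1 / d * hi d + (1 / (d:ℝ))^2 / 6) ?_ ?_
    · unfold wd; fun_prop
    · filter_upwards [bx_ae] with p hp
      have h1 := wd_le h.hd (hp k)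
      have h0 : 0 < p k := lt_of_lt_of_le (lo_pos h.hd) (hp k).1
      refine (abs_add_le _ _).trans (add_le_add ?_ ?_)
      · rw [abs_mul, abs_of_pos h0]
        exact mul_le_mul h1 (hp k).2 h0.le (by positivity)
      · rw [abs_of_nonneg (by positivity), ← sq_abs]
        gcongr
  have iGs : Integrable (fun p : Fin d → ℝ => ∑ k, (wd d (p k) * p k + wd d (p k) ^ 2 / 6)) (bx d) :=
    integrable_finsetSum _ fun k _ => iG k
  have iR := (h.R_int hm).const_mul (B + 3 / 2)
  have i1 : Integrable (fun p : Fin d → ℝ => A + ∑ k, (wd d (p k) * p k + wd d (p k) ^ 2 / 6)) (bx d) := (integrable_const (μ := bx d) A).add iGs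
  have key : (0:ℝ) ≤ ∫ p, (A + ∑ k, (wd d (p k) * p k + wd d (p k) ^ 2 / 6)) + (B + 3 / 2) * R m p M ∂(bx d) := by
    have e0 : ∫ p, ∑ k, ∫ X, VF m M k p X ∂(dat n m p) ∂(bx d) = 0 := by
      rw [integral_finsetSum _ fun k _ => (h.V hm k).1]
      exact Finset.sum_eq_zero fun k _ => (h.V hm k).2
    rw [← e0]
    apply integral_mono_ae (integrable_finsetSum _ fun k _ => (h.V hm k).1) (i1.add iR)
    filter_upwards [bx_ae] with p hp
    simp only [Pi.add_apply]
    have := h.pointwise hm hp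
    have := hT p hp
    linarith
  rw [integral_add i1 iR, integral_add (integrable_const _) iGs, integral_const_mul,
    integral_finsetSum _ fun k _ => iG k, integral_const, smul_eq_mul] at key
  have k2 := mul_nonneg (pow_nonneg hdp.le d) key
  have e1 : (d:ℝ)^d * ∑ k : Fin d, ∫ p, (wd d (p k) * p k + wd d (p k) ^ 2 / 6) ∂(bx d) = - (1 / (9 * (d:ℝ))) := by
    rw [Finset.mul_sum]
    simp only [bx_wd h.hd]
    simp
    field_simp
  have e2 := bx_univ h.hd
  set I := (bx d).real Set.univ
  set Q := ∫ p, R m p M ∂(bx d)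
  set GG := ∑ k : Fin d, ∫ p, (wd d (p k) * p k + wd d (p k) ^ 2 / 6) ∂(bx d)
  have e3 : (d:ℝ)^d * (I * A + GG + (B + 3 / 2) * Q) = ((d:ℝ)^d * I) * A + (d:ℝ)^d * GG + (B + 3 / 2) * ((d:ℝ)^d * Q) := by ring
  rw [e3, e2, e1] at k2
  linarith

lemma set_conv (f : EE d → ℝ) :
    ∫ p in {p : EE d | ∀ k, p k ∈ Set.Icc (1 / (2 * (d : ℝ))) (3 / (2 * (d : ℝ)))}, f p =
      ∫ p, f (WithLp.toLp 2 p) ∂(bx d) := by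
  have hb : bx d = (volume : Measure (Fin d → ℝ)).restrict (Set.univ.pi fun _ => Set.Icc (lo d) (hi d)) := by
    rw [bx, volume_pi, Measure.restrict_pi_pi]
  rw [hb, ← (PiLp.volume_preserving_toLp (Fin d)).setIntegral_preimage_emb
    (MeasurableEquiv.toLp 2 _).measurableEmbedding]
  congr 2
  ext p
  simp only [Set.mem_preimage, Set.mem_setOf_eq, Set.mem_pi, Set.mem_univ, true_imp_iff, lo, hi]

lemma Mech.risk (h : Mech d n M) (hm : 0 ≤ m) :
    ∫ p in {p : EE d | ∀ k, p k ∈ Set.Icc (1 / (2 * (d : ℝ))) (3 / (2 * (d : ℝ)))},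
      ∑' X : Fin n → Fin d → ℕ, (∏ i, ∏ k, poisPMF (m * p k) (X i k)) * ∫ θ, ‖θ - p‖ ^ 2 ∂(M X) =
    ∫ p, R m p M ∂(bx d) := by
  rw [set_conv]
  apply integral_congr_ae
  filter_upwards [bx_ae] with p hp
  have c := h.ctx hm hp
  rw [R, dat_tsum p (fun k => mul_nonneg hm (c.ppos k).le) c.int_int_sq]
  refine tsum_congr fun X => ?_
  unfold WW
  congr 1
  congr 1
  ext θ
  rw [EuclideanSpace.real_norm_sq_eq]
  rfl

end partF

section partG
lemma exp_diff {ε : ℝ} (h0 : 0 < ε) (h1 : ε ≤ 1) : Real.exp ε - Real.exp (-ε) ≤ 4 * ε := by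
  have a := Real.abs_exp_sub_one_le (x := ε) (by rw [abs_of_pos h0]; exact h1)
  have b := Real.abs_exp_sub_one_le (x := -ε) (by rw [abs_neg, abs_of_pos h0]; exact h1)
  rw [abs_neg] at b
  rw [abs_of_pos h0] at a b
  have := (abs_le.1 a).2
  have := (abs_le.1 b).1
  linarith

lemma final {d n : ℕ} {s ε α δ : ℝ} (hd : 1 ≤ d) (hs : 1 ≤ s) (hε : 0 < ε) (hα : 0 < α) (hα1 : α ≤ 1)
    (hδ : 0 ≤ δ) (hδ' : δ ≤ 1 * (ε * α) / ((d : ℝ) ^ 2 * s))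
    {M : (Fin n → Fin d → ℕ) → Measure (EE d)} (h : Mech d n M) (hdp : Ctx.DP ε δ M)
    (hρ : (d:ℝ)^d * ∫ p, R (s ^ 2) p M ∂(bx d) ≤ α ^ 2 / (24 * (d:ℝ))) :
    1 / 1000 * (d:ℝ) ≤ n * (α * ε * s) := by
  have hd1 : (1:ℝ) ≤ d := by exact_mod_cast hd
  have hd0 : (0:ℝ) < d := by linarith
  have hs0 : 0 < s := by linarith
  have hm : (0:ℝ) ≤ s ^ 2 := by positivity
  set ρ := (d:ℝ)^d * ∫ p, R (s ^ 2) p M ∂(bx d) with hρdef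
  have hρ0 : 0 ≤ ρ := mul_nonneg (by positivity) (integral_nonneg fun p => integral_nonneg fun X =>
    integral_nonneg fun θ => Ctx.sq_nonneg' θ)
  have hα2 : α ^ 2 ≤ 1 := by nlinarith
  have hρ1 : 3 / 2 * ρ ≤ 1 / (16 * (d:ℝ)) := by
    calc 3 / 2 * ρ ≤ 3 / 2 * (α ^ 2 / (24 * (d:ℝ))) := by gcongr
      _ ≤ 3 / 2 * (1 / (24 * (d:ℝ))) := by gcongr
      _ = _ := by field_simp; norm_num
  -- the delta term
  have hδm : δ * s ^ 2 / (d:ℝ)^2 ≤ ε * α * s / (d:ℝ)^2 := by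
    have h1 : δ * s ^ 2 ≤ ε * α * s := by
      calc δ * s ^ 2 ≤ 1 * (ε * α) / ((d : ℝ) ^ 2 * s) * s ^ 2 := by gcongr
        _ = ε * α * s / (d:ℝ)^2 := by field_simp
        _ ≤ ε * α * s := div_le_self (by positivity) (one_le_pow₀ hd1)
    gcongr
  set t := (d:ℝ)^2 / (α * s) with ht
  have ht0 : 0 < t := by positivity
  have fin : ∀ K : ℝ, K ≤ 10 → 1 / (9 * (d:ℝ)) ≤ K * (n * (ε * α * s / (d:ℝ)^2)) + 1 / (16 * (d:ℝ)) →
      1 / 1000 * (d:ℝ) ≤ n * (α * ε * s) := by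
    intro K hK h1
    have hX : 0 ≤ n * (ε * α * s / (d:ℝ)^2) := by positivity
    have h2 : 7 / 144 * (1 / (d:ℝ)) ≤ 10 * (n * (ε * α * s / (d:ℝ)^2)) := by
      have e1 : 1 / (9 * (d:ℝ)) - 1 / (16 * (d:ℝ)) = 7 / 144 * (1 / (d:ℝ)) := by field_simp; norm_num
      have := mul_le_mul_of_nonneg_right hK hX
      linarith
    have h3 := mul_le_mul_of_nonneg_right h2 (sq_nonneg (d:ℝ))
    have e2 : 7 / 144 * (1 / (d:ℝ)) * (d:ℝ)^2 = 7 / 144 * d := by field_simp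
    have e3 : 10 * (n * (ε * α * s / (d:ℝ)^2)) * (d:ℝ)^2 = 10 * (n * (α * ε * s)) := by field_simp
    rw [e2, e3] at h3
    linarith
  rcases le_or_gt ε 1 with hε1 | hε1
  · have hE := exp_diff hε hε1
    have hE0 : 0 ≤ Real.exp ε - Real.exp (-ε) := by
      have : Real.exp (-ε) ≤ Real.exp ε := Real.exp_le_exp.2 (by linarith)
      linarith
    set E := Real.exp ε - Real.exp (-ε) with hEdef
    have key := h.main hm (A := n * (E * (1 / (2 * t)) + δ * s ^ 2 / (d:ℝ)^2))
      (B := n * (E * (t * s ^ 2 / (16 * (d:ℝ)^3)))) (by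
        intro p hp
        refine ((h.ctx hm hp).case1 hε.le hδ hdp ht0).trans (le_of_eq ?_)
        ring)
    rw [← hρdef] at key
    apply fin (3 + 1 / 96) (by norm_num)
    have hA : n * (E * (1 / (2 * t)) + δ * s ^ 2 / (d:ℝ)^2) ≤ 3 * (n * (ε * α * s / (d:ℝ)^2)) := by
      calc n * (E * (1 / (2 * t)) + δ * s ^ 2 / (d:ℝ)^2) ≤ n * (4 * ε * (1 / (2 * t)) + ε * α * s / (d:ℝ)^2) := by gcongr
        _ = _ := by rw [ht]; field_simp; ring
    have hB : n * (E * (t * s ^ 2 / (16 * (d:ℝ)^3))) * ρ ≤ 1 / 96 * (n * (ε * α * s / (d:ℝ)^2)) := by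
      calc n * (E * (t * s ^ 2 / (16 * (d:ℝ)^3))) * ρ ≤ n * (4 * ε * (t * s ^ 2 / (16 * (d:ℝ)^3))) * (α ^ 2 / (24 * (d:ℝ))) := by
            gcongr
        _ = _ := by rw [ht]; field_simp; ring
    rw [add_mul] at key
    linarith
  · rcases le_or_gt (α * s) 1 with hs1 | hs1
    · have ht2 : 0 < 1 / α ^ 2 := by positivity
      have key := h.main hm (A := n * s ^ 2 / (16 * (1 / α ^ 2) * (d:ℝ)^2)) (B := 1 / α ^ 2 / 2) (by
        intro p hp
        refine ((h.ctx hm hp).case2 ht2).trans (le_of_eq ?_)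
        ring)
      rw [← hρdef, add_mul] at key
      have hB : 1 / α ^ 2 / 2 * ρ ≤ 1 / (48 * (d:ℝ)) := by
        calc 1 / α ^ 2 / 2 * ρ ≤ 1 / α ^ 2 / 2 * (α ^ 2 / (24 * (d:ℝ))) := by gcongr
          _ = _ := by field_simp; norm_num
      have hA : n * s ^ 2 / (16 * (1 / α ^ 2) * (d:ℝ)^2) = n * (α * s) ^ 2 / (16 * (d:ℝ)^2) := by field_simp
      have hA2 : n * (α * s) ^ 2 / (16 * (d:ℝ)^2) ≤ n * (α * ε * s) / (16 * (d:ℝ)^2) := by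
        gcongr
        have : 0 < α * s := by positivity
        nlinarith
      have h3 : 1 / 36 * (1 / (d:ℝ)) ≤ n * (α * ε * s) / (16 * (d:ℝ)^2) := by
        have e1 : 1 / (9 * (d:ℝ)) - 1 / (16 * (d:ℝ)) - 1 / (48 * (d:ℝ)) = 1 / 36 * (1 / (d:ℝ)) := by field_simp; norm_num
        linarith
      have h4 := mul_le_mul_of_nonneg_right h3 (sq_nonneg (d:ℝ))
      have e2 : 1 / 36 * (1 / (d:ℝ)) * (d:ℝ)^2 = 1 / 36 * d := by field_simp
      have e3 : n * (α * ε * s) / (16 * (d:ℝ)^2) * (d:ℝ)^2 = n * (α * ε * s) / 16 := by field_simp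
      rw [e2, e3] at h4
      linarith
    · have htd : t ≤ (d:ℝ)^2 := div_le_self (by positivity) hs1.le
      have key := h.main hm (A := n * ((ε + 1) / t + δ * s ^ 2 / (d:ℝ)^2))
        (B := n * (t * s ^ 2 / (8 * (d:ℝ)^3))) (by
          intro p hp
          refine ((h.ctx hm hp).case3 hε.le hδ hdp ht0 htd).trans (le_of_eq ?_)
          ring)
      rw [← hρdef, add_mul] at key
      apply fin (3 + 1 / 192) (by norm_num)
      have hA : n * ((ε + 1) / t + δ * s ^ 2 / (d:ℝ)^2) ≤ 3 * (n * (ε * α * s / (d:ℝ)^2)) := by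
        calc n * ((ε + 1) / t + δ * s ^ 2 / (d:ℝ)^2) ≤ n * ((ε + ε) / t + ε * α * s / (d:ℝ)^2) := by gcongr
          _ = _ := by rw [ht]; field_simp; ring
      have hB : n * (t * s ^ 2 / (8 * (d:ℝ)^3)) * ρ ≤ 1 / 192 * (n * (ε * α * s / (d:ℝ)^2)) := by
        calc n * (t * s ^ 2 / (8 * (d:ℝ)^3)) * ρ ≤ n * (t * s ^ 2 / (8 * (d:ℝ)^3)) * (α ^ 2 / (24 * (d:ℝ))) := by
              gcongr
          _ = 1 / 192 * (n * (1 * α * s / (d:ℝ)^2)) := by rw [ht]; field_simp; ring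
          _ ≤ _ := by gcongr
      linarith

end partG

end PL

/-- Lower bound for private estimation of Poisson rates: if `M` is an `(ε,δ)` user-level
differentially private mechanism mapping datasets `X ∈ (ℕ^d)ⁿ` to distributions on the box
`[1/(2d), 3/(2d)]^d ⊆ ℝ^d`, with `δ ≤ c·εα/(d²√m)`, and if under the joint distribution
(`p` uniform on the box, `X_{i,k} ~ Poisson(m·p_k)` independent, `θ ~ M(X)`) we have
`E[‖θ − p‖₂²] ≤ α²/(24d)`, then `n ≥ c'·d/(αε√m)`. -/
theorem stmt_15 :
    ∃ c c' : ℝ, 0 < c ∧ 0 < c' ∧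
      ∀ (d m n : ℕ), 1 ≤ d → 1 ≤ m → 1 ≤ n →
      ∀ ε α δ : ℝ, 0 < ε → 0 < α → α ≤ 1 → 0 ≤ δ →
        δ ≤ c * (ε * α) / ((d : ℝ) ^ 2 * Real.sqrt m) →
      ∀ M : (Fin n → Fin d → ℕ) → Measure (EuclideanSpace ℝ (Fin d)),
        (∀ X, IsProbabilityMeasure (M X)) →
        (∀ X, M X {θ : EuclideanSpace ℝ (Fin d) |
            ∀ k, θ k ∈ Set.Icc (1 / (2 * (d : ℝ))) (3 / (2 * (d : ℝ)))} = 1) →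
        (∀ X X' : Fin n → Fin d → ℕ,
          (∃ i₀, ∀ i, i ≠ i₀ → X i = X' i) →
          ∀ S : Set (EuclideanSpace ℝ (Fin d)), MeasurableSet S →
            M X S ≤ ENNReal.ofReal (Real.exp ε) * M X' S + ENNReal.ofReal δ) →
        ((d : ℝ) ^ d *
            ∫ p in {p : EuclideanSpace ℝ (Fin d) |
                ∀ k, p k ∈ Set.Icc (1 / (2 * (d : ℝ))) (3 / (2 * (d : ℝ)))},
              ∑' X : Fin n → Fin d → ℕ,
                (∏ i, ∏ k, poisPMF ((m : ℝ) * p k) (X i k)) *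
                  ∫ θ, ‖θ - p‖ ^ 2 ∂(M X)) ≤ α ^ 2 / (24 * (d : ℝ)) →
        c' * (d : ℝ) / (α * ε * Real.sqrt m) ≤ (n : ℝ) := by
  refine ⟨1, 1 / 1000, one_pos, by norm_num, ?_⟩
  intro d m n hd hm _ ε α δ hε hα hα1 hδ hδ' M hM hbox hdp hrisk
  have hs : (1:ℝ) ≤ Real.sqrt m := by
    rw [Real.one_le_sqrt]; exact_mod_cast hm
  have hms : Real.sqrt m ^ 2 = (m:ℝ) := Real.sq_sqrt (by positivity)
  have hmech : PL.Mech d n M := by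
    refine ⟨hd, hM, fun X => ?_⟩
    have := hM X
    have hms : MeasurableSet {θ : EuclideanSpace ℝ (Fin d) |
        ∀ k, θ k ∈ Set.Icc (1 / (2 * (d : ℝ))) (3 / (2 * (d : ℝ)))} := by
      apply IsClosed.measurableSet
      simp only [Set.setOf_forall]
      exact isClosed_iInter fun k => isClosed_Icc.preimage (by fun_prop)
    exact (mem_ae_iff_prob_eq_one hms).2 (hbox X)
  rw [PL.Mech.risk hmech (by positivity), ← hms] at hrisk
  have := PL.final hd hs hε hα hα1 hδ hδ' hmech hdp hrisk
  rw [div_le_iff₀ (by positivity)]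
  exact this
end

section
/- There exist absolute constants C, C' > 0 and d₀ such that the following holds. For every ε, δ with 0 < ε, δ ≤ 1/3, every integer n ≥ C·(1/ε)·log(1/δ), every integer d ≥ d₀, and every real r > 0, there exists a map M assigning to each tuple (x₁,…,xₙ) ∈ (ℝ^d)ⁿ a Borel probability measure M(x₁,…,xₙ) on ℝ^d such that: (1) for any two tuples x, x' differing in at most one point and every Borel set S ⊆ ℝ^d, M(x)(S) ≤ e^{ε}·M(x')(S) + δ; and (2) whenever some point x ∈ ℝ^d satisfies #{i : ‖xᵢ − x‖₂ ≤ r} ≥ 2n/3, the measure M(x₁,…,xₙ) assigns probability 1 to the closed ball {y ∈ ℝ^d : ‖y − x‖₂ ≤ C'·r·√d}. -/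
open MeasureTheory Metric
open scoped ENNReal Classical

section dp18

theorem dp18_second_moment (d : ℕ) (R : ℝ) (v : EuclideanSpace ℝ (Fin d)) :
    (d : ℝ≥0∞) * ∫⁻ y in closedBall (0 : EuclideanSpace ℝ (Fin d)) R,
        ENNReal.ofReal ((inner ℝ y v) ^ 2) ≤
      ENNReal.ofReal (‖v‖ ^ 2 * R ^ 2) * volume (closedBall (0 : EuclideanSpace ℝ (Fin d)) R) := by
  have key : ∀ i : Fin d, ∫⁻ y in closedBall (0 : EuclideanSpace ℝ (Fin d)) R,
        ENNReal.ofReal ((inner ℝ y v) ^ 2) =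
      ∫⁻ y in closedBall (0 : EuclideanSpace ℝ (Fin d)) R,
        ENNReal.ofReal (‖v‖ ^ 2 * (y i) ^ 2) := by
    intro i
    set w : EuclideanSpace ℝ (Fin d) := ‖v‖ • EuclideanSpace.single i (1 : ℝ) with hw
    have hn : ‖v‖ = ‖w‖ := by simp [hw, norm_smul]
    set L := (ℝ ∙ (v - w))ᗮ.reflection with hL
    have hLv : L v = w := Submodule.reflection_sub hn
    have hmp : MeasurePreserving L volume volume := L.measurePreserving
    have h1 := hmp.setLIntegral_comp_preimage_emb L.toHomeomorph.measurableEmbedding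
      (fun y => ENNReal.ofReal (‖v‖ ^ 2 * (y i) ^ 2)) (closedBall 0 R)
    rw [← h1]
    have h2 : Set.preimage L (closedBall 0 R) = closedBall 0 R := by
      ext y; simp
    rw [h2]
    congr 1
    ext y
    congr 1
    have : inner ℝ y v = inner ℝ (L y) w := by rw [← hLv, L.inner_map_map]
    rw [this, hw, inner_smul_right, EuclideanSpace.inner_single_right]
    simp [mul_pow]
  calc (d : ℝ≥0∞) * ∫⁻ y in closedBall (0 : EuclideanSpace ℝ (Fin d)) R,
        ENNReal.ofReal ((inner ℝ y v) ^ 2)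
      = ∑ i : Fin d, ∫⁻ y in closedBall (0 : EuclideanSpace ℝ (Fin d)) R,
        ENNReal.ofReal (‖v‖ ^ 2 * (y i) ^ 2) := by
        rw [← Finset.sum_congr rfl (fun i _ => key i)]; simp
    _ = ∫⁻ y in closedBall (0 : EuclideanSpace ℝ (Fin d)) R,
        ∑ i : Fin d, ENNReal.ofReal (‖v‖ ^ 2 * (y i) ^ 2) := by
        rw [lintegral_finsetSum]
        intro i _
        fun_prop
    _ ≤ ∫⁻ y in closedBall (0 : EuclideanSpace ℝ (Fin d)) R, ENNReal.ofReal (‖v‖ ^ 2 * R ^ 2) := by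
        apply setLIntegral_mono measurable_const
        intro y hy
        rw [← ENNReal.ofReal_sum_of_nonneg (fun i _ => by positivity), ← Finset.mul_sum]
        apply ENNReal.ofReal_le_ofReal
        have h1 : ∑ i, y i ^ 2 = ‖y‖ ^ 2 := by
          rw [EuclideanSpace.norm_sq_eq]; simp
        rw [h1]
        have : ‖y‖ ≤ R := by simpa using hy
        gcongr
    _ = _ := by simp

theorem dp18_overlap0 (d : ℕ) (hd : 1 ≤ d) (r : ℝ) (hr : 0 < r)
    (v : EuclideanSpace ℝ (Fin d)) (hv : ‖v‖ ≤ r) :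
    volume (closedBall (0 : EuclideanSpace ℝ (Fin d)) (480 * r * √d) \
        closedBall v (480 * r * √d)) ≤
      ENNReal.ofReal (1 / 12) * volume (closedBall (0 : EuclideanSpace ℝ (Fin d)) (480 * r * √d)) := by
  have hd' : (1 : ℝ) ≤ d := by exact_mod_cast hd
  set R : ℝ := 480 * r * √d with hR
  have hR0 : 0 < R := by positivity
  have hR2 : R ^ 2 = 230400 * r ^ 2 * d := by
    rw [hR, mul_pow, mul_pow, Real.sq_sqrt (by positivity)]; ring
  set B := closedBall (0 : EuclideanSpace ℝ (Fin d)) R with hB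
  set t : ℝ := 1 - 1 / (24 * d) with ht
  have hu : 1 / (24 * (d : ℝ)) ≤ 1 := by
    rw [div_le_one (by positivity)]; linarith
  have ht0 : 0 ≤ t := by rw [ht]; linarith
  have ht1 : t ≤ 1 := by rw [ht]; have : 0 ≤ 1 / (24 * (d : ℝ)) := by positivity
                         linarith
  set B' := closedBall (0 : EuclideanSpace ℝ (Fin d)) (t * R) with hB'
  set θ : ℝ := (4799 * r ^ 2) ^ 2 with hθ
  have hVfin : volume B ≠ ∞ := measure_closedBall_lt_top.ne
  have hsub : B \ closedBall v R ⊆ (B \ B') ∪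
      ({y | ENNReal.ofReal θ ≤ ENNReal.ofReal ((inner ℝ y v) ^ 2)} ∩ B) := by
    rintro y ⟨hyB, hyv⟩
    by_cases hy : y ∈ B'
    · right
      refine ⟨?_, hyB⟩
      apply ENNReal.ofReal_le_ofReal
      have h1 : ‖y‖ ≤ t * R := by simpa [hB'] using hy
      have h2 : R < ‖y - v‖ := by simpa [dist_eq_norm] using hyv
      have h3 := norm_sub_sq_real y v
      have h4 : ‖y‖ ^ 2 ≤ t ^ 2 * R ^ 2 := by rw [← mul_pow]; gcongr
      have h5 : R ^ 2 < ‖y - v‖ ^ 2 := by gcongr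
      have h6 : ‖v‖ ^ 2 ≤ r ^ 2 := by gcongr
      have h7 : t ^ 2 * R ^ 2 ≤ R ^ 2 - 9600 * r ^ 2 := by
        have h8 : t ^ 2 ≤ t := by nlinarith
        have h9 : t * R ^ 2 = R ^ 2 - 9600 * r ^ 2 := by
          rw [hR2, ht]; field_simp; ring
        calc t ^ 2 * R ^ 2 ≤ t * R ^ 2 := by gcongr
          _ = _ := h9
      have h10 : 4799 * r ^ 2 ≤ - inner ℝ y v := by nlinarith [sq_nonneg r]
      rw [hθ, ← neg_sq (inner ℝ y v)]
      gcongr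
    · left; exact ⟨hyB, hy⟩
  have hA : volume (B \ B') ≤ ENNReal.ofReal (1 / 24) * volume B := by
    have hs : B' ⊆ B := closedBall_subset_closedBall (by nlinarith)
    rw [measure_sdiff hs measurableSet_closedBall.nullMeasurableSet
      measure_closedBall_lt_top.ne]
    have h1 : volume B' = ENNReal.ofReal (t ^ d) * volume B := by
      rw [hB', hB, Measure.addHaar_closedBall_mul _ _ ht0 hR0.le,
        Measure.addHaar_closedBall_center]
      simp
    have h2 : ENNReal.ofReal (23 / 24) ≤ ENNReal.ofReal (t ^ d) := by
      apply ENNReal.ofReal_le_ofReal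
      have h3 := one_add_mul_le_pow (a := -(1 / (24 * (d : ℝ)))) (by linarith) d
      have h4 : (d : ℝ) * -(1 / (24 * (d : ℝ))) = -(1/24) := by field_simp
      rw [h4] at h3
      have h5 : 1 + -(1 / (24 * (d : ℝ))) = t := by rw [ht]; ring
      rw [h5] at h3
      linarith
    rw [tsub_le_iff_right, h1, ← add_mul]
    have h6 : 1 ≤ ENNReal.ofReal (1 / 24) + ENNReal.ofReal (t ^ d) := by
      calc (1 : ℝ≥0∞) = ENNReal.ofReal (1 / 24) + ENNReal.ofReal (23 / 24) := by
            rw [← ENNReal.ofReal_add (by norm_num) (by norm_num)]; norm_num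
        _ ≤ _ := by gcongr
    calc volume B = 1 * volume B := by simp
      _ ≤ _ := by gcongr
  have hC : volume ({y | ENNReal.ofReal θ ≤ ENNReal.ofReal ((inner ℝ y v) ^ 2)} ∩ B) ≤
      ENNReal.ofReal (1 / 24) * volume B := by
    have hm : Measurable (fun y : EuclideanSpace ℝ (Fin d) =>
        ENNReal.ofReal ((inner ℝ y v) ^ 2)) := by fun_prop
    have h1 := mul_meas_ge_le_lintegral (μ := volume.restrict B) hm (ENNReal.ofReal θ)
    rw [Measure.restrict_apply (measurableSet_le measurable_const hm)] at h1
    have h2 := dp18_second_moment d R v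
    have h3 : (d : ℝ≥0∞) * (ENNReal.ofReal θ *
        volume ({y | ENNReal.ofReal θ ≤ ENNReal.ofReal ((inner ℝ y v) ^ 2)} ∩ B)) ≤
        ENNReal.ofReal (‖v‖ ^ 2 * R ^ 2) * volume B := (mul_le_mul_right h1 _).trans h2
    have hdθ : (d : ℝ≥0∞) * ENNReal.ofReal θ = ENNReal.ofReal (d * θ) := by
      rw [ENNReal.ofReal_mul (by positivity)]; simp
    rw [← mul_assoc, hdθ] at h3
    have h4 : ENNReal.ofReal (‖v‖ ^ 2 * R ^ 2) ≤ ENNReal.ofReal (d * θ) * ENNReal.ofReal (1 / 24) := by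
      rw [← ENNReal.ofReal_mul (by positivity)]
      apply ENNReal.ofReal_le_ofReal
      have h6 : ‖v‖ ^ 2 ≤ r ^ 2 := by gcongr
      calc ‖v‖ ^ 2 * R ^ 2 ≤ r ^ 2 * R ^ 2 := by gcongr
        _ = d * r ^ 4 * 230400 := by rw [hR2]; ring
        _ ≤ d * r ^ 4 * (4799 ^ 2 / 24) := by gcongr; norm_num
        _ = _ := by rw [hθ]; ring
    have h5 : ENNReal.ofReal (d * θ) ≠ 0 := by
      rw [ne_eq, ENNReal.ofReal_eq_zero, not_le]; positivity
    have h6 := h3.trans (mul_le_mul_left h4 (volume B))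
    rw [mul_assoc] at h6
    exact (ENNReal.mul_le_mul_iff_right h5 ENNReal.ofReal_ne_top).1 h6
  calc volume (B \ closedBall v R) ≤ _ := measure_mono hsub
    _ ≤ _ := measure_union_le _ _
    _ ≤ ENNReal.ofReal (1 / 24) * volume B + ENNReal.ofReal (1 / 24) * volume B := add_le_add hA hC
    _ = _ := by rw [← add_mul, ← ENNReal.ofReal_add (by norm_num) (by norm_num)]; norm_num

theorem dp18_overlap (d : ℕ) (hd : 1 ≤ d) (r : ℝ) (hr : 0 < r)
    (a b : EuclideanSpace ℝ (Fin d)) (hab : dist b a ≤ r) :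
    volume (closedBall a (480 * r * √d) \ closedBall b (480 * r * √d)) ≤
      ENNReal.ofReal (1 / 12) * volume (closedBall (0 : EuclideanSpace ℝ (Fin d)) (480 * r * √d)) := by
  have h := dp18_overlap0 d hd r hr (b - a) (by rwa [← dist_eq_norm])
  rw [← measure_preimage_add_right volume a
    (closedBall a (480 * r * √d) \ closedBall b (480 * r * √d))]
  convert h using 2
  ext y
  simp only [Set.mem_preimage, Set.mem_sdiff, mem_closedBall, dist_eq_norm]
  rw [show y + a - a = y - 0 by abel, show y + a - b = y - (b - a) by abel]


noncomputable def dp18cnt {n d : ℕ} (xs : Fin n → EuclideanSpace ℝ (Fin d)) (ρ : ℝ)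
    (y : EuclideanSpace ℝ (Fin d)) : ℕ :=
  (Finset.univ.filter (fun i => dist (xs i) y ≤ ρ)).card

noncomputable def dp18G (ε δ s : ℝ) : ℝ := min 1 (max 0 (δ * (Real.exp (ε * s) - 1)))

theorem dp18G_nonneg (ε δ s : ℝ) : 0 ≤ dp18G ε δ s := by
  unfold dp18G; positivity

theorem dp18G_le_one (ε δ s : ℝ) : dp18G ε δ s ≤ 1 := min_le_left _ _

theorem dp18G_zero (ε δ s : ℝ) (hε : 0 ≤ ε) (hδ : 0 ≤ δ) (hs : s ≤ 0) : dp18G ε δ s = 0 := by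
  unfold dp18G
  have h : Real.exp (ε * s) ≤ 1 := Real.exp_le_one_iff.2 (mul_nonpos_of_nonneg_of_nonpos hε hs)
  rw [max_eq_left (mul_nonpos_of_nonneg_of_nonpos hδ (by linarith))]
  simp

theorem dp18G_one (ε δ s : ℝ) (hδ : 0 < δ) (hδ1 : δ ≤ 1) (hs : Real.log (2 / δ) ≤ ε * s) :
    dp18G ε δ s = 1 := by
  unfold dp18G
  apply min_eq_left
  apply le_max_of_le_right
  have h : 2 / δ ≤ Real.exp (ε * s) := (Real.log_le_iff_le_exp (by positivity)).1 hs
  rw [div_le_iff₀ hδ] at h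
  nlinarith

theorem dp18G_mono (ε δ s t : ℝ) (hε : 0 ≤ ε) (hδ : 0 ≤ δ) (h : s ≤ t) :
    dp18G ε δ s ≤ dp18G ε δ t := by
  unfold dp18G; gcongr

theorem dp18G_step (ε δ s t : ℝ) (hε : 0 ≤ ε) (hε2 : Real.exp ε ≤ 2) (hδ : 0 ≤ δ) (h : s ≤ t + 1) :
    dp18G ε δ s ≤ Real.exp ε * dp18G ε δ t + δ := by
  refine (dp18G_mono ε δ s (t + 1) hε hδ h).trans ?_
  have he : 1 ≤ Real.exp ε := Real.one_le_exp hε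
  have hx : Real.exp (ε * (t + 1)) = Real.exp ε * Real.exp (ε * t) := by
    rw [← Real.exp_add]; ring_nf
  have h1 : δ * (Real.exp (ε * (t + 1)) - 1) ≤ Real.exp ε * (δ * (Real.exp (ε * t) - 1)) + δ := by
    rw [hx]; nlinarith
  rcases le_total 1 (max 0 (δ * (Real.exp (ε * t) - 1))) with h2 | h2
  · have : dp18G ε δ t = 1 := by unfold dp18G; exact min_eq_left h2
    rw [this]
    have := dp18G_le_one ε δ (t + 1)
    linarith
  · have h3 : dp18G ε δ t = max 0 (δ * (Real.exp (ε * t) - 1)) := by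
      unfold dp18G; exact min_eq_right h2
    rw [h3]
    unfold dp18G
    refine (min_le_right _ _).trans (max_le (by positivity) (h1.trans ?_))
    gcongr
    exact le_max_right _ _

theorem dp18cnt_measurable {n d : ℕ} (xs : Fin n → EuclideanSpace ℝ (Fin d)) (ρ : ℝ) :
    Measurable (dp18cnt xs ρ) := by
  have : dp18cnt xs ρ = fun y => ∑ i, if dist (xs i) y ≤ ρ then 1 else 0 := by
    ext y; simp [dp18cnt]
  rw [this]
  apply Finset.measurable_sum
  intro i _
  apply Measurable.ite _ measurable_const measurable_const
  exact measurableSet_le (by fun_prop) measurable_const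

theorem dp18cnt_le {n d : ℕ} (xs : Fin n → EuclideanSpace ℝ (Fin d)) (ρ : ℝ)
    (y : EuclideanSpace ℝ (Fin d)) : dp18cnt xs ρ y ≤ n := by
  unfold dp18cnt
  simpa using Finset.card_filter_le (Finset.univ : Finset (Fin n)) (fun i => dist (xs i) y ≤ ρ)

theorem dp18cnt_sens {n d : ℕ} (xs xs' : Fin n → EuclideanSpace ℝ (Fin d)) (ρ : ℝ)
    (h : ∃ i₀, ∀ i, i ≠ i₀ → xs i = xs' i)
    (y : EuclideanSpace ℝ (Fin d)) : dp18cnt xs ρ y ≤ dp18cnt xs' ρ y + 1 := by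
  obtain ⟨i₀, h⟩ := h
  unfold dp18cnt
  refine (Finset.card_le_card (t := insert i₀ (Finset.univ.filter
    (fun i => dist (xs' i) y ≤ ρ))) ?_).trans (Finset.card_insert_le _ _)
  intro i hi
  by_cases hi0 : i = i₀
  · simp [hi0]
  · rw [Finset.mem_insert]; right
    simpa [h i hi0] using hi

noncomputable def dp18q {n d : ℕ} (xs : Fin n → EuclideanSpace ℝ (Fin d)) (ρ : ℝ) : ℕ :=
  sSup (Set.range (dp18cnt xs ρ))

theorem dp18q_ge {n d : ℕ} (xs : Fin n → EuclideanSpace ℝ (Fin d)) (ρ : ℝ)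
    (y : EuclideanSpace ℝ (Fin d)) : dp18cnt xs ρ y ≤ dp18q xs ρ :=
  le_csSup ⟨n, by rintro _ ⟨y, rfl⟩; exact dp18cnt_le xs ρ y⟩ ⟨y, rfl⟩

theorem dp18q_attained {n d : ℕ} (xs : Fin n → EuclideanSpace ℝ (Fin d)) (ρ : ℝ) :
    ∃ y, dp18cnt xs ρ y = dp18q xs ρ :=
  Nat.sSup_mem (Set.range_nonempty _) ⟨n, by rintro _ ⟨y, rfl⟩; exact dp18cnt_le xs ρ y⟩

theorem dp18q_sens {n d : ℕ} (xs xs' : Fin n → EuclideanSpace ℝ (Fin d)) (ρ : ℝ)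
    (h : ∃ i₀, ∀ i, i ≠ i₀ → xs i = xs' i) : dp18q xs ρ ≤ dp18q xs' ρ + 1 := by
  obtain ⟨y, hy⟩ := dp18q_attained xs ρ
  have := dp18cnt_sens xs xs' ρ h y
  have := dp18q_ge xs' ρ y
  omega

theorem dp18_support {n d : ℕ} (hn : 0 < n) (xs : Fin n → EuclideanSpace ℝ (Fin d)) (R : ℝ) :
    volume {y | (n : ℝ) / 3 < dp18cnt xs R y} ≤
      3 * volume (closedBall (0 : EuclideanSpace ℝ (Fin d)) R) := by
  have hm : Measurable (fun y => (dp18cnt xs R y : ℝ≥0∞)) :=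
    (measurable_from_nat (f := fun k : ℕ => (k : ℝ≥0∞))).comp (dp18cnt_measurable xs R)
  have h1 := mul_meas_ge_le_lintegral (μ := volume) hm (ENNReal.ofReal ((n : ℝ) / 3))
  have h2 : ∫⁻ y, (dp18cnt xs R y : ℝ≥0∞) =
      n * volume (closedBall (0 : EuclideanSpace ℝ (Fin d)) R) := by
    have : ∀ y, (dp18cnt xs R y : ℝ≥0∞) =
        ∑ i, (closedBall (xs i) R).indicator (fun _ => (1 : ℝ≥0∞)) y := by
      intro y
      simp [dp18cnt, Set.indicator_apply, dist_comm]
    simp_rw [this]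
    rw [lintegral_finsetSum _ (fun i _ => measurable_const.indicator measurableSet_closedBall)]
    simp [lintegral_indicator measurableSet_closedBall, Measure.addHaar_closedBall_center]
  rw [h2] at h1
  have h3 : (n : ℝ≥0∞) = ENNReal.ofReal ((n : ℝ) / 3) * 3 := by
    rw [show (3 : ℝ≥0∞) = ENNReal.ofReal 3 by simp, ← ENNReal.ofReal_mul (by positivity)]
    rw [div_mul_cancel₀ _ (by norm_num)]; simp
  have h0 : ENNReal.ofReal ((n : ℝ) / 3) ≠ 0 := by
    rw [ne_eq, ENNReal.ofReal_eq_zero, not_le]; positivity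
  rw [h3, mul_assoc, ENNReal.mul_le_mul_iff_right h0 ENNReal.ofReal_ne_top] at h1
  refine (measure_mono ?_).trans h1
  intro y hy
  have hy : (n : ℝ) / 3 < dp18cnt xs R y := hy
  show ENNReal.ofReal ((n : ℝ) / 3) ≤ (dp18cnt xs R y : ℝ≥0∞)
  rw [← ENNReal.ofReal_natCast]
  exact ENNReal.ofReal_le_ofReal hy.le

theorem dp18_mass {n d : ℕ} (hn : 0 < n) (hd : 1 ≤ d) (r : ℝ) (hr : 0 < r)
    (xs : Fin n → EuclideanSpace ℝ (Fin d)) (x : EuclideanSpace ℝ (Fin d))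
    (hx : (3 / 5 : ℝ) * n ≤ dp18cnt xs r x) :
    ENNReal.ofReal (1 / 2) * volume (closedBall (0 : EuclideanSpace ℝ (Fin d)) (480 * r * √d)) ≤
      volume {y | (n : ℝ) / 2 ≤ dp18cnt xs (480 * r * √d) y} := by
  set R : ℝ := 480 * r * √d with hR
  set V := volume (closedBall (0 : EuclideanSpace ℝ (Fin d)) R) with hV
  set F := Finset.univ.filter (fun i => dist (xs i) x ≤ r) with hF
  have hFc : (3 / 5 : ℝ) * n ≤ F.card := hx
  have hn' : (0 : ℝ) < n := by exact_mod_cast hn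
  have hFpos : (0 : ℝ) < F.card := by linarith
  set f : EuclideanSpace ℝ (Fin d) → ℝ≥0∞ := fun y =>
    ∑ i ∈ F, (closedBall x R \ closedBall (xs i) R).indicator (fun _ => (1 : ℝ≥0∞)) y with hf
  have hms : ∀ i, MeasurableSet (closedBall x R \ closedBall (xs i) R) := fun i =>
    measurableSet_closedBall.diff measurableSet_closedBall
  have hfm : Measurable f := by
    apply Finset.measurable_sum
    intro i _
    exact measurable_const.indicator (hms i)
  have hint : ∫⁻ y, f y ≤ F.card * (ENNReal.ofReal (1 / 12) * V) := by
    rw [hf, lintegral_finsetSum _ (fun i _ => measurable_const.indicator (hms i)), ← nsmul_eq_mul]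
    apply Finset.sum_le_card_nsmul
    intro i hi
    rw [lintegral_indicator (hms i)]
    simp only [lintegral_const, one_mul, Measure.restrict_apply MeasurableSet.univ, Set.univ_inter]
    exact dp18_overlap d hd r hr x (xs i) (by simpa [hF] using hi)
  have hmk := (mul_meas_ge_le_lintegral (μ := volume) hfm (ENNReal.ofReal (F.card / 6))).trans hint
  have hbad : volume {y | ENNReal.ofReal (F.card / 6) ≤ f y} ≤ ENNReal.ofReal (1 / 2) * V := by
    have h3 : (F.card : ℝ≥0∞) * (ENNReal.ofReal (1 / 12) * V) =
        ENNReal.ofReal (F.card / 6) * (ENNReal.ofReal (1 / 2) * V) := by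
      rw [← mul_assoc, ← mul_assoc, ← ENNReal.ofReal_natCast, ← ENNReal.ofReal_mul (by positivity),
        ← ENNReal.ofReal_mul (by positivity)]
      congr 2; ring
    have h0 : ENNReal.ofReal ((F.card : ℝ) / 6) ≠ 0 := by
      rw [ne_eq, ENNReal.ofReal_eq_zero, not_le]; positivity
    rwa [h3, ENNReal.mul_le_mul_iff_right h0 ENNReal.ofReal_ne_top] at hmk
  have hcov : closedBall x R ⊆ {y | (n : ℝ) / 2 ≤ dp18cnt xs R y} ∪
      {y | ENNReal.ofReal (F.card / 6) ≤ f y} := by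
    intro y hy
    by_contra hcon
    simp only [Set.mem_union, Set.mem_ofPred_eq, not_or, not_le] at hcon
    obtain ⟨hc1, hc2⟩ := hcon
    have h1 : f y = ((F.filter (fun i => ¬ dist (xs i) y ≤ R)).card : ℝ≥0∞) := by
      rw [hf]
      simp only [Set.indicator_apply, Set.mem_sdiff, hy, true_and, mem_closedBall, dist_comm y]
      rw [Finset.sum_boole]
    have h2 : (F.filter (fun i => dist (xs i) y ≤ R)).card ≤ dp18cnt xs R y := by
      unfold dp18cnt
      apply Finset.card_le_card
      apply Finset.filter_subset_filter
      exact Finset.subset_univ _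
    have h3 := Finset.card_filter_add_card_filter_not (s := F) (fun i => dist (xs i) y ≤ R)
    rw [h1, ← ENNReal.ofReal_natCast, ENNReal.ofReal_lt_ofReal_iff (by positivity)] at hc2
    have h2' : ((F.filter (fun i => dist (xs i) y ≤ R)).card : ℝ) ≤ dp18cnt xs R y := by
      exact_mod_cast h2
    have h3' : ((F.filter (fun i => dist (xs i) y ≤ R)).card : ℝ) +
      (F.filter (fun i => ¬ dist (xs i) y ≤ R)).card = F.card := by exact_mod_cast h3
    linarith
  have hVx : volume (closedBall x R) = V := Measure.addHaar_closedBall_center _ _ _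
  have hVfin : V ≠ ∞ := measure_closedBall_lt_top.ne
  have h5 : V ≤ volume {y | (n : ℝ) / 2 ≤ dp18cnt xs R y} + ENNReal.ofReal (1 / 2) * V := by
    calc V = volume (closedBall x R) := hVx.symm
      _ ≤ _ := (measure_mono hcov).trans (measure_union_le _ _)
      _ ≤ _ := by gcongr
  have h6 : V = ENNReal.ofReal (1 / 2) * V + ENNReal.ofReal (1 / 2) * V := by
    rw [← add_mul, ← ENNReal.ofReal_add (by norm_num) (by norm_num)]; norm_num
  have h7 : ENNReal.ofReal (1 / 2) * V ≠ ∞ := ENNReal.mul_ne_top ENNReal.ofReal_ne_top hVfin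
  rw [h6] at h5
  rw [← h6] at h5
  nth_rewrite 1 [h6] at h5
  exact (ENNReal.add_le_add_iff_right h7).1 h5

theorem dp18_normalize {α : Type*} [MeasurableSpace α] (ν ν' : Measure α)
    [IsFiniteMeasure ν] [IsFiniteMeasure ν'] (e δ : ℝ) (he : 1 ≤ e) (he2 : e ≤ 2) (hδ : 0 ≤ δ)
    (h1 : ENNReal.ofReal (1 / 2) ≤ ν Set.univ) (h1' : ENNReal.ofReal (1 / 2) ≤ ν' Set.univ)
    (S : Set α)
    (h2 : ν S ≤ ENNReal.ofReal e * ν' S + ENNReal.ofReal (δ / 6))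
    (h3 : ν' Set.univ ≤ ENNReal.ofReal e * ν Set.univ + ENNReal.ofReal (δ / 6)) :
    ((ν Set.univ)⁻¹ • ν) S ≤
      ENNReal.ofReal (e * e) * ((ν' Set.univ)⁻¹ • ν') S + ENNReal.ofReal δ := by
  have c1 : ∀ (μ : Measure α) [IsFiniteMeasure μ] (T : Set α), μ T = ENNReal.ofReal (μ.real T) := by
    intro μ _ T; simp [Measure.real]
  have hS : ν'.real S ≤ ν'.real Set.univ := measureReal_mono (Set.subset_univ _)
  have n1 : 0 ≤ ν.real S := measureReal_nonneg
  have n2 : 0 ≤ ν'.real S := measureReal_nonneg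
  simp only [Measure.smul_apply, smul_eq_mul]
  rw [c1 ν, c1 ν' S, ← ENNReal.ofReal_mul (by positivity),
    ← ENNReal.ofReal_add (by positivity) (by positivity),
    ENNReal.ofReal_le_ofReal_iff (by positivity)] at h2
  rw [c1 ν, c1 ν', ← ENNReal.ofReal_mul (by positivity),
    ← ENNReal.ofReal_add (by positivity) (by positivity),
    ENNReal.ofReal_le_ofReal_iff (by positivity)] at h3
  rw [c1 ν, ENNReal.ofReal_le_ofReal_iff measureReal_nonneg] at h1
  rw [c1 ν', ENNReal.ofReal_le_ofReal_iff measureReal_nonneg] at h1'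
  rw [c1 ν, c1 ν S, c1 ν' Set.univ, c1 ν' S]
  set a := ν.real S
  set a' := ν'.real S
  set Z := ν.real Set.univ
  set Z' := ν'.real Set.univ
  have hZ : 0 < Z := by linarith
  have hZ' : 0 < Z' := by linarith
  rw [← ENNReal.ofReal_inv_of_pos hZ, ← ENNReal.ofReal_inv_of_pos hZ',
    ← ENNReal.ofReal_mul (by positivity), ← ENNReal.ofReal_mul (by positivity),
    ← ENNReal.ofReal_mul (by positivity), ← ENNReal.ofReal_add (by positivity) (by positivity)]
  apply ENNReal.ofReal_le_ofReal
  have k1 : Z⁻¹ ≤ 2 := by rw [inv_le_comm₀ hZ (by norm_num)]; linarith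
  set p' := Z'⁻¹ * a' with hp'
  have hp0 : 0 ≤ p' := by positivity
  have hp1 : p' ≤ 1 := by rw [hp', inv_mul_le_iff₀ hZ']; linarith
  have k2 : Z⁻¹ * a' ≤ e * p' + δ / 3 := by
    have ha : a' = p' * Z' := by rw [hp']; field_simp
    calc Z⁻¹ * a' = Z⁻¹ * (p' * Z') := by rw [ha]
      _ ≤ Z⁻¹ * (p' * (e * Z + δ / 6)) := by gcongr
      _ = e * p' + Z⁻¹ * p' * (δ / 6) := by field_simp
      _ ≤ e * p' + 2 * 1 * (δ / 6) := by gcongr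
      _ = _ := by ring
  calc Z⁻¹ * a ≤ Z⁻¹ * (e * a' + δ / 6) := by gcongr
    _ = e * (Z⁻¹ * a') + Z⁻¹ * (δ / 6) := by ring
    _ ≤ e * (e * p' + δ / 3) + 2 * (δ / 6) := by gcongr
    _ ≤ _ := by nlinarith

noncomputable def dp18nu {n d : ℕ} (ε δ r R : ℝ) (xs : Fin n → EuclideanSpace ℝ (Fin d)) :
    Measure (EuclideanSpace ℝ (Fin d)) :=
  (volume (closedBall (0 : EuclideanSpace ℝ (Fin d)) R))⁻¹ •
    volume.withDensity (fun y => ENNReal.ofReal (dp18G ε δ (dp18cnt xs R y - n / 3))) +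
  ENNReal.ofReal (dp18G ε δ (2 * n / 3 - dp18q xs r)) • Measure.dirac 0

theorem dp18_dens_meas {n d : ℕ} (ε δ R : ℝ) (xs : Fin n → EuclideanSpace ℝ (Fin d)) :
    Measurable (fun y => ENNReal.ofReal (dp18G ε δ (dp18cnt xs R y - n / 3))) :=
  (measurable_from_nat (f := fun k : ℕ => ENNReal.ofReal (dp18G ε δ (k - n / 3)))).comp
    (dp18cnt_measurable xs R)

theorem dp18nu_step {n d : ℕ} (hn : 0 < n) (ε δ r R : ℝ) (hR : 0 < R)
    (hε : 0 ≤ ε) (hε2 : Real.exp ε ≤ 2) (hδ : 0 ≤ δ)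
    (xs xs' : Fin n → EuclideanSpace ℝ (Fin d))
    (h : ∃ i₀, ∀ i, i ≠ i₀ → xs i = xs' i)
    (S : Set (EuclideanSpace ℝ (Fin d))) (hS : MeasurableSet S) :
    dp18nu ε δ r R xs S ≤ ENNReal.ofReal (Real.exp ε) * dp18nu ε δ r R xs' S +
      ENNReal.ofReal (4 * δ) := by
  have h' : ∃ i₀, ∀ i, i ≠ i₀ → xs' i = xs i := by
    obtain ⟨i₀, hi⟩ := h; exact ⟨i₀, fun i hne => (hi i hne).symm⟩
  set V := volume (closedBall (0 : EuclideanSpace ℝ (Fin d)) R) with hV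
  have hV0 : V ≠ 0 := (measure_closedBall_pos volume _ hR).ne'
  have hVfin : V ≠ ∞ := measure_closedBall_lt_top.ne
  have hstep : ∀ s t : ℝ, s ≤ t + 1 → ENNReal.ofReal (dp18G ε δ s) ≤
      ENNReal.ofReal (Real.exp ε) * ENNReal.ofReal (dp18G ε δ t) + ENNReal.ofReal δ := by
    intro s t hst
    have := dp18G_nonneg ε δ t
    rw [← ENNReal.ofReal_mul (by positivity), ← ENNReal.ofReal_add (by positivity) hδ]
    exact ENNReal.ofReal_le_ofReal (dp18G_step ε δ s t hε hε2 hδ hst)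
  set T := {y | (n : ℝ) / 3 < dp18cnt xs R y} with hT
  have hTm : MeasurableSet T := by
    apply measurableSet_lt measurable_const
    exact (measurable_from_nat (f := fun k : ℕ => (k : ℝ))).comp (dp18cnt_measurable xs R)
  have hint : ∫⁻ y in S, ENNReal.ofReal (dp18G ε δ (dp18cnt xs R y - n / 3)) ≤
      ENNReal.ofReal (Real.exp ε) * (∫⁻ y in S, ENNReal.ofReal (dp18G ε δ (dp18cnt xs' R y - n / 3)))
      + ENNReal.ofReal δ * (3 * V) := by
    calc ∫⁻ y in S, ENNReal.ofReal (dp18G ε δ (dp18cnt xs R y - n / 3))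
        ≤ ∫⁻ y in S, (ENNReal.ofReal (Real.exp ε) *
            ENNReal.ofReal (dp18G ε δ (dp18cnt xs' R y - n / 3)) +
            T.indicator (fun _ => ENNReal.ofReal δ) y) := by
          apply lintegral_mono
          intro y
          by_cases hy : y ∈ T
          · simp only [Set.indicator_of_mem hy]
            apply hstep
            have : (dp18cnt xs R y : ℝ) ≤ dp18cnt xs' R y + 1 := by
              exact_mod_cast dp18cnt_sens xs xs' R h y
            linarith
          · have : (dp18cnt xs R y : ℝ) ≤ n / 3 := not_lt.1 hy
            simp only []
            rw [dp18G_zero ε δ _ hε hδ (by linarith)]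
            simp
      _ = ENNReal.ofReal (Real.exp ε) *
            (∫⁻ y in S, ENNReal.ofReal (dp18G ε δ (dp18cnt xs' R y - n / 3)))
          + ∫⁻ y in S, T.indicator (fun _ => ENNReal.ofReal δ) y := by
          rw [lintegral_add_left ((dp18_dens_meas ε δ R xs').const_mul _),
            lintegral_const_mul _ (dp18_dens_meas ε δ R xs')]
      _ ≤ _ := by
          gcongr
          refine (setLIntegral_le_lintegral _ _).trans ?_
          rw [lintegral_indicator hTm]
          simp only [lintegral_const, Measure.restrict_apply MeasurableSet.univ, Set.univ_inter]
          gcongr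
          exact dp18_support hn xs R
  have hw := hstep (2 * n / 3 - dp18q xs r) (2 * n / 3 - dp18q xs' r) (by
    have : (dp18q xs' r : ℝ) ≤ dp18q xs r + 1 := by exact_mod_cast dp18q_sens xs' xs r h'
    linarith)
  unfold dp18nu
  simp only [Measure.add_apply, Measure.smul_apply, smul_eq_mul, withDensity_apply _ hS, ← hV]
  set I := ∫⁻ y in S, ENNReal.ofReal (dp18G ε δ (dp18cnt xs R y - n / 3))
  set I' := ∫⁻ y in S, ENNReal.ofReal (dp18G ε δ (dp18cnt xs' R y - n / 3))
  set D := (Measure.dirac (0 : EuclideanSpace ℝ (Fin d))) S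
  have hD : D ≤ 1 := prob_le_one
  set w := ENNReal.ofReal (dp18G ε δ (2 * n / 3 - dp18q xs r))
  set w' := ENNReal.ofReal (dp18G ε δ (2 * n / 3 - dp18q xs' r))
  calc V⁻¹ * I + w * D ≤ V⁻¹ * (ENNReal.ofReal (Real.exp ε) * I' + ENNReal.ofReal δ * (3 * V)) +
        (ENNReal.ofReal (Real.exp ε) * w' + ENNReal.ofReal δ) * D := by gcongr
    _ = ENNReal.ofReal (Real.exp ε) * (V⁻¹ * I' + w' * D) + (ENNReal.ofReal δ * 3 * (V⁻¹ * V) +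
        ENNReal.ofReal δ * D) := by ring
    _ ≤ ENNReal.ofReal (Real.exp ε) * (V⁻¹ * I' + w' * D) + (ENNReal.ofReal δ * 3 * 1 +
        ENNReal.ofReal δ * 1) := by
        rw [ENNReal.inv_mul_cancel hV0 hVfin]; gcongr
    _ = _ := by
        congr 1
        rw [ENNReal.ofReal_mul (by norm_num)]
        simp; ring

theorem dp18nu_finite {n d : ℕ} (hn : 0 < n) (ε δ r R : ℝ) (hR : 0 < R)
    (hε : 0 ≤ ε) (hδ : 0 ≤ δ)
    (xs : Fin n → EuclideanSpace ℝ (Fin d)) : IsFiniteMeasure (dp18nu ε δ r R xs) := by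
  constructor
  set V := volume (closedBall (0 : EuclideanSpace ℝ (Fin d)) R) with hV
  have hV0 : V ≠ 0 := (measure_closedBall_pos volume _ hR).ne'
  have hVfin : V ≠ ∞ := measure_closedBall_lt_top.ne
  unfold dp18nu
  simp only [Measure.add_apply, Measure.smul_apply, smul_eq_mul,
    withDensity_apply _ MeasurableSet.univ, ← hV]
  apply ENNReal.add_lt_top.2
  refine ⟨ENNReal.mul_lt_top (ENNReal.inv_lt_top.2 hV0.bot_lt) ?_,
    ENNReal.mul_lt_top ENNReal.ofReal_lt_top (measure_lt_top _ _)⟩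
  set T := {y | (n : ℝ) / 3 < dp18cnt xs R y} with hT
  have hTm : MeasurableSet T := by
    apply measurableSet_lt measurable_const
    exact (measurable_from_nat (f := fun k : ℕ => (k : ℝ))).comp (dp18cnt_measurable xs R)
  calc ∫⁻ y in Set.univ, ENNReal.ofReal (dp18G ε δ (dp18cnt xs R y - n / 3))
      ≤ ∫⁻ y in Set.univ, T.indicator (fun _ => 1) y := by
        apply lintegral_mono
        intro y
        by_cases hy : y ∈ T
        · simp only [Set.indicator_of_mem hy]
          simpa using dp18G_le_one _ _ _
        · have : (dp18cnt xs R y : ℝ) ≤ n / 3 := not_lt.1 hy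
          simp only []
          rw [dp18G_zero ε δ _ hε hδ (by linarith)]
          simp
    _ = volume T := by simp [lintegral_indicator hTm]
    _ ≤ 3 * V := dp18_support hn xs R
    _ < ∞ := ENNReal.mul_lt_top (by simp) hVfin.lt_top

theorem dp18nu_mass {n d : ℕ} (hn : 0 < n) (hd : 1 ≤ d) (ε δ r : ℝ) (hr : 0 < r)
    (hε : 0 < ε) (hδ : 0 < δ) (hδ1 : δ ≤ 1) (hL : Real.log (2 / δ) ≤ ε * (n / 15))
    (xs : Fin n → EuclideanSpace ℝ (Fin d)) :
    ENNReal.ofReal (1 / 2) ≤ dp18nu ε δ r (480 * r * √d) xs Set.univ := by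
  have hd' : (1 : ℝ) ≤ d := by exact_mod_cast hd
  set R := 480 * r * √d with hR
  have hR0 : 0 < R := by positivity
  set V := volume (closedBall (0 : EuclideanSpace ℝ (Fin d)) R) with hV
  have hV0 : V ≠ 0 := (measure_closedBall_pos volume _ hR0).ne'
  have hVfin : V ≠ ∞ := measure_closedBall_lt_top.ne
  have hn' : (0 : ℝ) < n := by exact_mod_cast hn
  unfold dp18nu
  simp only [Measure.add_apply, Measure.smul_apply, smul_eq_mul,
    withDensity_apply _ MeasurableSet.univ, ← hV]
  rcases le_total ((3 / 5 : ℝ) * n) (dp18q xs r) with h | h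
  · obtain ⟨x, hx⟩ := dp18q_attained xs r
    have hm := dp18_mass hn hd r hr xs x (by rw [hx]; exact h)
    refine le_trans ?_ (le_add_right le_rfl)
    have : ENNReal.ofReal (1 / 2) = V⁻¹ * (ENNReal.ofReal (1 / 2) * V) := by
      rw [mul_comm, mul_assoc, ENNReal.mul_inv_cancel hV0 hVfin, mul_one]
    rw [this]
    gcongr
    refine hm.trans ?_
    rw [← hR]
    have hTm : MeasurableSet {y | (n : ℝ) / 2 ≤ dp18cnt xs R y} := by
      apply measurableSet_le measurable_const
      exact (measurable_from_nat (f := fun k : ℕ => (k : ℝ))).comp (dp18cnt_measurable xs R)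
    rw [← lintegral_indicator_one hTm, Measure.restrict_univ]
    apply lintegral_mono
    intro y
    by_cases hy : y ∈ {y | (n : ℝ) / 2 ≤ dp18cnt xs R y}
    · rw [Set.indicator_of_mem hy]
      have hy : (n : ℝ) / 2 ≤ dp18cnt xs R y := hy
      simp only []
      rw [dp18G_one ε δ _ hδ hδ1]
      · simp
      · refine hL.trans ?_
        gcongr
        linarith
    · rw [Set.indicator_of_notMem hy]; exact zero_le
  · refine le_trans ?_ (le_add_left le_rfl)
    rw [dp18G_one ε δ _ hδ hδ1]
    · simp
    · refine hL.trans ?_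
      gcongr
      linarith

theorem dp18nu_compl {n d : ℕ} (ε δ r R : ℝ) (hε : 0 ≤ ε) (hδ : 0 ≤ δ)
    (xs : Fin n → EuclideanSpace ℝ (Fin d)) (x : EuclideanSpace ℝ (Fin d))
    (hx : 2 * (n : ℝ) / 3 ≤ dp18cnt xs r x) :
    dp18nu ε δ r R xs (closedBall x (R + r))ᶜ = 0 := by
  unfold dp18nu
  have hq : (dp18cnt xs r x : ℝ) ≤ dp18q xs r := by exact_mod_cast dp18q_ge xs r x
  have hms : MeasurableSet (closedBall x (R + r))ᶜ := measurableSet_closedBall.compl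
  simp only [Measure.add_apply, Measure.smul_apply, smul_eq_mul, withDensity_apply _ hms]
  rw [dp18G_zero ε δ (2 * n / 3 - dp18q xs r) hε hδ (by linarith)]
  simp only [ENNReal.ofReal_zero, zero_mul, add_zero]
  rw [setLIntegral_eq_zero hms, mul_zero]
  intro y hy
  simp only [Pi.zero_apply]
  rw [dp18G_zero ε δ _ hε hδ, ENNReal.ofReal_zero]
  by_contra hcon
  push Not at hcon
  apply hy
  set A := Finset.univ.filter (fun i => dist (xs i) x ≤ r) with hA
  set B := Finset.univ.filter (fun i => dist (xs i) y ≤ R) with hB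
  have hAc : 2 * (n : ℝ) / 3 ≤ A.card := hx
  have hBc : 0 < (B.card : ℝ) - n / 3 := hcon
  have hlt : Fintype.card (Fin n) < A.card + B.card := by
    rw [Fintype.card_fin]
    have : (n : ℝ) < (A.card + B.card : ℕ) := by push_cast; linarith
    exact_mod_cast this
  have hne : (A ∩ B).Nonempty := by
    rw [Finset.nonempty_iff_ne_empty]
    intro hem
    have h1 := Finset.card_union_add_card_inter A B
    rw [hem, Finset.card_empty] at h1
    have := Finset.card_le_univ (A ∪ B)
    omega
  obtain ⟨i, hi⟩ := hne
  rw [Finset.mem_inter] at hi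
  have h1 : dist (xs i) x ≤ r := by simpa [hA] using hi.1
  have h2 : dist (xs i) y ≤ R := by simpa [hB] using hi.2
  rw [mem_closedBall]
  have := dist_triangle_left y x (xs i)
  linarith

end dp18

/-- Theorem (inefficient private estimation with few points): for suitable absolute
constants `C, C', d₀`, for all `0 < ε, δ ≤ 1/3`, all `n ≥ C·(1/ε)·log(1/δ)`, all `d ≥ d₀`
and `r > 0`, there is an `(ε,δ)` (item-level) differentially private mechanism on `n`
points in `ℝ^d` that, whenever at least `2n/3` of the points lie within distance `r` of
some point `x`, outputs with probability `1` a point within `C'·r·√d` of `x`. -/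
theorem stmt_18 :
    ∃ C C' : ℝ, ∃ d₀ : ℕ, 0 < C ∧ 0 < C' ∧
      ∀ ε δ : ℝ, 0 < ε → ε ≤ 1/3 → 0 < δ → δ ≤ 1/3 →
      ∀ n : ℕ, C * (1/ε) * Real.log (1/δ) ≤ (n : ℝ) →
      ∀ d : ℕ, d₀ ≤ d → ∀ r : ℝ, 0 < r →
      ∃ M : (Fin n → EuclideanSpace ℝ (Fin d)) → Measure (EuclideanSpace ℝ (Fin d)),
        (∀ xs, IsProbabilityMeasure (M xs)) ∧
        (∀ xs xs' : Fin n → EuclideanSpace ℝ (Fin d),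
          (∃ i₀, ∀ i, i ≠ i₀ → xs i = xs' i) →
          ∀ S : Set (EuclideanSpace ℝ (Fin d)), MeasurableSet S →
            M xs S ≤ ENNReal.ofReal (Real.exp ε) * M xs' S + ENNReal.ofReal δ) ∧
        (∀ (xs : Fin n → EuclideanSpace ℝ (Fin d)) (x : EuclideanSpace ℝ (Fin d)),
          (2 * (n : ℝ) / 3) ≤
            ((Finset.univ.filter (fun i => dist (xs i) x ≤ r)).card : ℝ) →
          M xs (closedBall x (C' * r * Real.sqrt d)) = 1) := by
  refine ⟨150, 481, 1, by norm_num, by norm_num, ?_⟩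
  intro ε δ hε hε3 hδ hδ3 n hn d hd r hr
  have hd' : (1 : ℝ) ≤ d := by exact_mod_cast hd
  have hδi : 3 ≤ 1 / δ := by rw [le_div_iff₀ hδ]; linarith
  have hlog : 0 < Real.log (1 / δ) := Real.log_pos (by linarith)
  have hn' : (0 : ℝ) < n := lt_of_lt_of_le (by positivity) hn
  have hn0 : 0 < n := by exact_mod_cast hn'
  have hL : Real.log (2 / (δ / 24)) ≤ ε / 2 * (n / 15) := by
    have h1 : 2 / (δ / 24) ≤ (1 / δ) ^ 5 := by
      have : 2 / (δ / 24) = 48 * (1 / δ) := by field_simp; norm_num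
      rw [this]
      have h4 : (3 : ℝ) ^ 4 ≤ (1 / δ) ^ 4 := by gcongr
      have h0 : 0 < 1 / δ := by positivity
      nlinarith
    have h2 : Real.log (2 / (δ / 24)) ≤ 5 * Real.log (1 / δ) := by
      have := Real.log_le_log (by positivity) h1
      rw [Real.log_pow] at this
      exact_mod_cast this
    have h3 : 150 * Real.log (1 / δ) ≤ ε * n := by
      have := mul_le_mul_of_nonneg_left hn hε.le
      have h5 : ε * (150 * (1 / ε) * Real.log (1 / δ)) = 150 * Real.log (1 / δ) := by
        field_simp
      linarith
    linarith
  have he1 : 1 ≤ Real.exp (ε / 2) := Real.one_le_exp (by positivity)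
  have he2 : Real.exp (ε / 2) ≤ 2 := by
    rw [← Real.le_log_iff_exp_le (by norm_num)]
    have := Real.log_two_gt_d9
    linarith
  set R := 480 * r * √d with hR
  have hR0 : 0 < R := by positivity
  set ν : (Fin n → EuclideanSpace ℝ (Fin d)) → Measure (EuclideanSpace ℝ (Fin d)) :=
    fun xs => dp18nu (ε / 2) (δ / 24) r R xs with hν
  have hfin : ∀ xs, IsFiniteMeasure (ν xs) := fun xs =>
    dp18nu_finite hn0 _ _ _ _ hR0 (by positivity) (by positivity) xs
  have hmass : ∀ xs, ENNReal.ofReal (1 / 2) ≤ ν xs Set.univ := fun xs =>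
    dp18nu_mass hn0 hd _ _ r hr (by positivity) (by positivity) (by linarith) hL xs
  have hne : ∀ xs, ν xs Set.univ ≠ 0 := fun xs h0 => by
    have := hmass xs
    rw [h0] at this
    norm_num at this
  have hprob : ∀ xs, IsProbabilityMeasure ((ν xs Set.univ)⁻¹ • ν xs) := fun xs => ⟨by
    simp only [Measure.smul_apply, smul_eq_mul]
    exact ENNReal.inv_mul_cancel (hne xs) (measure_ne_top _ _)⟩
  refine ⟨fun xs => (ν xs Set.univ)⁻¹ • ν xs, hprob, ?_, ?_⟩
  · intro xs xs' h S hS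
    have h' : ∃ i₀, ∀ i, i ≠ i₀ → xs' i = xs i := by
      obtain ⟨i₀, hi⟩ := h; exact ⟨i₀, fun i hne => (hi i hne).symm⟩
    have h4 : 4 * (δ / 24) = δ / 6 := by ring
    have a1 := dp18nu_step hn0 (ε / 2) (δ / 24) r R hR0 (by positivity) he2 (by positivity)
      xs xs' h S hS
    have a2 := dp18nu_step hn0 (ε / 2) (δ / 24) r R hR0 (by positivity) he2 (by positivity)
      xs' xs h' Set.univ MeasurableSet.univ
    rw [h4] at a1 a2
    have := dp18_normalize (ν xs) (ν xs') (Real.exp (ε / 2)) δ he1 he2 hδ.le (hmass xs) (hmass xs')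
      S a1 a2
    rwa [← Real.exp_add, add_halves] at this
  · intro xs x hx
    have hP := hprob xs
    show ((ν xs Set.univ)⁻¹ • ν xs) _ = 1
    rw [← prob_compl_eq_zero_iff measurableSet_closedBall]
    simp only [Measure.smul_apply, smul_eq_mul]
    have hz := dp18nu_compl (ε / 2) (δ / 24) r R (by positivity) (by positivity) xs x hx
    have hsub : (closedBall x (481 * r * √d))ᶜ ⊆ (closedBall x (R + r))ᶜ := by
      apply Set.compl_subset_compl.2
      apply closedBall_subset_closedBall
      have : 1 ≤ √(d : ℝ) := Real.one_le_sqrt.2 hd'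
      rw [hR]; nlinarith
    rw [measure_mono_null hsub hz, mul_zero]
end

section
/- There exist absolute constants C, C' ≥ 1 and d₀ such that the following holds. For every ε, δ, α with 0 < ε, δ, α ≤ 1/3, every integer d ≥ d₀, every real r > 0, and every integer n with C·(1/ε)·log(1/δ) ≤ n ≤ √d·(1/ε)·log(1/δ), there exists a map M assigning to each tuple (x₁,…,xₙ) ∈ (ℝ^d)ⁿ a Borel probability measure M(x₁,…,xₙ) on ℝ^d such that: (1) for any two tuples x, x' differing in at most one point and every Borel set S ⊆ ℝ^d, M(x)(S) ≤ e^{C'·ε}·M(x')(S) + C'·δ; and (2) whenever some point x ∈ ℝ^d satisfies #{i : ‖xᵢ − x‖₂ ≤ r} ≥ 2n/3, the measure M(x₁,…,xₙ) assigns probability at least 1 − α to the closed ball {y ∈ ℝ^d : ‖y − x‖₂ ≤ C'·r·√d·(1/ε)·log(d/δ)·√(log(1/δ))·√(log(d·n/α))/n}. -/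
open MeasureTheory Metric
open scoped ENNReal Classical

section gaussian
variable {d : ℕ}

noncomputable def gm (d : ℕ) (b : ℝ) (m : EuclideanSpace ℝ (Fin d)) :
    Measure (EuclideanSpace ℝ (Fin d)) :=
  volume.withDensity (fun z => ENNReal.ofReal (((Real.pi / b) ^ ((d : ℝ) / 2))⁻¹ *
    Real.exp (-b * ‖z - m‖ ^ 2)))

lemma lint_base (b : ℝ) (hb : 0 < b) :
    ∫⁻ z : EuclideanSpace ℝ (Fin d), ENNReal.ofReal (Real.exp (-b * ‖z‖ ^ 2)) =
      ENNReal.ofReal ((Real.pi / b) ^ ((d : ℝ) / 2)) := by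
  have h := GaussianFourier.integral_rexp_neg_mul_sq_norm
    (V := EuclideanSpace ℝ (Fin d)) hb
  rw [finrank_euclideanSpace_fin] at h
  rw [← h, ofReal_integral_eq_lintegral_ofReal]
  · by_contra hn
    rw [integral_undef hn] at h
    have : 0 < (Real.pi / b) ^ ((d : ℝ) / 2) := by positivity
    linarith
  · exact Filter.Eventually.of_forall fun z => (Real.exp_pos _).le

lemma lint_shift (b : ℝ) (hb : 0 < b) (m : EuclideanSpace ℝ (Fin d)) (A : ℝ) (hA : 0 ≤ A) :
    ∫⁻ z : EuclideanSpace ℝ (Fin d), ENNReal.ofReal (A * Real.exp (-b * ‖z - m‖ ^ 2)) =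
      ENNReal.ofReal (A * (Real.pi / b) ^ ((d : ℝ) / 2)) := by
  rw [ENNReal.ofReal_mul hA, ← lint_base b hb,
    ← lintegral_sub_right_eq_self (fun z : EuclideanSpace ℝ (Fin d) =>
      ENNReal.ofReal (Real.exp (-b * ‖z‖ ^ 2))) m, ← lintegral_const_mul' _ _ ENNReal.ofReal_ne_top]
  simp only [ENNReal.ofReal_mul hA]

lemma gm_prob (b : ℝ) (hb : 0 < b) (m : EuclideanSpace ℝ (Fin d)) :
    IsProbabilityMeasure (gm d b m) := by
  constructor
  rw [gm, withDensity_apply _ MeasurableSet.univ, Measure.restrict_univ, lint_shift b hb m _ (by positivity),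
    inv_mul_cancel₀ (by positivity), ENNReal.ofReal_one]

/-- Norm tail. -/
lemma gm_tail (b : ℝ) (hb : 0 < b) (m : EuclideanSpace ℝ (Fin d)) (T : ℝ) :
    gm d b m {z | T < ‖z - m‖ ^ 2} ≤ ENNReal.ofReal (Real.exp (d - b / 2 * T)) := by
  have hS : MeasurableSet {z : EuclideanSpace ℝ (Fin d) | T < ‖z - m‖ ^ 2} :=
    measurableSet_lt measurable_const (by fun_prop)
  rw [gm, withDensity_apply _ hS]
  have h2 : ((Real.pi / (b / 2)) ^ ((d : ℝ) / 2)) =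
      (2 : ℝ) ^ ((d : ℝ) / 2) * (Real.pi / b) ^ ((d : ℝ) / 2) := by
    rw [← Real.mul_rpow (by norm_num) (by positivity)]; congr 1; field_simp
  have hpos : 0 < (Real.pi / b) ^ ((d : ℝ) / 2) := by positivity
  have h3 : (2 : ℝ) ^ ((d : ℝ) / 2) ≤ Real.exp d := by
    rw [Real.rpow_def_of_pos (by norm_num)]
    apply Real.exp_le_exp.2
    have : Real.log 2 ≤ 1 := by linarith [Real.log_two_lt_d9]
    have hd : (0 : ℝ) ≤ d := Nat.cast_nonneg d
    nlinarith
  calc _ ≤ ∫⁻ z in {z | T < ‖z - m‖ ^ 2}, ENNReal.ofReal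
        (((Real.pi / b) ^ ((d : ℝ) / 2))⁻¹ * Real.exp (-(b / 2 * T)) *
          Real.exp (-(b / 2) * ‖z - m‖ ^ 2)) := by
        apply setLIntegral_mono' hS
        intro z hz
        apply ENNReal.ofReal_le_ofReal
        rw [mul_assoc, ← Real.exp_add]
        gcongr
        have hz' : T < ‖z - m‖ ^ 2 := hz
        nlinarith
    _ ≤ ∫⁻ z, ENNReal.ofReal
        (((Real.pi / b) ^ ((d : ℝ) / 2))⁻¹ * Real.exp (-(b / 2 * T)) *
          Real.exp (-(b / 2) * ‖z - m‖ ^ 2)) := setLIntegral_le_lintegral _ _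
    _ = _ := lint_shift (b / 2) (by positivity) m _ (by positivity)
    _ ≤ _ := by
        apply ENNReal.ofReal_le_ofReal
        rw [h2, sub_eq_add_neg, Real.exp_add]
        have : ((Real.pi / b) ^ ((d : ℝ) / 2))⁻¹ * Real.exp (-(b / 2 * T)) *
          ((2 : ℝ) ^ ((d : ℝ) / 2) * (Real.pi / b) ^ ((d : ℝ) / 2)) =
          (2 : ℝ) ^ ((d : ℝ) / 2) * Real.exp (-(b / 2 * T)) := by
          field_simp
        rw [this]
        gcongr

/-- Privacy of the Gaussian mechanism. -/
lemma gm_dp (b ε t : ℝ) (hb : 0 < b) (ht : 0 ≤ t)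
    (m m' : EuclideanSpace ℝ (Fin d)) (S : Set (EuclideanSpace ℝ (Fin d)))
    (hS : MeasurableSet S) :
    gm d b m S ≤ ENNReal.ofReal (Real.exp ε) * gm d b m' S +
      ENNReal.ofReal (Real.exp (b * ‖m - m'‖ ^ 2 * (t + t ^ 2) - t * ε)) := by
  set K := ((Real.pi / b) ^ ((d : ℝ) / 2))⁻¹ with hK
  have hKpos : 0 < K := by positivity
  have key : ∀ z : EuclideanSpace ℝ (Fin d),
      ENNReal.ofReal (K * Real.exp (-b * ‖z - m‖ ^ 2)) ≤
      ENNReal.ofReal (Real.exp ε) * ENNReal.ofReal (K * Real.exp (-b * ‖z - m'‖ ^ 2)) +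
      ENNReal.ofReal (K * Real.exp (b * ‖m - m'‖ ^ 2 * (t + t ^ 2) - t * ε) *
        Real.exp (-b * ‖z - (m + t • (m - m'))‖ ^ 2)) := by
    intro z
    rw [← ENNReal.ofReal_mul (by positivity), ← ENNReal.ofReal_add (by positivity) (by positivity)]
    apply ENNReal.ofReal_le_ofReal
    set w := z - m with hw
    set v := m - m' with hv
    have e1 : z - m' = w + v := by rw [hw, hv]; abel
    have e2 : z - (m + t • v) = w - t • v := by rw [hw]; abel
    rw [e1, e2, norm_add_sq_real w v, norm_sub_sq_real w (t • v), inner_smul_right, norm_smul]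
    set q := inner ℝ w v
    rcases le_total (b * (2 * q + ‖v‖ ^ 2)) ε with h | h
    · have : K * Real.exp (-b * ‖w‖ ^ 2) ≤
          Real.exp ε * (K * Real.exp (-b * (‖w‖ ^ 2 + 2 * q + ‖v‖ ^ 2))) := by
        rw [mul_left_comm, ← Real.exp_add]
        gcongr
        nlinarith
      have h0 : 0 ≤ K * Real.exp (b * ‖v‖ ^ 2 * (t + t ^ 2) - t * ε) *
        Real.exp (-b * (‖w‖ ^ 2 - 2 * (t * q) + (‖t‖ * ‖v‖) ^ 2)) := by positivity
      linarith
    · have : K * Real.exp (-b * ‖w‖ ^ 2) ≤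
          K * Real.exp (b * ‖v‖ ^ 2 * (t + t ^ 2) - t * ε) *
        Real.exp (-b * (‖w‖ ^ 2 - 2 * (t * q) + (‖t‖ * ‖v‖) ^ 2)) := by
        rw [mul_assoc, ← Real.exp_add]
        gcongr
        rw [Real.norm_eq_abs, mul_pow, sq_abs]
        nlinarith [mul_le_mul_of_nonneg_left h ht]
      have h0 : 0 ≤ Real.exp ε * (K * Real.exp (-b * (‖w‖ ^ 2 + 2 * q + ‖v‖ ^ 2))) := by
        positivity
      linarith
  rw [gm, gm, withDensity_apply _ hS, withDensity_apply _ hS,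
    ← lintegral_const_mul' _ _ ENNReal.ofReal_ne_top]
  calc _ ≤ _ := lintegral_mono key
    _ = _ := lintegral_add_left (by fun_prop) _
    _ ≤ _ := by
      gcongr
      refine (setLIntegral_le_lintegral _ _).trans ?_
      rw [lint_shift b hb _ _ (by positivity)]
      apply ENNReal.ofReal_le_ofReal
      apply le_of_eq
      rw [hK]
      have hpos : 0 < (Real.pi / b) ^ ((d : ℝ) / 2) := by positivity
      field_simp
end gaussian

section core
variable {d n : ℕ}

noncomputable def cnt (r : ℝ) (xs : Fin n → EuclideanSpace ℝ (Fin d)) (i : Fin n) : ℕ :=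
  (Finset.univ.filter (fun j => dist (xs i) (xs j) ≤ 2 * r)).card

noncomputable def wt (r : ℝ) (xs : Fin n → EuclideanSpace ℝ (Fin d)) (i : Fin n) : ℝ :=
  max 0 (min 1 (12 * (cnt r xs i : ℝ) / n - 7))

noncomputable def tot (r : ℝ) (xs : Fin n → EuclideanSpace ℝ (Fin d)) : ℝ :=
  ∑ i, wt r xs i

noncomputable def ctr (r : ℝ) (xs : Fin n → EuclideanSpace ℝ (Fin d)) :
    EuclideanSpace ℝ (Fin d) :=
  (tot r xs)⁻¹ • ∑ i, wt r xs i • xs i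

lemma inter_ne (A B : Finset (Fin n)) (i₀ : Fin n) (h : n + 1 < A.card + B.card) :
    ∃ j, j ≠ i₀ ∧ j ∈ A ∧ j ∈ B := by
  have h1 := Finset.card_union_add_card_inter A B
  have h2 : (A ∪ B).card ≤ n := by simpa using Finset.card_le_univ (A ∪ B)
  have h3 : 1 < (A ∩ B).card := by omega
  obtain ⟨j, hj, hne⟩ := Finset.exists_mem_ne h3 i₀
  exact ⟨j, hne, (Finset.mem_inter.1 hj).1, (Finset.mem_inter.1 hj).2⟩

lemma wt_nonneg (r : ℝ) (xs : Fin n → EuclideanSpace ℝ (Fin d)) (i : Fin n) : 0 ≤ wt r xs i :=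
  le_max_left _ _

lemma wt_le_one (r : ℝ) (xs : Fin n → EuclideanSpace ℝ (Fin d)) (i : Fin n) : wt r xs i ≤ 1 :=
  max_le zero_le_one (min_le_left _ _)

lemma cnt_le (r : ℝ) (xs xs' : Fin n → EuclideanSpace ℝ (Fin d)) (i₀ : Fin n)
    (h : ∀ i, i ≠ i₀ → xs i = xs' i) (i : Fin n) (hi : i ≠ i₀) :
    cnt r xs i ≤ cnt r xs' i + 1 := by
  refine le_trans (Finset.card_le_card ?_) (Finset.card_insert_le i₀ _)
  intro j hj
  by_cases hj0 : j = i₀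
  · simp [hj0]
  · simp only [Finset.mem_filter, Finset.mem_univ, true_and, Finset.mem_insert] at hj ⊢
    right
    rwa [← h i hi, ← h j hj0]

lemma wt_sens (r : ℝ) (xs xs' : Fin n → EuclideanSpace ℝ (Fin d)) (i₀ : Fin n)
    (h : ∀ i, i ≠ i₀ → xs i = xs' i) (i : Fin n) (hi : i ≠ i₀) :
    |wt r xs i - wt r xs' i| ≤ 12 / n := by
  have hn : (0 : ℝ) < n := by exact_mod_cast i.pos
  have h1 : (cnt r xs i : ℝ) ≤ cnt r xs' i + 1 := by exact_mod_cast cnt_le r xs xs' i₀ h i hi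
  have h2 : (cnt r xs' i : ℝ) ≤ cnt r xs i + 1 := by
    exact_mod_cast cnt_le r xs' xs i₀ (fun j hj => (h j hj).symm) i hi
  have e1 : 12 * (cnt r xs i : ℝ) / n ≤ 12 * (cnt r xs' i : ℝ) / n + 12 / n := by
    rw [← add_div]; gcongr; linarith
  have e2 : 12 * (cnt r xs' i : ℝ) / n ≤ 12 * (cnt r xs i : ℝ) / n + 12 / n := by
    rw [← add_div]; gcongr; linarith
  have e3 : (0 : ℝ) < 12 / n := by positivity
  unfold wt
  generalize 12 * (cnt r xs i : ℝ) / n = a at *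
  generalize 12 * (cnt r xs' i : ℝ) / n = b at *
  generalize (12 : ℝ) / n = c at *
  rw [abs_le]
  constructor <;>
  · rcases max_cases 0 (min 1 (a - 7)) with ⟨h1, _⟩ | ⟨h1, _⟩ <;>
    rcases max_cases 0 (min 1 (b - 7)) with ⟨h2, _⟩ | ⟨h2, _⟩ <;>
    rcases min_cases 1 (a - 7) with ⟨h3, _⟩ | ⟨h3, _⟩ <;>
    rcases min_cases 1 (b - 7) with ⟨h4, _⟩ | ⟨h4, _⟩ <;> rw [h1, h2] <;> linarith

lemma sum_bound (n : ℕ) (g : Fin n → ℝ) (i₀ : Fin n) (a b : ℝ) (ha : 0 ≤ a)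
    (h0 : g i₀ ≤ b) (h : ∀ i, i ≠ i₀ → g i ≤ a / n) : ∑ i, g i ≤ a + b := by
  have hn : (0 : ℝ) < n := by exact_mod_cast i₀.pos
  rw [← Finset.sum_erase_add _ _ (Finset.mem_univ i₀)]
  gcongr
  calc ∑ i ∈ Finset.univ.erase i₀, g i ≤ ∑ i ∈ Finset.univ.erase i₀, a / n :=
        Finset.sum_le_sum fun i hi => h i (Finset.ne_of_mem_erase hi)
    _ ≤ ∑ i : Fin n, a / n :=
        Finset.sum_le_sum_of_subset_of_nonneg (Finset.erase_subset _ _)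
          (fun _ _ _ => by positivity)
    _ = a := by simp; field_simp

lemma tot_sens (r : ℝ) (xs xs' : Fin n → EuclideanSpace ℝ (Fin d)) (i₀ : Fin n)
    (h : ∀ i, i ≠ i₀ → xs i = xs' i) : |tot r xs - tot r xs'| ≤ 13 := by
  unfold tot
  rw [← Finset.sum_sub_distrib]
  refine (Finset.abs_sum_le_sum_abs _ _).trans ?_
  refine (sum_bound n _ i₀ 12 1 (by norm_num) ?_ (fun i hi => wt_sens r xs xs' i₀ h i hi)).trans
    (by norm_num)
  rw [abs_le]
  constructor <;> linarith [wt_nonneg r xs i₀, wt_nonneg r xs' i₀, wt_le_one r xs i₀,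
    wt_le_one r xs' i₀]

lemma cnt_of_wt (r : ℝ) (xs : Fin n → EuclideanSpace ℝ (Fin d)) (i : Fin n)
    (h : 0 < wt r xs i) : 7 * (n : ℝ) / 12 < cnt r xs i := by
  have hn : (0 : ℝ) < n := by exact_mod_cast i.pos
  unfold wt at h
  have h1 : 0 < min 1 (12 * (cnt r xs i : ℝ) / n - 7) := by
    rcases lt_max_iff.1 h with h | h
    · exact absurd h (lt_irrefl _)
    · exact h
  have h2 := (lt_min_iff.1 h1).2
  have h3 : 7 < 12 * (cnt r xs i : ℝ) / n := by linarith
  rw [lt_div_iff₀ hn] at h3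
  linarith

lemma core_dist (r : ℝ) (xs xs' : Fin n → EuclideanSpace ℝ (Fin d)) (i₀ : Fin n)
    (hn : 6 ≤ n) (h : ∀ i, i ≠ i₀ → xs i = xs' i) (i k : Fin n)
    (hi : 0 < wt r xs i) (hk : 0 < wt r xs' k) : dist (xs i) (xs' k) ≤ 4 * r := by
  have h1 := cnt_of_wt r xs i hi
  have h2 := cnt_of_wt r xs' k hk
  have hn' : (6 : ℝ) ≤ n := by exact_mod_cast hn
  have h3 : n + 1 < cnt r xs i + cnt r xs' k := by
    have : (n : ℝ) + 1 < cnt r xs i + cnt r xs' k := by linarith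
    exact_mod_cast this
  obtain ⟨j, hj, hA, hB⟩ := inter_ne _ _ i₀ h3
  simp only [Finset.mem_filter, Finset.mem_univ, true_and] at hA hB
  rw [← h j hj] at hB
  have := dist_triangle_right (xs i) (xs' k) (xs j)
  linarith

lemma ctr_sub (r : ℝ) (xs : Fin n → EuclideanSpace ℝ (Fin d)) (y : EuclideanSpace ℝ (Fin d))
    (h : 0 < tot r xs) : ctr r xs - y = (tot r xs)⁻¹ • ∑ i, wt r xs i • (xs i - y) := by
  simp only [smul_sub, Finset.sum_sub_distrib, ← Finset.sum_smul]
  rw [← tot, inv_smul_smul₀ h.ne', ctr]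

lemma sum_norm (r : ℝ) (xs : Fin n → EuclideanSpace ℝ (Fin d)) (y : EuclideanSpace ℝ (Fin d))
    (ρ : ℝ) (h : ∀ i, 0 < wt r xs i → dist (xs i) y ≤ ρ) :
    ‖∑ i, wt r xs i • (xs i - y)‖ ≤ tot r xs * ρ := by
  refine (norm_sum_le _ _).trans ?_
  rw [tot, Finset.sum_mul]
  refine Finset.sum_le_sum fun i _ => ?_
  rw [norm_smul, Real.norm_eq_abs, abs_of_nonneg (wt_nonneg r xs i), ← dist_eq_norm]
  rcases (wt_nonneg r xs i).eq_or_lt with h0 | h0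
  · rw [← h0]; simp
  · exact mul_le_mul_of_nonneg_left (h i h0) h0.le

lemma ctr_sens (r : ℝ) (hr : 0 < r) (xs xs' : Fin n → EuclideanSpace ℝ (Fin d)) (i₀ : Fin n)
    (hn : 6 ≤ n) (h : ∀ i, i ≠ i₀ → xs i = xs' i)
    (hW : (n : ℝ) / 3 ≤ tot r xs) (hW' : (n : ℝ) / 3 ≤ tot r xs') :
    ‖ctr r xs - ctr r xs'‖ ≤ 324 * r / n := by
  have hn' : (6 : ℝ) ≤ n := by exact_mod_cast hn
  have hp : 0 < tot r xs := by linarith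
  have hp' : 0 < tot r xs' := by linarith
  obtain ⟨k, -, hk⟩ : ∃ k ∈ Finset.univ, 0 < wt r xs k := by
    apply Finset.exists_lt_of_sum_lt (f := fun _ => (0 : ℝ))
    simpa [tot] using hp
  set y := xs k with hy
  have hc : ∀ i, 0 < wt r xs i → dist (xs i) y ≤ 4 * r := fun i hi =>
    core_dist r xs xs i₀ hn (fun _ _ => rfl) i k hi hk
  have hc' : ∀ i, 0 < wt r xs' i → dist (xs' i) y ≤ 4 * r := fun i hi =>
    core_dist r xs' xs i₀ hn (fun j hj => (h j hj).symm) i k hi hk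
  have nb : ∀ i, ‖wt r xs i • (xs i - y)‖ ≤ 4 * r := by
    intro i
    rw [norm_smul, Real.norm_eq_abs, abs_of_nonneg (wt_nonneg r xs i), ← dist_eq_norm]
    rcases (wt_nonneg r xs i).eq_or_lt with h0 | h0
    · rw [← h0]; linarith
    · nlinarith [hc i h0, wt_le_one r xs i, dist_nonneg (x := xs i) (y := y)]
  have nb' : ∀ i, ‖wt r xs' i • (xs' i - y)‖ ≤ 4 * r := by
    intro i
    rw [norm_smul, Real.norm_eq_abs, abs_of_nonneg (wt_nonneg r xs' i), ← dist_eq_norm]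
    rcases (wt_nonneg r xs' i).eq_or_lt with h0 | h0
    · rw [← h0]; linarith
    · nlinarith [hc' i h0, wt_le_one r xs' i, dist_nonneg (x := xs' i) (y := y)]
  set A := ∑ i, wt r xs i • (xs i - y) with hA
  set B := ∑ i, wt r xs' i • (xs' i - y) with hB
  have hAB : ‖A - B‖ ≤ 56 * r := by
    rw [hA, hB, ← Finset.sum_sub_distrib]
    refine (norm_sum_le _ _).trans ?_
    refine (sum_bound n _ i₀ (48 * r) (8 * r) (by positivity) ?_ ?_).trans (by linarith)
    · refine (norm_sub_le _ _).trans ?_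
      linarith [nb i₀, nb' i₀]
    · intro i hi
      have hs := wt_sens r xs xs' i₀ h i hi
      have e : wt r xs i • (xs i - y) - wt r xs' i • (xs' i - y) =
          (wt r xs i - wt r xs' i) • (xs i - y) := by
        rw [← h i hi, sub_smul]
      rw [e, norm_smul, Real.norm_eq_abs]
      have e2 : 48 * r / n = 12 / n * (4 * r) := by ring
      rw [e2]
      rcases (wt_nonneg r xs i).eq_or_lt with h0 | h0
      · rcases (wt_nonneg r xs' i).eq_or_lt with h1 | h1
        · rw [← h0, ← h1]; simp; positivity
        · apply mul_le_mul hs _ (norm_nonneg _) (by positivity)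
          rw [h i hi, ← dist_eq_norm]; exact hc' i h1
      · apply mul_le_mul hs _ (norm_nonneg _) (by positivity)
        rw [← dist_eq_norm]; exact hc i h0
  have hBn : ‖B‖ ≤ tot r xs' * (4 * r) := sum_norm r xs' y (4 * r) hc'
  have ht := tot_sens r xs xs' i₀ h
  have e : ctr r xs - ctr r xs' = (tot r xs)⁻¹ • ((A - B) +
      ((tot r xs' - tot r xs) * (tot r xs')⁻¹) • B) := by
    have : ctr r xs - ctr r xs' = (ctr r xs - y) - (ctr r xs' - y) := by abel
    rw [this, ctr_sub r xs y hp, ctr_sub r xs' y hp', ← hA, ← hB]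
    rw [smul_add, smul_sub, smul_smul]
    have : (tot r xs)⁻¹ * ((tot r xs' - tot r xs) * (tot r xs')⁻¹) =
        (tot r xs)⁻¹ - (tot r xs')⁻¹ := by field_simp
    rw [this, sub_smul]; abel
  have hb2 : ‖((tot r xs' - tot r xs) * (tot r xs')⁻¹) • B‖ ≤ 52 * r := by
    rw [norm_smul, norm_mul, Real.norm_eq_abs, abs_sub_comm, Real.norm_eq_abs,
      abs_of_pos (inv_pos.2 hp')]
    calc |tot r xs - tot r xs'| * (tot r xs')⁻¹ * ‖B‖ ≤
        13 * (tot r xs')⁻¹ * (tot r xs' * (4 * r)) := by gcongr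
      _ = 52 * r := by field_simp; ring
  rw [e, norm_smul, Real.norm_eq_abs, abs_of_pos (inv_pos.2 hp)]
  calc (tot r xs)⁻¹ * ‖A - B + ((tot r xs' - tot r xs) * (tot r xs')⁻¹) • B‖ ≤
      ((n : ℝ) / 3)⁻¹ * (56 * r + 52 * r) := by
        gcongr
        exact (norm_add_le _ _).trans (add_le_add hAB hb2)
    _ = 324 * r / n := by field_simp; ring

lemma util (r : ℝ) (xs : Fin n → EuclideanSpace ℝ (Fin d)) (x : EuclideanSpace ℝ (Fin d))
    (hn : 6 ≤ n)
    (h : (2 * (n : ℝ) / 3) ≤ ((Finset.univ.filter (fun i => dist (xs i) x ≤ r)).card : ℝ)) :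
    2 * (n : ℝ) / 3 ≤ tot r xs ∧ dist (ctr r xs) x ≤ 3 * r := by
  have hn' : (6 : ℝ) ≤ n := by exact_mod_cast hn
  set F := Finset.univ.filter (fun i => dist (xs i) x ≤ r) with hF
  have hw : ∀ i ∈ F, wt r xs i = 1 := by
    intro i hi
    have hi' : dist (xs i) x ≤ r := (Finset.mem_filter.1 hi).2
    have hsub : F.card ≤ cnt r xs i := by
      apply Finset.card_le_card
      intro j hj
      have hj' : dist (xs j) x ≤ r := (Finset.mem_filter.1 hj).2
      simp only [Finset.mem_filter, Finset.mem_univ, true_and]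
      linarith [dist_triangle_right (xs i) (xs j) x]
    have h2 : 2 * (n : ℝ) / 3 ≤ cnt r xs i := h.trans (by exact_mod_cast hsub)
    unfold wt
    rw [min_eq_left, max_eq_right zero_le_one]
    have : 8 ≤ 12 * (cnt r xs i : ℝ) / n := by
      rw [le_div_iff₀ (by linarith)]; linarith
    linarith
  have hW : 2 * (n : ℝ) / 3 ≤ tot r xs := by
    calc _ ≤ (F.card : ℝ) := h
      _ = ∑ i ∈ F, wt r xs i := by rw [Finset.sum_congr rfl hw]; simp
      _ ≤ _ := Finset.sum_le_sum_of_subset_of_nonneg (Finset.subset_univ _)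
          (fun i _ _ => wt_nonneg r xs i)
  refine ⟨hW, ?_⟩
  have hp : 0 < tot r xs := by linarith
  have hc : ∀ i, 0 < wt r xs i → dist (xs i) x ≤ 3 * r := by
    intro i hi
    have h1 := cnt_of_wt r xs i hi
    have h3 : n + 1 < cnt r xs i + F.card := by
      have : (n : ℝ) + 1 < cnt r xs i + F.card := by linarith
      exact_mod_cast this
    obtain ⟨j, -, hA, hB⟩ := inter_ne _ _ i h3
    simp only [hF, Finset.mem_filter, Finset.mem_univ, true_and] at hA hB
    linarith [dist_triangle (xs i) (xs j) x]
  rw [dist_eq_norm, ctr_sub r xs x hp, norm_smul, Real.norm_eq_abs, abs_of_pos (inv_pos.2 hp)]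
  calc _ ≤ (tot r xs)⁻¹ * (tot r xs * (3 * r)) := by
        gcongr; exact sum_norm r xs x (3 * r) hc
    _ = 3 * r := by field_simp

end core

section prob

noncomputable def lg (u : ℝ) : ℝ := (1 + Real.exp (-u))⁻¹

noncomputable def pr (δ u : ℝ) : ℝ := max 0 (min 1 ((1 + 2 * δ) * lg u - δ))

lemma lg_neg (u : ℝ) : 1 - lg u = lg (-u) := by
  unfold lg
  rw [neg_neg, Real.exp_neg]
  have := Real.exp_pos u
  field_simp
  ring

lemma lg_le (u u' ε : ℝ) (h : u - u' ≤ ε) (hε : 0 ≤ ε) : lg u ≤ Real.exp ε * lg u' := by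
  unfold lg
  rw [← div_eq_mul_inv, inv_eq_one_div, div_le_div_iff₀ (by positivity) (by positivity)]
  have h1 : Real.exp (-u') ≤ Real.exp ε * Real.exp (-u) := by
    rw [← Real.exp_add]; apply Real.exp_le_exp.2; linarith
  have h2 : 1 ≤ Real.exp ε := Real.one_le_exp hε
  nlinarith

lemma pr_nonneg (δ u : ℝ) : 0 ≤ pr δ u := le_max_left _ _
lemma pr_le_one (δ u : ℝ) : pr δ u ≤ 1 := max_le zero_le_one (min_le_left _ _)

lemma pr_neg (δ u : ℝ) : 1 - pr δ u = pr δ (-u) := by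
  unfold pr
  rw [← lg_neg]
  have : (1 + 2 * δ) * (1 - lg u) - δ = 1 - ((1 + 2 * δ) * lg u - δ) := by ring
  rw [this]
  generalize (1 + 2 * δ) * lg u - δ = a
  rcases max_cases 0 (min 1 a) with ⟨h1, _⟩ | ⟨h1, _⟩ <;>
    rcases max_cases 0 (min 1 (1 - a)) with ⟨h2, _⟩ | ⟨h2, _⟩ <;>
    rcases min_cases 1 a with ⟨h3, _⟩ | ⟨h3, _⟩ <;>
    rcases min_cases 1 (1 - a) with ⟨h4, _⟩ | ⟨h4, _⟩ <;> rw [h1, h2] <;> linarith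

lemma pr_le (δ u u' ε : ℝ) (hδ : 0 < δ) (h : u - u' ≤ ε) (hε : 0 ≤ ε)
    (hε2 : Real.exp ε ≤ 2) : pr δ u ≤ Real.exp ε * pr δ u' + δ := by
  have h1 := lg_le u u' ε h hε
  have h2 : 1 ≤ Real.exp ε := Real.one_le_exp hε
  unfold pr
  have h3 : (1 + 2 * δ) * lg u - δ ≤ Real.exp ε * ((1 + 2 * δ) * lg u' - δ) + δ := by nlinarith
  generalize (1 + 2 * δ) * lg u - δ = a at *
  generalize (1 + 2 * δ) * lg u' - δ = b at *
  generalize Real.exp ε = e at *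
  rcases le_total b 0 with hb | hb
  · have : e * b ≤ 0 := by nlinarith
    have h5 : max 0 (min 1 a) ≤ δ := max_le hδ.le ((min_le_right _ _).trans (by linarith))
    have h6 : 0 ≤ e * max 0 (min 1 b) := mul_nonneg (by linarith) (le_max_left _ _)
    linarith
  · have h0 : 0 ≤ e * b := by nlinarith
    rw [max_eq_right (le_min zero_le_one hb)]
    rcases le_total 1 b with hb1 | hb1
    · rw [min_eq_left hb1]
      exact max_le (by linarith) ((min_le_left _ _).trans (by linarith))
    · rw [min_eq_right hb1]
      exact max_le (by linarith) ((min_le_right _ _).trans (by linarith))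

lemma pr_zero (δ u : ℝ) (hδ : 0 < δ) (hδ1 : δ ≤ 1 / 3) (h : u ≤ -(2 * Real.log (1 / δ))) :
    pr δ u = 0 := by
  unfold pr
  apply max_eq_left
  apply (min_le_right _ _).trans
  have h1 : δ⁻¹ ^ 2 ≤ Real.exp (-u) := by
    calc δ⁻¹ ^ 2 = Real.exp (2 * Real.log (1 / δ)) := by
          rw [two_mul, Real.exp_add, Real.exp_log (by positivity), one_div, sq]
      _ ≤ _ := Real.exp_le_exp.2 (by linarith)
  have h3 : 3 ≤ δ⁻¹ := by
    rw [le_inv_comm₀ (by norm_num) hδ]; linarith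
  have h2 : lg u ≤ δ / (1 + 2 * δ) := by
    unfold lg
    rw [inv_eq_one_div, div_le_div_iff₀ (by positivity) (by positivity)]
    have : δ * δ⁻¹ = 1 := by field_simp
    have h4 : δ * δ⁻¹ ^ 2 = δ⁻¹ := by field_simp
    nlinarith
  rw [le_div_iff₀ (by positivity)] at h2
  linarith

lemma pr_one (δ u : ℝ) (hδ : 0 < δ) (hδ1 : δ ≤ 1 / 3) (h : 2 * Real.log (1 / δ) ≤ u) :
    pr δ u = 1 := by
  have := pr_neg δ (-u)
  rw [pr_zero δ (-u) hδ hδ1 (by linarith), neg_neg] at this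
  linarith
end prob

lemma mix_le (e p p' δ : ℝ) (he : 1 ≤ e) (he2 : e ≤ 2) (hδ : 0 < δ) (hp : 0 ≤ p) (hp1 : p ≤ 1)
    (hp' : 0 ≤ p') (hp1' : p' ≤ 1)
    (h1 : p ≤ e * p' + δ) (h2 : 1 - p ≤ e * (1 - p') + δ) (g g' q : ℝ)
    (hg : g ≤ 1) (hg0' : 0 ≤ g') (hg' : g' ≤ 1) (hq : 0 ≤ q) (hq1 : q ≤ 1)
    (h : p ≠ 0 → p' ≠ 0 → g ≤ e * g' + δ) :
    p * g + (1 - p) * q ≤ e ^ 2 * (p' * g' + (1 - p') * q) + 4 * δ := by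
  have hb : (1 - p) * q ≤ e ^ 2 * ((1 - p') * q) + δ := by
    have t1 : (1 - p) * q ≤ (e * (1 - p') + δ) * q := mul_le_mul_of_nonneg_right h2 hq
    have t2 : 0 ≤ (1 - p') * q := mul_nonneg (by linarith) hq
    have t3 : e * ((1 - p') * q) ≤ e ^ 2 * ((1 - p') * q) :=
      mul_le_mul_of_nonneg_right (by nlinarith) t2
    nlinarith
  have ha : p * g ≤ e ^ 2 * (p' * g') + 3 * δ := by
    have t0 : 0 ≤ e ^ 2 * (p' * g') := by positivity
    by_cases c1 : p = 0
    · rw [c1]; linarith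
    by_cases c2 : p' = 0
    · rw [c2] at h1 ⊢
      nlinarith
    have h3 := h c1 c2
    have t1 : p * g ≤ p * (e * g' + δ) := mul_le_mul_of_nonneg_left h3 hp
    have t2 : p * (e * g') ≤ (e * p' + δ) * (e * g') :=
      mul_le_mul_of_nonneg_right h1 (by positivity)
    have t3 : δ * (e * g') ≤ δ * 2 := mul_le_mul_of_nonneg_left (by nlinarith) hδ.le
    nlinarith
  linarith

lemma mix_dp {E : Type*} [MeasurableSpace E] (ε p p' δ : ℝ) (hε : 0 ≤ ε)
    (he2 : Real.exp ε ≤ 2) (hδ : 0 < δ) (hp : 0 ≤ p) (hp1 : p ≤ 1)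
    (hp' : 0 ≤ p') (hp1' : p' ≤ 1)
    (h1 : p ≤ Real.exp ε * p' + δ) (h2 : 1 - p ≤ Real.exp ε * (1 - p') + δ)
    (G G' Q : Measure E) [IsProbabilityMeasure G] [IsProbabilityMeasure G']
    [IsProbabilityMeasure Q] (S : Set E)
    (h : p ≠ 0 → p' ≠ 0 → G S ≤ ENNReal.ofReal (Real.exp ε) * G' S + ENNReal.ofReal δ) :
    (ENNReal.ofReal p • G + ENNReal.ofReal (1 - p) • Q) S ≤
      ENNReal.ofReal (Real.exp (2000 * ε)) *
        (ENNReal.ofReal p' • G' + ENNReal.ofReal (1 - p') • Q) S +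
      ENNReal.ofReal (2000 * δ) := by
  have c : ∀ (μ : Measure E) [IsProbabilityMeasure μ], μ S = ENNReal.ofReal (μ.real S) := by
    intro μ _; rw [ofReal_measureReal]
  simp only [Measure.add_apply, Measure.smul_apply, smul_eq_mul]
  rw [c G, c G'] at h
  rw [c G, c G', c Q]
  have b1 : G.real S ≤ 1 := measureReal_le_one
  have b2 : G'.real S ≤ 1 := measureReal_le_one
  have b3 : Q.real S ≤ 1 := measureReal_le_one
  have a1 : 0 ≤ G.real S := measureReal_nonneg
  have a2 : 0 ≤ G'.real S := measureReal_nonneg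
  have a3 : 0 ≤ Q.real S := measureReal_nonneg
  generalize G.real S = g at *
  generalize G'.real S = g' at *
  generalize Q.real S = q at *
  have hp2 : 0 ≤ 1 - p := by linarith
  have hp2' : 0 ≤ 1 - p' := by linarith
  rw [← ENNReal.ofReal_mul hp, ← ENNReal.ofReal_mul hp2, ← ENNReal.ofReal_mul hp',
    ← ENNReal.ofReal_mul hp2', ← ENNReal.ofReal_add (by positivity) (by positivity),
    ← ENNReal.ofReal_add (by positivity) (by positivity), ← ENNReal.ofReal_mul (by positivity),
    ← ENNReal.ofReal_add (by positivity) (by positivity)]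
  apply ENNReal.ofReal_le_ofReal
  have := mix_le (Real.exp ε) p p' δ (Real.one_le_exp hε) he2 hδ hp hp1 hp' hp1' h1 h2 g g' q
    b1 a2 b2 a3 b3 (by
      intro n1 n2
      have h3 := h n1 n2
      rw [← ENNReal.ofReal_mul (by positivity), ← ENNReal.ofReal_add (by positivity) hδ.le,
        ENNReal.ofReal_le_ofReal_iff (by positivity)] at h3
      exact h3)
  refine this.trans ?_
  have e2 : Real.exp ε ^ 2 ≤ Real.exp (2000 * ε) := by
    rw [← Real.exp_nat_mul]; apply Real.exp_le_exp.2; push_cast; linarith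
  gcongr
  linarith

lemma one_le_log_inv (a : ℝ) (h : 0 < a) (h3 : a ≤ 1 / 3) : 1 ≤ Real.log (1 / a) := by
  rw [Real.le_log_iff_exp_le (by positivity)]
  have : (3 : ℝ) ≤ 1 / a := by rw [le_div_iff₀ h]; linarith
  linarith [Real.exp_one_lt_d9]

lemma radius_bound (ε δ α r : ℝ) (d n : ℕ) (hε : 0 < ε) (hδ : 0 < δ) (hδ3 : δ ≤ 1 / 3)
    (hα : 0 < α) (hα3 : α ≤ 1 / 3) (hd : 1 ≤ d) (hr : 0 < r) (hn : 1 ≤ n)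
    (hn2 : (n : ℝ) ≤ Real.sqrt d * (1/ε) * Real.log (1/δ)) :
    3 * r + 4 * (324 * r / n) / ε * Real.sqrt (Real.log (1 / δ)) *
        Real.sqrt (d + Real.log (1 / α)) ≤
      2000 * r * Real.sqrt d * (1/ε) * Real.log ((d : ℝ)/δ) *
                Real.sqrt (Real.log (1/δ)) *
                Real.sqrt (Real.log ((d : ℝ) * n / α)) / n := by
  have hd' : (1 : ℝ) ≤ d := by exact_mod_cast hd
  have hn' : (1 : ℝ) ≤ n := by exact_mod_cast hn
  have hnpos : (0 : ℝ) < n := by linarith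
  have hl := one_le_log_inv δ hδ hδ3
  have ha := one_le_log_inv α hα hα3
  have hld : Real.log (1 / δ) ≤ Real.log (d / δ) := by
    apply Real.log_le_log (by positivity); gcongr
  have hla : Real.log (1 / α) ≤ Real.log (d * n / α) := by
    apply Real.log_le_log (by positivity); gcongr; nlinarith
  set l := Real.log (1 / δ)
  set L := Real.log (d / δ)
  set a := Real.log (1 / α)
  set A := Real.log (d * n / α)
  have hsq : Real.sqrt (d + a) ≤ 3 / 2 * (Real.sqrt d * Real.sqrt A) := by
    rw [← Real.sqrt_mul (by linarith)]
    have : (3 / 2 : ℝ) = Real.sqrt (9 / 4) := by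
      rw [show (9 / 4 : ℝ) = (3 / 2) ^ 2 by norm_num, Real.sqrt_sq (by norm_num)]
    rw [this, ← Real.sqrt_mul (by norm_num)]
    apply Real.sqrt_le_sqrt
    nlinarith [mul_nonneg (sub_nonneg.2 hd') (sub_nonneg.2 (ha.trans hla))]
  have hA1 : 1 ≤ Real.sqrt A := Real.one_le_sqrt.2 (ha.trans hla)
  have hl1 : 1 ≤ Real.sqrt l := Real.one_le_sqrt.2 hl
  set X := Real.sqrt d * (1 / ε) / n with hX
  have hX0 : 0 < X := by positivity
  have hXl : 1 ≤ X * l := by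
    rw [hX, div_mul_eq_mul_div, le_div_iff₀ hnpos]; linarith
  have e1 : 2000 * r * Real.sqrt d * (1/ε) * L * Real.sqrt l * Real.sqrt A / n =
      2000 * r * (X * L * Real.sqrt l * Real.sqrt A) := by rw [hX]; ring
  have e2 : 4 * (324 * r / n) / ε * Real.sqrt l * Real.sqrt (d + a) ≤
      1944 * r * (X * Real.sqrt l * Real.sqrt A) := by
    calc _ ≤ 4 * (324 * r / n) / ε * Real.sqrt l * (3 / 2 * (Real.sqrt d * Real.sqrt A)) := by
          gcongr
      _ = _ := by rw [hX]; ring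
  have e3 : X * Real.sqrt l * Real.sqrt A ≤ X * L * Real.sqrt l * Real.sqrt A := by
    gcongr
    nlinarith
  have e4 : 1 ≤ X * L * Real.sqrt l * Real.sqrt A := by
    have : 1 ≤ X * L := by nlinarith
    have h2 : 1 ≤ X * L * Real.sqrt l := by nlinarith
    nlinarith
  rw [e1]
  nlinarith [mul_le_mul_of_nonneg_left e3 hr.le, mul_le_mul_of_nonneg_left e4 hr.le]

/-- Theorem (interpolation regime): for suitable absolute constants `C, C', d₀`, for all
`0 < ε, δ, α ≤ 1/3`, `d ≥ d₀`, `r > 0` and `C·(1/ε)·log(1/δ) ≤ n ≤ √d·(1/ε)·log(1/δ)`,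
there is an `(C'ε, C'δ)` (item-level) differentially private mechanism on `n` points in
`ℝ^d` that, whenever at least `2n/3` of the points lie within distance `r` of some point
`x`, outputs with probability at least `1 − α` a point within
`C'·r·√d·(1/ε)·log(d/δ)·√(log(1/δ))·√(log(dn/α))/n` of `x`. -/
theorem stmt_19 :
    ∃ C C' : ℝ, ∃ d₀ : ℕ, 1 ≤ C ∧ 1 ≤ C' ∧
      ∀ ε δ α : ℝ, 0 < ε → ε ≤ 1/3 → 0 < δ → δ ≤ 1/3 → 0 < α → α ≤ 1/3 →
      ∀ d : ℕ, d₀ ≤ d → ∀ r : ℝ, 0 < r →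
      ∀ n : ℕ, C * (1/ε) * Real.log (1/δ) ≤ (n : ℝ) →
        (n : ℝ) ≤ Real.sqrt d * (1/ε) * Real.log (1/δ) →
      ∃ M : (Fin n → EuclideanSpace ℝ (Fin d)) → Measure (EuclideanSpace ℝ (Fin d)),
        (∀ xs, IsProbabilityMeasure (M xs)) ∧
        (∀ xs xs' : Fin n → EuclideanSpace ℝ (Fin d),
          (∃ i₀, ∀ i, i ≠ i₀ → xs i = xs' i) →
          ∀ S : Set (EuclideanSpace ℝ (Fin d)), MeasurableSet S →
            M xs S ≤ ENNReal.ofReal (Real.exp (C' * ε)) * M xs' S +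
              ENNReal.ofReal (C' * δ)) ∧
        (∀ (xs : Fin n → EuclideanSpace ℝ (Fin d)) (x : EuclideanSpace ℝ (Fin d)),
          (2 * (n : ℝ) / 3) ≤
            ((Finset.univ.filter (fun i => dist (xs i) x ≤ r)).card : ℝ) →
          ENNReal.ofReal (1 - α) ≤
            M xs (closedBall x
              (C' * r * Real.sqrt d * (1/ε) * Real.log ((d : ℝ)/δ) *
                Real.sqrt (Real.log (1/δ)) *
                Real.sqrt (Real.log ((d : ℝ) * n / α)) / n))) := by
  refine ⟨200, 2000, 1, by norm_num, by norm_num, ?_⟩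
  intro ε δ α hε hε3 hδ hδ3 hα hα3 d hd r hr n hn1 hn2
  have hl := one_le_log_inv δ hδ hδ3
  set l := Real.log (1 / δ) with hldef
  have hnε : 200 * l ≤ n * ε := by
    have : 200 * (1 / ε) * l * ε ≤ n * ε := mul_le_mul_of_nonneg_right hn1 hε.le
    have e : 200 * (1 / ε) * l * ε = 200 * l := by field_simp
    linarith
  have hn6' : (6 : ℝ) ≤ n := by nlinarith [(Nat.cast_nonneg n : (0 : ℝ) ≤ n)]
  have hn6 : 6 ≤ n := by exact_mod_cast hn6'
  have hnpos : (0 : ℝ) < n := by linarith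
  have he2 : Real.exp ε ≤ 2 := by
    have h1 : ε ≤ Real.log 2 := by linarith [Real.log_two_gt_d9]
    calc Real.exp ε ≤ Real.exp (Real.log 2) := Real.exp_le_exp.2 h1
      _ = 2 := Real.exp_log (by norm_num)
  set Δ := 324 * r / n with hΔ
  have hΔpos : 0 < Δ := by positivity
  set b := ε ^ 2 / (8 * l * Δ ^ 2) with hb
  have hbpos : 0 < b := by positivity
  set u : (Fin n → EuclideanSpace ℝ (Fin d)) → ℝ :=
    fun xs => ε / 13 * (tot r xs - n / 2) with hu
  have hprob : ∀ m, IsProbabilityMeasure (gm d b m) := gm_prob b hbpos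
  refine ⟨fun xs => ENNReal.ofReal (pr δ (u xs)) • gm d b (ctr r xs) +
    ENNReal.ofReal (1 - pr δ (u xs)) • Measure.dirac 0, ?_, ?_, ?_⟩
  · intro xs
    constructor
    simp only [Measure.add_apply, Measure.smul_apply, smul_eq_mul, measure_univ, mul_one]
    rw [← ENNReal.ofReal_add (pr_nonneg _ _) (by linarith [pr_le_one δ (u xs)])]
    simp
  · rintro xs xs' ⟨i₀, h⟩ S hS
    have ht := abs_le.1 (tot_sens r xs xs' i₀ h)
    have hbig : ∀ ys : Fin n → EuclideanSpace ℝ (Fin d), pr δ (u ys) ≠ 0 →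
        (n : ℝ) / 3 ≤ tot r ys := by
      intro ys hy
      by_contra hlt
      push Not at hlt
      apply hy
      apply pr_zero δ _ hδ hδ3
      simp only [hu]
      nlinarith
    apply mix_dp ε _ _ δ hε.le he2 hδ (pr_nonneg _ _) (pr_le_one _ _) (pr_nonneg _ _)
      (pr_le_one _ _)
    · apply pr_le δ _ _ ε hδ _ hε.le he2
      simp only [hu]
      nlinarith
    · rw [pr_neg, pr_neg]
      apply pr_le δ _ _ ε hδ _ hε.le he2
      simp only [hu]
      nlinarith
    · intro h1 h2
      have hs := ctr_sens r hr xs xs' i₀ hn6 h (hbig _ h1) (hbig _ h2)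
      refine (gm_dp b ε (2 * l / ε) hbpos (by positivity) (ctr r xs) (ctr r xs') S hS).trans ?_
      gcongr
      rw [← Real.exp_log hδ]
      apply Real.exp_le_exp.2
      have hlog : Real.log δ = -l := by rw [hldef, one_div, Real.log_inv, neg_neg]
      rw [hlog]
      have hD : b * ‖ctr r xs - ctr r xs'‖ ^ 2 ≤ ε ^ 2 / (8 * l) := by
        calc _ ≤ b * Δ ^ 2 := by gcongr
          _ = _ := by rw [hb]; field_simp
      have ht1 : 1 ≤ 2 * l / ε := by rw [le_div_iff₀ hε]; linarith
      have e1 : 2 * l / ε * ε = 2 * l := by field_simp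
      have e2 : ε ^ 2 / (8 * l) * (2 * (2 * l / ε) ^ 2) = l := by field_simp; norm_num
      have e3 : b * ‖ctr r xs - ctr r xs'‖ ^ 2 * (2 * l / ε + (2 * l / ε) ^ 2) ≤
          ε ^ 2 / (8 * l) * (2 * (2 * l / ε) ^ 2) := by
        apply mul_le_mul hD _ (by positivity) (by positivity)
        nlinarith
      linarith
  · intro xs x hx
    obtain ⟨hW, hdist⟩ := util r xs x hn6 hx
    have hp1 : pr δ (u xs) = 1 := by
      apply pr_one δ _ hδ hδ3
      simp only [hu]
      nlinarith
    simp only [hp1, ENNReal.ofReal_one, one_smul, sub_self, ENNReal.ofReal_zero, zero_smul,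
      add_zero]
    have hrad := radius_bound ε δ α r d n hε hδ hδ3 hα hα3 hd hr (by omega) hn2
    set R := 2000 * r * Real.sqrt d * (1/ε) * Real.log ((d : ℝ)/δ) *
                Real.sqrt (Real.log (1/δ)) *
                Real.sqrt (Real.log ((d : ℝ) * n / α)) / n
    have ha := one_le_log_inv α hα hα3
    set a := Real.log (1 / α) with hadef
    set T := 2 * (d + a) / b with hT
    have htail := gm_tail b hbpos (ctr r xs) T
    have hval : Real.exp (d - b / 2 * T) = α := by
      have : d - b / 2 * T = Real.log α := by
        rw [hT, hadef, one_div, Real.log_inv]; field_simp; ring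
      rw [this, Real.exp_log hα]
    rw [hval] at htail
    set B := {z : EuclideanSpace ℝ (Fin d) | T < ‖z - ctr r xs‖ ^ 2} with hB
    have hBm : MeasurableSet B := measurableSet_lt measurable_const (by fun_prop)
    have hsqrt : Real.sqrt T = 4 * Δ / ε * Real.sqrt l * Real.sqrt (d + a) := by
      have : T = (4 * Δ / ε) ^ 2 * (l * (d + a)) := by
        rw [hT, hb]; field_simp; norm_num
      rw [this, Real.sqrt_mul (by positivity), Real.sqrt_sq (by positivity),
        Real.sqrt_mul (by positivity)]
      ring
    have hsub : Bᶜ ⊆ closedBall x R := by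
      intro z hz
      have hz' : ‖z - ctr r xs‖ ^ 2 ≤ T := not_lt.1 hz
      have h1 : dist z (ctr r xs) ≤ Real.sqrt T := by
        rw [dist_eq_norm]; exact Real.le_sqrt_of_sq_le hz'
      rw [hsqrt] at h1
      rw [mem_closedBall]
      linarith [dist_triangle z (ctr r xs) x]
    refine le_trans ?_ (measure_mono hsub)
    rw [prob_compl_eq_one_sub hBm, ENNReal.ofReal_sub _ hα.le, ENNReal.ofReal_one]
    gcongr
end
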